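/- Let k ≥ 6 be an integer, and suppose that α ∈ ℝ, a ∈ ℤ and q ∈ ℕ satisfy gcd(a,q) = 1 and |α − a/q| ≤ q^{−2}. Then for every ε > 0 there is a constant C(k,ε) such that for all real X ≥ 1 one has |g_k(α;X)| ≤ C(k,ε) · ( X^{1+ε} · Θ^{2^{−k}} + X^{1+ε} · (Θ/X)^{(2/3)·2^{−k}} ), where Θ = q^{−1} + X^{−3} + q·X^{−k}. -/

import Mathlib

/-- The exponential sum `g k β X = ∑_{1 ≤ x ≤ X} e(β x^k)`. -/
noncomputable def gsum (k : ℕ) (β : ℝ) (X : ℝ) : ℂ :=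
  ∑ x ∈ Finset.Icc 1 ⌊X⌋₊,
    Complex.exp (2 * (Real.pi : ℂ) * Complex.I * ((β * (x : ℝ) ^ k : ℝ) : ℂ))

set_option linter.all false
namespace WW
open Finset

/-- e(x) -/
noncomputable def ee (x : ℝ) : ℂ := Complex.exp (2 * (Real.pi : ℂ) * Complex.I * ((x : ℝ) : ℂ))

lemma ee_add (x y : ℝ) : ee (x + y) = ee x * ee y := by
  unfold ee; rw [← Complex.exp_add]; congr 1; push_cast; ring

lemma ee_zero : ee 0 = 1 := by simp [ee]

lemma norm_ee (x : ℝ) : ‖ee x‖ = 1 := by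
  unfold ee
  rw [Complex.norm_exp]
  simp

lemma ee_int (n : ℤ) : ee n = 1 := by
  unfold ee
  rw [Complex.exp_eq_one_iff]
  exact ⟨n, by push_cast; ring⟩

lemma ee_add_int (x : ℝ) (n : ℤ) : ee (x + n) = ee x := by rw [ee_add, ee_int, mul_one]

lemma conj_ee (x : ℝ) : (starRingEnd ℂ) (ee x) = ee (-x) := by
  unfold ee
  rw [← Complex.exp_conj]
  congr 1
  simp only [map_mul, Complex.conj_I, Complex.conj_ofReal, map_ofNat]
  push_cast; ring

lemma ee_sum {ι : Type*} (s : Finset ι) (f : ι → ℝ) : ee (∑ i ∈ s, f i) = ∏ i ∈ s, ee (f i) := by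
  classical
  induction s using Finset.induction_on with
  | empty => simp [ee_zero]
  | insert a s ha ih => rw [sum_insert ha, prod_insert ha, ee_add, ih]

lemma ee_nat_mul (n : ℕ) (x : ℝ) : ee (n * x) = ee x ^ n := by
  induction n with
  | zero => simp [ee_zero]
  | succ n ih => push_cast; rw [add_mul, one_mul, ee_add, ih, pow_succ]

lemma ee_eq_one_iff (x : ℝ) : ee x = 1 ↔ ∃ n : ℤ, x = n := by
  constructor
  · intro h
    unfold ee at h
    rw [Complex.exp_eq_one_iff] at h
    obtain ⟨n, hn⟩ := h
    refine ⟨n, ?_⟩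
    have h2 : (2 * (Real.pi : ℂ) * Complex.I) ≠ 0 := by simp [Real.pi_ne_zero]
    have : (2 * (Real.pi : ℂ) * Complex.I) * (x : ℂ) = (2 * (Real.pi : ℂ) * Complex.I) * (n : ℂ) := by
      rw [hn]; ring
    have := mul_left_cancel₀ h2 this
    exact_mod_cast this
  · rintro ⟨n, rfl⟩; exact ee_int n

lemma orth1 (L : ℕ) (hL : 0 < L) (u : ℤ) :
    ∑ j ∈ range L, ee ((j : ℝ) * u / L) = if (L : ℤ) ∣ u then (L : ℂ) else 0 := by
  have hL' : (L : ℝ) ≠ 0 := by positivity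
  have e1 : ∀ j ∈ range L, ee ((j : ℝ) * u / L) = ee ((u : ℝ) / L) ^ j := by
    intro j _
    rw [mul_div_assoc, ee_nat_mul]
  rw [sum_congr rfl e1]
  split_ifs with h
  · obtain ⟨m, rfl⟩ := h
    have : ee (((L * m : ℤ) : ℝ) / L) = 1 := by
      rw [ee_eq_one_iff]; exact ⟨m, by push_cast; field_simp⟩
    rw [this]; simp
  · have hne : ee ((u : ℝ) / L) ≠ 1 := by
      rw [Ne, ee_eq_one_iff]
      rintro ⟨n, hn⟩
      apply h
      refine ⟨n, ?_⟩
      rw [div_eq_iff hL'] at hn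
      have : (u : ℝ) = ((L * n : ℤ) : ℝ) := by push_cast; linarith
      exact_mod_cast this
    rw [geom_sum_eq hne, ← ee_nat_mul]
    have : (L : ℝ) * ((u : ℝ) / L) = u := by field_simp
    rw [this, ee_int]; simp

/-- three dimensional orthogonality -/
lemma orth3 {σ τ : Type*} (S : Finset σ) (T : Finset τ) (c : σ → ℂ) (d : τ → ℂ)
    (L : Fin 3 → ℕ) (hL : ∀ i, 0 < L i) (Φ : σ → Fin 3 → ℤ) (Ψ : τ → Fin 3 → ℤ) :
    ∑ j ∈ Fintype.piFinset (fun i => range (L i)),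
      (∑ s ∈ S, c s * ee (∑ i, (j i : ℝ) * Φ s i / L i)) *
        (starRingEnd ℂ) (∑ t ∈ T, d t * ee (∑ i, (j i : ℝ) * Ψ t i / L i)) =
    (∏ i, (L i : ℂ)) * ∑ s ∈ S, ∑ t ∈ T,
      if (∀ i, (L i : ℤ) ∣ Φ s i - Ψ t i) then c s * (starRingEnd ℂ) (d t) else 0 := by
  have e1 : ∀ j ∈ Fintype.piFinset (fun i => range (L i)),
      (∑ s ∈ S, c s * ee (∑ i, (j i : ℝ) * Φ s i / L i)) *
        (starRingEnd ℂ) (∑ t ∈ T, d t * ee (∑ i, (j i : ℝ) * Ψ t i / L i)) =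
      ∑ s ∈ S, ∑ t ∈ T, (c s * (starRingEnd ℂ) (d t)) *
        ∏ i, ee ((j i : ℝ) * (Φ s i - Ψ t i : ℤ) / L i) := by
    intro j _
    rw [map_sum, sum_mul_sum]
    refine sum_congr rfl fun s _ => sum_congr rfl fun t _ => ?_
    rw [map_mul, conj_ee, ← ee_sum]
    have : ∑ i, (j i : ℝ) * ((Φ s i - Ψ t i : ℤ) : ℝ) / L i =
      (∑ i, (j i : ℝ) * Φ s i / L i) + - ∑ i, (j i : ℝ) * Ψ t i / L i := by
      rw [← sum_neg_distrib, ← sum_add_distrib]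
      refine sum_congr rfl fun i _ => ?_
      push_cast; ring
    rw [this, ee_add]; ring
  rw [sum_congr rfl e1, sum_comm, mul_sum]
  refine sum_congr rfl fun s _ => ?_
  rw [sum_comm, mul_sum]
  refine sum_congr rfl fun t _ => ?_
  rw [← mul_sum]
  have e2 := prod_univ_sum (fun i : Fin 3 => range (L i))
    (fun i j => ee ((j : ℝ) * (Φ s i - Ψ t i : ℤ) / L i))
  rw [← e2, prod_congr rfl (fun i _ => orth1 (L i) (hL i) _)]
  split_ifs with h
  · rw [prod_congr rfl (fun i _ => if_pos (h i))]; ring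
  · push Not at h
    obtain ⟨i, hi⟩ := h
    rw [prod_eq_zero (mem_univ i) (if_neg hi)]; simp

end WW

namespace WW
open Finset

def psum (x : Fin 6 → ℤ) (i : Fin 3) : ℤ := ∑ l, x l ^ ((i : ℕ) + 1)

def cnt (A A' : Fin 6 → Finset ℤ) : ℕ :=
  ((Fintype.piFinset A ×ˢ Fintype.piFinset A').filter (fun z => psum z.1 = psum z.2)).card

noncomputable def fs (L : ℕ) (A : Finset ℤ) (j : Fin 3 → ℕ) : ℂ :=
  ∑ x ∈ A, ee (∑ i : Fin 3, (j i : ℝ) * ((x ^ ((i : ℕ) + 1) : ℤ) : ℝ) / L)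

def GG (L : ℕ) : Finset (Fin 3 → ℕ) := Fintype.piFinset (fun _ : Fin 3 => range L)

lemma prod_fs (L : ℕ) (A : Fin 6 → Finset ℤ) (j : Fin 3 → ℕ) :
    ∏ l, fs L (A l) j = ∑ x ∈ Fintype.piFinset A, 1 * ee (∑ i, (j i : ℝ) * psum x i / L) := by
  unfold fs
  rw [prod_univ_sum]
  refine sum_congr rfl fun x _ => ?_
  rw [← ee_sum, one_mul]
  congr 1
  rw [sum_comm]
  refine sum_congr rfl fun i _ => ?_
  unfold psum
  push_cast
  rw [mul_sum, sum_div]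

lemma psum_bound (R : ℤ) (hR : 1 ≤ R) (x : Fin 6 → ℤ) (hx : ∀ l, |x l| ≤ R) (i : Fin 3) :
    |psum x i| ≤ 6 * R ^ 3 := by
  unfold psum
  calc |∑ l, x l ^ ((i : ℕ) + 1)| ≤ ∑ l : Fin 6, |x l ^ ((i : ℕ) + 1)| := abs_sum_le_sum_abs _ _
    _ ≤ ∑ l : Fin 6, R ^ 3 := by
        refine sum_le_sum fun l _ => ?_
        rw [abs_pow]
        calc |x l| ^ ((i : ℕ) + 1) ≤ R ^ ((i : ℕ) + 1) := pow_le_pow_left₀ (abs_nonneg _) (hx l) _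
          _ ≤ R ^ 3 := pow_le_pow_right₀ hR (by omega)
    _ = 6 * R ^ 3 := by simp

lemma exists_L (T : Finset ℤ) : ∃ L : ℕ, 0 < L ∧ ∀ A A' : Fin 6 → Finset ℤ,
    (∀ l, A l ⊆ T) → (∀ l, A' l ⊆ T) →
    ∑ j ∈ GG L, (∏ l, fs L (A l) j) * (starRingEnd ℂ) (∏ l, fs L (A' l) j) =
      (L : ℂ) ^ 3 * cnt A A' := by
  obtain ⟨R, hR1, hR⟩ : ∃ R : ℤ, 1 ≤ R ∧ ∀ x ∈ T, |x| ≤ R := by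
    refine ⟨1 + ∑ x ∈ T, |x|, ?_, ?_⟩
    · have : 0 ≤ ∑ x ∈ T, |x| := sum_nonneg fun _ _ => abs_nonneg _
      linarith
    · intro x hx
      have := single_le_sum (f := fun x : ℤ => |x|) (fun _ _ => abs_nonneg _) hx
      linarith
  have hRp : 0 < R ^ 3 := by positivity
  refine ⟨(12 * R ^ 3 + 1).toNat, by omega, ?_⟩
  set L := (12 * R ^ 3 + 1).toNat with hLdef
  have hL0 : 0 < L := by omega
  intro A A' hA hA'
  have hLR : (L : ℤ) = 12 * R ^ 3 + 1 := by omega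
  have := orth3 (Fintype.piFinset A) (Fintype.piFinset A') (fun _ => 1) (fun _ => 1)
    (fun _ => L) (fun _ => hL0) psum psum
  unfold GG
  simp_rw [prod_fs]
  rw [this]
  have e1 : (∏ i : Fin 3, (L : ℂ)) = (L : ℂ) ^ 3 := by simp
  rw [e1]
  congr 1
  unfold cnt
  rw [card_filter, sum_product]
  push_cast
  refine sum_congr rfl fun x hx => sum_congr rfl fun y hy => ?_
  rw [Fintype.mem_piFinset] at hx hy
  have hb : ∀ i, |psum x i - psum y i| < L := by
    intro i
    have h1 := psum_bound R hR1 x (fun l => hR _ (hA l (hx l))) i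
    have h2 := psum_bound R hR1 y (fun l => hR _ (hA' l (hy l))) i
    have := abs_sub (psum x i) (psum y i)
    omega
  have : (∀ i, (L : ℤ) ∣ psum x i - psum y i) ↔ psum x = psum y := by
    constructor
    · intro h
      funext i
      have := Int.eq_zero_of_abs_lt_dvd (h i) (hb i)
      omega
    · intro h i; rw [h]; simp
  simp only [this]
  simp

def V2 (A B : Finset ℤ) : ℕ := cnt ![A, A, B, B, B, B] ![A, A, B, B, B, B]
def V1 (A B : Finset ℤ) : ℕ := cnt ![A, B, B, B, B, B] ![A, B, B, B, B, B]
def V0 (A : Finset ℤ) : ℕ := cnt (fun _ => A) (fun _ => A)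

lemma real_rep (L : ℕ) (A : Fin 6 → Finset ℤ)
    (h : ∑ j ∈ GG L, (∏ l, fs L (A l) j) * (starRingEnd ℂ) (∏ l, fs L (A l) j) =
      (L : ℂ) ^ 3 * cnt A A) :
    (L : ℝ) ^ 3 * cnt A A = ∑ j ∈ GG L, (∏ l, ‖fs L (A l) j‖) ^ 2 := by
  have : ((∑ j ∈ GG L, (∏ l, ‖fs L (A l) j‖) ^ 2 : ℝ) : ℂ) = ((L : ℝ) ^ 3 * cnt A A : ℝ) := by
    push_cast
    rw [← h]
    refine sum_congr rfl fun j _ => ?_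
    rw [Complex.mul_conj, Complex.normSq_eq_norm_sq, norm_prod]
    push_cast; rfl
  exact_mod_cast this.symm

lemma exists_L2 (A B : Finset ℤ) : ∃ L : ℕ, 0 < L ∧
    (∀ A' B' : Finset ℤ, A' ⊆ A ∪ B → B' ⊆ A ∪ B →
    (L : ℝ) ^ 3 * V2 A' B' = ∑ j ∈ GG L, ‖fs L A' j‖ ^ 4 * ‖fs L B' j‖ ^ 8) ∧
    (L : ℝ) ^ 3 * V1 A B = ∑ j ∈ GG L, ‖fs L A j‖ ^ 2 * ‖fs L B j‖ ^ 10 ∧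
    (∀ A' : Finset ℤ, A' ⊆ A ∪ B →
    (L : ℝ) ^ 3 * V0 A' = ∑ j ∈ GG L, ‖fs L A' j‖ ^ 12) := by
  obtain ⟨L, hL, h⟩ := exists_L (A ∪ B)
  have hA : A ⊆ A ∪ B := subset_union_left
  have hB : B ⊆ A ∪ B := subset_union_right
  refine ⟨L, hL, ?_, ?_, ?_⟩
  · intro A' B' hA' hB'
    have hs : ∀ l : Fin 6, (![A', A', B', B', B', B'] : Fin 6 → Finset ℤ) l ⊆ A ∪ B := by
      intro l; fin_cases l <;> simpa
    unfold V2
    rw [real_rep L _ (h _ _ hs hs)]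
    refine sum_congr rfl fun j _ => ?_
    rw [Fin.prod_univ_six]; simp; ring
  · have hs : ∀ l : Fin 6, (![A, B, B, B, B, B] : Fin 6 → Finset ℤ) l ⊆ A ∪ B := by
      intro l; fin_cases l <;> simpa
    unfold V1
    rw [real_rep L _ (h _ _ hs hs)]
    refine sum_congr rfl fun j _ => ?_
    rw [Fin.prod_univ_six]; simp; ring
  · intro A' hA'
    unfold V0
    rw [real_rep L _ (h _ _ (fun _ => hA') (fun _ => hA'))]
    refine sum_congr rfl fun j _ => ?_
    simp; ring

lemma holder {ι : Type*} (s : Finset ι) (f g : ι → ℝ) (hf : ∀ i ∈ s, 0 ≤ f i)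
    (hg : ∀ i ∈ s, 0 ≤ g i) (θ : ℝ) (h0 : 0 < θ) (h1 : θ < 1) :
    ∑ i ∈ s, f i ^ θ * g i ^ (1 - θ) ≤ (∑ i ∈ s, f i) ^ θ * (∑ i ∈ s, g i) ^ (1 - θ) := by
  have hpq : Real.HolderConjugate (1 / θ) (1 / (1 - θ)) := by
    rw [Real.holderConjugate_iff]
    constructor
    · rw [lt_div_iff₀ h0]; linarith
    · simp
  have := Real.inner_le_Lp_mul_Lq_of_nonneg s hpq (f := fun i => f i ^ θ)
    (g := fun i => g i ^ (1 - θ)) (fun i hi => Real.rpow_nonneg (hf i hi) _)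
    (fun i hi => Real.rpow_nonneg (hg i hi) _)
  refine this.trans (le_of_eq ?_)
  have e1 : ∑ i ∈ s, (f i ^ θ) ^ (1 / θ) = ∑ i ∈ s, f i := by
    refine sum_congr rfl fun i hi => ?_
    rw [← Real.rpow_mul (hf i hi), mul_one_div_cancel h0.ne', Real.rpow_one]
  have e2 : ∑ i ∈ s, (g i ^ (1 - θ)) ^ (1 / (1 - θ)) = ∑ i ∈ s, g i := by
    refine sum_congr rfl fun i hi => ?_
    rw [← Real.rpow_mul (hg i hi), mul_one_div_cancel (by linarith), Real.rpow_one]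
  rw [e1, e2]; simp

lemma holderK {ι : Type*} (s : Finset ι) (f g : ι → ℝ) (hf : ∀ i ∈ s, 0 ≤ f i)
    (hg : ∀ i ∈ s, 0 ≤ g i) (θ : ℝ) (h0 : 0 < θ) (h1 : θ < 1) (K u v w : ℝ) (hK : 0 < K)
    (hv : 0 ≤ v) (hw : 0 ≤ w)
    (hu' : K * u = ∑ i ∈ s, f i ^ θ * g i ^ (1 - θ)) (hv' : K * v = ∑ i ∈ s, f i)
    (hw' : K * w = ∑ i ∈ s, g i) : u ≤ v ^ θ * w ^ (1 - θ) := by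
  have := holder s f g hf hg θ h0 h1
  rw [← hu', ← hv', ← hw', Real.mul_rpow hK.le hv, Real.mul_rpow hK.le hw] at this
  have e : K ^ θ * v ^ θ * (K ^ (1 - θ) * w ^ (1 - θ)) = K * (v ^ θ * w ^ (1 - θ)) := by
    have : K ^ θ * K ^ (1 - θ) = K := by rw [← Real.rpow_add hK]; simp
    calc _ = (K ^ θ * K ^ (1 - θ)) * (v ^ θ * w ^ (1 - θ)) := by ring
      _ = _ := by rw [this]
  rw [e] at this
  exact le_of_mul_le_mul_left this hK

lemma mono_rpow (a b : ℝ) (ha : 0 ≤ a) (hb : 0 ≤ b) (m n m' n' M N : ℕ) (θ : ℝ)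
    (h1 : (m : ℝ) * θ + m' * (1 - θ) = M) (h2 : (n : ℝ) * θ + n' * (1 - θ) = N)
    (hm : 0 < (m : ℝ) * θ) (hm' : 0 ≤ (m' : ℝ) * (1 - θ))
    (hn : 0 < (n : ℝ) * θ) (hn' : 0 ≤ (n' : ℝ) * (1 - θ)) :
    (a ^ m * b ^ n) ^ θ * (a ^ m' * b ^ n') ^ (1 - θ) = a ^ M * b ^ N := by
  rw [Real.mul_rpow (by positivity) (by positivity), Real.mul_rpow (by positivity) (by positivity)]
  rw [← Real.rpow_natCast a m, ← Real.rpow_natCast b n, ← Real.rpow_natCast a m',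
    ← Real.rpow_natCast b n', ← Real.rpow_mul ha, ← Real.rpow_mul hb, ← Real.rpow_mul ha,
    ← Real.rpow_mul hb, ← Real.rpow_natCast a M, ← Real.rpow_natCast b N, ← h1, ← h2,
    Real.rpow_add_of_nonneg ha hm.le hm', Real.rpow_add_of_nonneg hb hn.le hn']
  ring

lemma V2_le_a (A B : Finset ℤ) :
    (V2 A B : ℝ) ≤ (V2 B A : ℝ) ^ (1 / 3 : ℝ) * (V1 A B : ℝ) ^ (1 - 1 / 3 : ℝ) := by
  obtain ⟨L, hL, h2, h1, h0⟩ := exists_L2 A B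
  refine holderK (GG L) (fun j => ‖fs L A j‖ ^ 8 * ‖fs L B j‖ ^ 4)
    (fun j => ‖fs L A j‖ ^ 2 * ‖fs L B j‖ ^ 10) (fun _ _ => by positivity) (fun _ _ => by positivity)
    (1 / 3) (by norm_num) (by norm_num) ((L : ℝ) ^ 3) _ _ _ (by positivity) (by positivity)
    (by positivity) ?_ ?_ h1
  · rw [h2 A B subset_union_left subset_union_right]
    refine sum_congr rfl fun j _ => ?_
    rw [mono_rpow _ _ (norm_nonneg _) (norm_nonneg _) 8 4 2 10 4 8] <;> norm_num
  · rw [h2 B A subset_union_right subset_union_left]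
    refine sum_congr rfl fun j _ => ?_
    ring

lemma V1_le (A B : Finset ℤ) :
    (V1 A B : ℝ) ≤ (V2 B A : ℝ) ^ (1 / 4 : ℝ) * (V0 B : ℝ) ^ (1 - 1 / 4 : ℝ) := by
  obtain ⟨L, hL, h2, h1, h0⟩ := exists_L2 A B
  refine holderK (GG L) (fun j => ‖fs L A j‖ ^ 8 * ‖fs L B j‖ ^ 4)
    (fun j => ‖fs L A j‖ ^ 0 * ‖fs L B j‖ ^ 12) (fun _ _ => by positivity) (fun _ _ => by positivity)
    (1 / 4) (by norm_num) (by norm_num) ((L : ℝ) ^ 3) _ _ _ (by positivity) (by positivity)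
    (by positivity) ?_ ?_ ?_
  · rw [h1]
    refine sum_congr rfl fun j _ => ?_
    rw [mono_rpow _ _ (norm_nonneg _) (norm_nonneg _) 8 4 0 12 2 10] <;> norm_num
  · rw [h2 B A subset_union_right subset_union_left]
    refine sum_congr rfl fun j _ => ?_
    ring
  · rw [h0 B subset_union_right]
    refine sum_congr rfl fun j _ => ?_
    ring

lemma V2_le_0 (A B : Finset ℤ) :
    (V2 A B : ℝ) ≤ (V0 A : ℝ) ^ (1 / 3 : ℝ) * (V0 B : ℝ) ^ (1 - 1 / 3 : ℝ) := by
  obtain ⟨L, hL, h2, h1, h0⟩ := exists_L2 A B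
  refine holderK (GG L) (fun j => ‖fs L A j‖ ^ 12)
    (fun j => ‖fs L B j‖ ^ 12) (fun _ _ => by positivity) (fun _ _ => by positivity)
    (1 / 3) (by norm_num) (by norm_num) ((L : ℝ) ^ 3) _ _ _ (by positivity) (by positivity)
    (by positivity) ?_ (h0 A subset_union_left) (h0 B subset_union_right)
  rw [h2 A B subset_union_left subset_union_right]
  refine sum_congr rfl fun j _ => ?_
  rw [← Real.rpow_natCast _ 12, ← Real.rpow_natCast _ 12, ← Real.rpow_mul (norm_nonneg _),
    ← Real.rpow_mul (norm_nonneg _), ← Real.rpow_natCast _ 4, ← Real.rpow_natCast _ 8]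
  norm_num

/-- mixing -/
lemma cnt_mix (A : Fin 4 → Finset ℤ) (B : Finset ℤ) (U : ℝ) (hU : ∀ i, (V2 (A i) B : ℝ) ≤ U) :
    (cnt ![A 0, A 1, B, B, B, B] ![A 2, A 3, B, B, B, B] : ℝ) ≤ U := by
  obtain ⟨L, hL, h⟩ := exists_L ((univ.biUnion A) ∪ B)
  have hA : ∀ i, A i ⊆ (univ.biUnion A) ∪ B := fun i =>
    (subset_biUnion_of_mem A (mem_univ i)).trans subset_union_left
  have hB : B ⊆ (univ.biUnion A) ∪ B := subset_union_right
  have hs : ∀ a b l : Fin 6, ∀ A' B' : Finset ℤ, A' ⊆ (univ.biUnion A) ∪ B →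
      B' ⊆ (univ.biUnion A) ∪ B →
      (![A', B', B, B, B, B] : Fin 6 → Finset ℤ) l ⊆ (univ.biUnion A) ∪ B := by
    intro a b l A' B' h1 h2; fin_cases l <;> simpa
  have e2 : ∀ i, (L : ℝ) ^ 3 * V2 (A i) B = ∑ j ∈ GG L, ‖fs L (A i) j‖ ^ 4 * ‖fs L B j‖ ^ 8 := by
    intro i
    unfold V2
    rw [real_rep L _ (h _ _ (fun l => hs 0 0 l _ _ (hA i) (hA i)) (fun l => hs 0 0 l _ _ (hA i) (hA i)))]
    refine sum_congr rfl fun j _ => ?_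
    rw [Fin.prod_univ_six]; simp; ring
  have e3 := h ![A 0, A 1, B, B, B, B] ![A 2, A 3, B, B, B, B] (fun l => hs 0 0 l _ _ (hA _) (hA _))
    (fun l => hs 0 0 l _ _ (hA _) (hA _))
  have e4 : (L : ℝ) ^ 3 * cnt ![A 0, A 1, B, B, B, B] ![A 2, A 3, B, B, B, B] ≤
      ∑ j ∈ GG L, (1 / 4) * ∑ i, ‖fs L (A i) j‖ ^ 4 * ‖fs L B j‖ ^ 8 := by
    calc (L : ℝ) ^ 3 * cnt ![A 0, A 1, B, B, B, B] ![A 2, A 3, B, B, B, B]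
        = ‖(L : ℂ) ^ 3 * cnt ![A 0, A 1, B, B, B, B] ![A 2, A 3, B, B, B, B]‖ := by simp
      _ ≤ _ := by
        rw [← e3]
        refine (norm_sum_le _ _).trans (sum_le_sum fun j _ => ?_)
        rw [norm_mul, RCLike.norm_conj, norm_prod, norm_prod, Fin.prod_univ_six, Fin.prod_univ_six,
          Fin.sum_univ_four]
        simp only [Matrix.cons_val]
        have a0 := norm_nonneg (fs L (A 0) j)
        have a1 := norm_nonneg (fs L (A 1) j)
        have a2 := norm_nonneg (fs L (A 2) j)
        have a3 := norm_nonneg (fs L (A 3) j)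
        generalize ‖fs L (A 0) j‖ = x at *
        generalize ‖fs L (A 1) j‖ = y at *
        generalize ‖fs L (A 2) j‖ = z at *
        generalize ‖fs L (A 3) j‖ = w at *
        have key : x * y * z * w ≤ 1 / 4 * (x ^ 4 + y ^ 4 + z ^ 4 + w ^ 4) := by
          nlinarith [sq_nonneg (x * y - z * w), sq_nonneg (x ^ 2 - y ^ 2), sq_nonneg (z ^ 2 - w ^ 2)]
        have := mul_le_mul_of_nonneg_right key (by positivity : 0 ≤ ‖fs L B j‖ ^ 8)
        calc _ = x * y * z * w * ‖fs L B j‖ ^ 8 := by ring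
          _ ≤ _ := this
          _ = _ := by ring
  have e5 : ∑ j ∈ GG L, (1 / 4) * ∑ i, ‖fs L (A i) j‖ ^ 4 * ‖fs L B j‖ ^ 8 ≤ (L : ℝ) ^ 3 * U := by
    rw [← mul_sum, sum_comm, sum_congr rfl (fun i _ => (e2 i).symm)]
    rw [Fin.sum_univ_four]
    have : (0:ℝ) < (L : ℝ) ^ 3 := by positivity
    have := fun i => mul_le_mul_of_nonneg_left (hU i) this.le
    linarith [this 0, this 1, this 2, this 3]
  exact le_of_mul_le_mul_left (e4.trans e5) (by positivity)

end WW

namespace WW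
open Finset

noncomputable def cl (X m : ℕ) (ξ : ℤ) : Finset ℤ := (Icc 1 (X : ℤ)).filter (fun x => (m : ℤ) ∣ x - ξ)
noncomputable def JJ (X : ℕ) : ℕ := V0 (Icc 1 (X : ℤ))

lemma mem_cl {X m : ℕ} {ξ x : ℤ} : x ∈ cl X m ξ ↔ (1 ≤ x ∧ x ≤ X) ∧ (m : ℤ) ∣ x - ξ := by
  simp [cl]

lemma pointwise_cover (p : ℕ) (hp : 0 < p) (z : ℕ → ℂ) :
    ‖∑ i ∈ range p, z i‖ ^ 12 ≤ 2 ^ 12 * ∑ i ∈ range p, ‖z i‖ ^ 12 +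
      (2 * p) ^ 12 * ∑ i ∈ range p, ∑ j ∈ (range p).erase i, ‖z i‖ ^ 4 * ‖z j‖ ^ 8 := by
  obtain ⟨i0, hi0, hmax⟩ := exists_max_image (range p) (fun i => ‖z i‖) ⟨0, by simpa⟩
  have n1 : (0:ℝ) ≤ ∑ i ∈ range p, ‖z i‖ ^ 12 := sum_nonneg fun _ _ => by positivity
  have n2 : (0:ℝ) ≤ ∑ i ∈ range p, ∑ j ∈ (range p).erase i, ‖z i‖ ^ 4 * ‖z j‖ ^ 8 :=
    sum_nonneg fun _ _ => sum_nonneg fun _ _ => by positivity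
  by_cases h : ‖∑ i ∈ range p, z i‖ ≤ 2 * ‖z i0‖
  · have h1 : ‖∑ i ∈ range p, z i‖ ^ 12 ≤ (2 * ‖z i0‖) ^ 12 := pow_le_pow_left₀ (norm_nonneg _) h _
    have h2 : ‖z i0‖ ^ 12 ≤ ∑ i ∈ range p, ‖z i‖ ^ 12 :=
      single_le_sum (f := fun i => ‖z i‖ ^ 12) (fun _ _ => by positivity) hi0
    rw [mul_pow] at h1
    have : (0:ℝ) ≤ (2 * p) ^ 12 * ∑ i ∈ range p, ∑ j ∈ (range p).erase i, ‖z i‖ ^ 4 * ‖z j‖ ^ 8 := by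
      positivity
    linarith
  · push Not at h
    obtain ⟨j, hj, hjj⟩ : ∃ j ∈ (range p).erase i0, ‖∑ i ∈ range p, z i‖ ≤ 2 * p * ‖z j‖ := by
      by_contra hcon
      push Not at hcon
      have h3 : ‖∑ i ∈ range p, z i‖ ≤ ‖z i0‖ + ∑ j ∈ (range p).erase i0, ‖z j‖ := by
        rw [← add_sum_erase _ _ hi0]
        exact (norm_add_le _ _).trans (by gcongr; exact norm_sum_le _ _)
      have h4 : ∑ j ∈ (range p).erase i0, 2 * p * ‖z j‖ ≤
          ∑ j ∈ (range p).erase i0, ‖∑ i ∈ range p, z i‖ := sum_le_sum fun j hj => (hcon j hj).le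
      rw [← mul_sum, sum_const, card_erase_of_mem hi0, card_range, nsmul_eq_mul] at h4
      have h5 : ((p - 1 : ℕ) : ℝ) ≤ p := by exact_mod_cast Nat.sub_le _ _
      have hp' : (0:ℝ) < p := by exact_mod_cast hp
      have h6 : ((p - 1 : ℕ) : ℝ) * ‖∑ i ∈ range p, z i‖ ≤ p * ‖∑ i ∈ range p, z i‖ := by gcongr
      have h7 : 2 * (∑ j ∈ (range p).erase i0, ‖z j‖) ≤ ‖∑ i ∈ range p, z i‖ := by
        have : (p:ℝ) * (2 * (∑ j ∈ (range p).erase i0, ‖z j‖)) ≤ p * ‖∑ i ∈ range p, z i‖ := by linarith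
        exact le_of_mul_le_mul_left this hp'
      linarith
    have h1 : ‖∑ i ∈ range p, z i‖ ^ 12 ≤ (2 * p * ‖z j‖) ^ 12 :=
      pow_le_pow_left₀ (norm_nonneg _) hjj _
    have h2 : ‖z i0‖ ^ 4 * ‖z j‖ ^ 8 ≤
        ∑ i ∈ range p, ∑ j ∈ (range p).erase i, ‖z i‖ ^ 4 * ‖z j‖ ^ 8 :=
      (single_le_sum (f := fun j => ‖z i0‖ ^ 4 * ‖z j‖ ^ 8) (fun _ _ => by positivity) hj).trans
      (single_le_sum (f := fun i => ∑ j ∈ (range p).erase i, ‖z i‖ ^ 4 * ‖z j‖ ^ 8)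
        (fun _ _ => sum_nonneg fun _ _ => by positivity) hi0)
    have h3 : ‖z j‖ ^ 12 ≤ ‖z i0‖ ^ 4 * ‖z j‖ ^ 8 := by
      have := hmax j (mem_of_mem_erase hj)
      calc ‖z j‖ ^ 12 = ‖z j‖ ^ 4 * ‖z j‖ ^ 8 := by ring
        _ ≤ _ := by gcongr
    rw [mul_pow] at h1
    have h8 : (2 * (p:ℝ)) ^ 12 * ‖z j‖ ^ 12 ≤
      (2 * p) ^ 12 * ∑ i ∈ range p, ∑ j ∈ (range p).erase i, ‖z i‖ ^ 4 * ‖z j‖ ^ 8 := by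
      exact mul_le_mul_of_nonneg_left (h3.trans h2) (by positivity)
    have h9 : 0 ≤ 2 ^ 12 * ∑ i ∈ range p, ‖z i‖ ^ 12 := mul_nonneg (by norm_num) n1
    exact (h1.trans h8).trans (le_add_of_nonneg_left h9)

lemma cover (X p : ℕ) (hp : 0 < p) (U0 U2 : ℝ)
    (h0 : ∀ ξ, (V0 (cl X p ξ) : ℝ) ≤ U0)
    (h2 : ∀ ξ η : ℤ, ¬ (p : ℤ) ∣ ξ - η → (V2 (cl X p ξ) (cl X p η) : ℝ) ≤ U2) (hU2 : 0 ≤ U2) :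
    (JJ X : ℝ) ≤ 2 ^ 12 * (p * U0) + (2 * p) ^ 12 * (p * (p * U2)) := by
  obtain ⟨L, hL, h⟩ := exists_L (Icc 1 (X : ℤ))
  have hc : ∀ ξ, cl X p ξ ⊆ Icc 1 (X : ℤ) := fun ξ => filter_subset _ _
  have hsum : ∀ j, fs L (Icc 1 (X : ℤ)) j = ∑ i ∈ range p, fs L (cl X p i) j := by
    intro j
    unfold fs cl
    simp_rw [sum_filter]
    rw [sum_comm]
    refine sum_congr rfl fun x hx => ?_
    have hpz : (p : ℤ) ≠ 0 := by positivity
    rw [sum_eq_single_of_mem (x % p).toNat]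
    · rw [if_pos]
      rw [Int.toNat_of_nonneg (Int.emod_nonneg _ hpz)]
      exact Int.dvd_self_sub_emod
    · rw [mem_range]
      have := Int.emod_lt_of_pos x (by positivity : (0:ℤ) < p)
      have := Int.emod_nonneg x hpz
      omega
    · intro b hb hne
      rw [if_neg]
      intro hd
      apply hne
      rw [mem_range] at hb
      have h3 : x % p = b % p := Int.emod_eq_emod_iff_emod_sub_eq_zero.2 (Int.emod_eq_zero_of_dvd hd)
      rw [h3, Int.emod_eq_of_lt (by positivity) (by exact_mod_cast hb)]
      simp
  have r0 : ∀ A ⊆ Icc 1 (X : ℤ), (L : ℝ) ^ 3 * V0 A = ∑ j ∈ GG L, ‖fs L A j‖ ^ 12 := by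
    intro A hA
    unfold V0
    rw [real_rep L _ (h _ _ (fun _ => hA) (fun _ => hA))]
    refine sum_congr rfl fun j _ => ?_
    simp; ring
  have r2 : ∀ A ⊆ Icc 1 (X : ℤ), ∀ B ⊆ Icc 1 (X : ℤ),
      (L : ℝ) ^ 3 * V2 A B = ∑ j ∈ GG L, ‖fs L A j‖ ^ 4 * ‖fs L B j‖ ^ 8 := by
    intro A' hA' B' hB'
    have hs : ∀ l : Fin 6, (![A', A', B', B', B', B'] : Fin 6 → Finset ℤ) l ⊆ Icc 1 (X : ℤ) := by
      intro l; fin_cases l <;> simpa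
    unfold V2
    rw [real_rep L _ (h _ _ hs hs)]
    refine sum_congr rfl fun j _ => ?_
    rw [Fin.prod_univ_six]; simp; ring
  have hLp : (0:ℝ) < (L : ℝ) ^ 3 := by positivity
  refine le_of_mul_le_mul_left ?_ hLp
  unfold JJ
  rw [r0 _ (subset_refl _)]
  calc ∑ j ∈ GG L, ‖fs L (Icc 1 (X : ℤ)) j‖ ^ 12
      ≤ ∑ j ∈ GG L, (2 ^ 12 * ∑ i ∈ range p, ‖fs L (cl X p i) j‖ ^ 12 +
      (2 * p) ^ 12 * ∑ i ∈ range p, ∑ i' ∈ (range p).erase i,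
        ‖fs L (cl X p i) j‖ ^ 4 * ‖fs L (cl X p i') j‖ ^ 8) := by
        refine sum_le_sum fun j _ => ?_
        rw [hsum j]
        exact pointwise_cover p hp (fun i => fs L (cl X p i) j)
    _ = 2 ^ 12 * ∑ i ∈ range p, (L : ℝ) ^ 3 * V0 (cl X p i) + (2 * p) ^ 12 *
        ∑ i ∈ range p, ∑ i' ∈ (range p).erase i, (L : ℝ) ^ 3 * V2 (cl X p i) (cl X p i') := by
        rw [sum_add_distrib, ← mul_sum, ← mul_sum]
        congr 2
        · rw [sum_comm]
          exact sum_congr rfl fun i _ => (r0 _ (hc _)).symm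
        · rw [sum_comm]
          refine sum_congr rfl fun i _ => ?_
          rw [sum_comm]
          exact sum_congr rfl fun i' _ => (r2 _ (hc _) _ (hc _)).symm
    _ ≤ 2 ^ 12 * ∑ i ∈ range p, (L : ℝ) ^ 3 * U0 + (2 * p) ^ 12 *
        ∑ i ∈ range p, ∑ i' ∈ range p, (L : ℝ) ^ 3 * U2 := by
        gcongr with i hi i hi
        · exact h0 _
        · refine (sum_le_sum fun i' hi' => ?_).trans
            (sum_le_sum_of_subset_of_nonneg (erase_subset i _) fun _ _ _ => by positivity)
          gcongr
          apply h2
          intro hd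
          rw [mem_erase, mem_range] at hi'
          rw [mem_range] at hi
          have := Int.eq_zero_of_abs_lt_dvd hd (by rw [abs_lt]; constructor <;> omega)
          omega
    _ = _ := by simp; ring

end WW

namespace WW
open Finset

lemma psum_affine (x u : Fin 6 → ℤ) (m c : ℤ) (h : ∀ l, x l = m * u l + c) :
    psum x 0 = m * psum u 0 + 6 * c ∧
    psum x 1 = m ^ 2 * psum u 1 + 2 * m * c * psum u 0 + 6 * c ^ 2 ∧
    psum x 2 = m ^ 3 * psum u 2 + 3 * m ^ 2 * c * psum u 1 + 3 * m * c ^ 2 * psum u 0 + 6 * c ^ 3 := by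
  unfold psum
  simp only [Fin.sum_univ_six, h]
  simp
  refine ⟨by ring, by ring, by ring⟩

lemma psum_descend (x y u v : Fin 6 → ℤ) (m c : ℤ) (hm : m ≠ 0) (h : ∀ l, x l = m * u l + c)
    (h' : ∀ l, y l = m * v l + c) (hxy : psum x = psum y) : psum u = psum v := by
  obtain ⟨a0, a1, a2⟩ := psum_affine x u m c h
  obtain ⟨b0, b1, b2⟩ := psum_affine y v m c h'
  rw [hxy] at a0 a1 a2
  have c0 : psum u 0 = psum v 0 := by
    apply mul_left_cancel₀ hm; linarith
  have c1 : psum u 1 = psum v 1 := by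
    apply mul_left_cancel₀ (pow_ne_zero 2 hm); rw [c0] at a1; linarith
  have c2 : psum u 2 = psum v 2 := by
    apply mul_left_cancel₀ (pow_ne_zero 3 hm); rw [c0, c1] at a2; linarith
  funext i; fin_cases i <;> assumption

lemma V0_cl (X m : ℕ) (hm : 0 < m) (ξ : ℤ) : V0 (cl X m ξ) ≤ JJ (X / m + 1) := by
  have hmz : (0:ℤ) < m := by exact_mod_cast hm
  have key : ∀ x ∈ cl X m ξ, x = m * ((x - ξ % m) / m + 1) + (ξ % m - m) ∧
      (x - ξ % m) / m + 1 ∈ Icc 1 ((X / m + 1 : ℕ) : ℤ) := by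
    intro x hx
    rw [mem_cl] at hx
    obtain ⟨⟨h1, h2⟩, hd⟩ := hx
    have r0 := Int.emod_nonneg ξ hmz.ne'
    have r1 := Int.emod_lt_of_pos ξ hmz
    have hd2 : (m:ℤ) ∣ x - ξ % m := by
      have : x - ξ % m = (x - ξ) + (ξ - ξ % m) := by ring
      rw [this]; exact dvd_add hd Int.dvd_self_sub_emod
    obtain ⟨k, hk⟩ := hd2
    rw [hk, Int.mul_ediv_cancel_left _ hmz.ne']
    refine ⟨by linarith, ?_⟩
    rw [mem_Icc]
    have k0 : 0 ≤ k := by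
      by_contra hneg
      push Not at hneg
      have : (m:ℤ) * k ≤ m * (-1) := by gcongr; omega
      omega
    have k1 : k ≤ (X / m : ℕ) := by
      push_cast
      rw [Int.le_ediv_iff_mul_le hmz]
      linarith [mul_comm k (m:ℤ)]
    push_cast at k1 ⊢
    omega
  unfold JJ V0 cnt
  refine card_le_card_of_injOn
    (fun z => (fun l => (z.1 l - ξ % m) / m + 1, fun l => (z.2 l - ξ % m) / m + 1)) ?_ ?_
  · rintro ⟨x, y⟩ hz
    simp only [coe_filter, Set.mem_setOf_eq, mem_product, Fintype.mem_piFinset] at hz ⊢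
    obtain ⟨⟨hx, hy⟩, hp⟩ := hz
    refine ⟨⟨fun l => (key _ (hx l)).2, fun l => (key _ (hy l)).2⟩, ?_⟩
    exact psum_descend x y _ _ m _ hmz.ne' (fun l => (key _ (hx l)).1) (fun l => (key _ (hy l)).1) hp
  · rintro ⟨x, y⟩ hz ⟨x', y'⟩ hz' heq
    simp only [coe_filter, Set.mem_setOf_eq, mem_product, Fintype.mem_piFinset] at hz hz'
    simp only [Prod.mk.injEq] at heq ⊢
    constructor
    · funext l
      have := congrFun heq.1 l
      rw [(key _ (hz.1.1 l)).1, (key _ (hz'.1.1 l)).1, this]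
    · funext l
      have := congrFun heq.2 l
      rw [(key _ (hz.1.2 l)).1, (key _ (hz'.1.2 l)).1, this]

lemma psum_shift (x y : Fin 6 → ℤ) (η : ℤ) (hxy : psum x = psum y) :
    psum (fun l => x l - η) = psum (fun l => y l - η) :=
  psum_descend x y _ _ 1 η one_ne_zero (fun l => by ring) (fun l => by ring) hxy

lemma class_rep (P Q : ℕ) (hP : 0 < P) (hQ : 0 < Q) (ξ x : ℤ) (h : (P : ℤ) ∣ x - ξ) :
    ∃ t ∈ range Q, ((P * Q : ℕ) : ℤ) ∣ x - (ξ + P * (t : ℤ)) := by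
  obtain ⟨k, hk⟩ := h
  have hQz : (0:ℤ) < Q := by exact_mod_cast hQ
  refine ⟨(k % Q).toNat, ?_, ?_⟩
  · rw [mem_range]
    have := Int.emod_lt_of_pos k hQz
    have := Int.emod_nonneg k hQz.ne'
    omega
  · rw [Int.toNat_of_nonneg (Int.emod_nonneg k hQz.ne')]
    have e : x - (ξ + P * (k % Q)) = P * (k - k % Q) := by
      rw [← sub_sub, hk]; ring
    rw [e]
    push_cast
    exact mul_dvd_mul_left _ Int.dvd_self_sub_emod

lemma prime_int {p : ℕ} (hp : p.Prime) : Prime (p : ℤ) := Nat.prime_iff_prime_int.1 hp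

lemma cop_pow {p : ℕ} (hp : p.Prime) (n : ℕ) {z : ℤ} (h : ¬ (p : ℤ) ∣ z) :
    IsCoprime ((p : ℤ) ^ n) z :=
  ((prime_int hp).coprime_iff_not_dvd.2 h).pow_left

lemma not_dvd_small {p : ℕ} (hp5 : 5 ≤ p) (n : ℤ) (h0 : 0 < n) (h4 : n ≤ 4) : ¬ (p : ℤ) ∣ n := by
  intro h
  have := Int.le_of_dvd h0 h
  omega

lemma cube_step {p : ℕ} (hp : p.Prime) (hp5 : 5 ≤ p) (n : ℕ) (x y ρ : ℤ) (hρ : ¬ (p : ℤ) ∣ ρ)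
    (hx : (p : ℤ) ∣ x - ρ) (hy : (p : ℤ) ∣ y - ρ) (h : (p : ℤ) ^ n ∣ x ^ 3 - y ^ 3) :
    (p : ℤ) ^ n ∣ x - y := by
  have e : x ^ 3 - y ^ 3 = (x ^ 2 + x * y + y ^ 2) * (x - y) := by ring
  rw [e] at h
  refine (cop_pow hp n ?_).dvd_of_dvd_mul_left h
  intro hd
  have e2 : (p:ℤ) ∣ 3 * (ρ * ρ) := by
    have : 3 * (ρ * ρ) = (x ^ 2 + x * y + y ^ 2) - ((x - ρ) * (x + ρ + y) + (y - ρ) * (y + 2 * ρ)) := by ring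
    rw [this]
    exact dvd_sub hd (dvd_add (hx.mul_right _) (hy.mul_right _))
  have hpp := prime_int hp
  rcases hpp.dvd_or_dvd e2 with h3 | h3
  · exact not_dvd_small hp5 3 (by norm_num) (by norm_num) h3
  · rcases hpp.dvd_or_dvd h3 with h3 | h3 <;> exact hρ h3

lemma quad_step {p : ℕ} (hp : p.Prime) (hp5 : 5 ≤ p) (n : ℕ) (x y z w ρ : ℤ) (hρ : ¬ (p : ℤ) ∣ ρ)
    (hx : (p : ℤ) ∣ x - ρ) (hy : (p : ℤ) ∣ y - ρ) (hz : (p : ℤ) ∣ z - ρ) (hw : (p : ℤ) ∣ w - ρ)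
    (h2 : (p : ℤ) ^ n ∣ x ^ 2 + y ^ 2 - (z ^ 2 + w ^ 2))
    (h3 : (p : ℤ) ^ n ∣ x ^ 3 + y ^ 3 - (z ^ 3 + w ^ 3)) :
    (p : ℤ) ^ n ∣ x + y - (z + w) ∧ (p : ℤ) ^ n ∣ (x - z) * (x - w) := by
  have hpp := prime_int hp
  set D := x - z with hD
  set E := w - y with hE
  set σ := x + z with hσ
  set τ := w + y with hτ
  have hpD : (p:ℤ) ∣ D := by
    have : D = (x - ρ) - (z - ρ) := by rw [hD]; ring
    rw [this]; exact dvd_sub hx hz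
  have hpσ : ¬ (p:ℤ) ∣ σ := by
    intro h
    have : (p:ℤ) ∣ 2 * ρ := by
      have e : 2 * ρ = σ - ((x - ρ) + (z - ρ)) := by rw [hσ]; ring
      rw [e]; exact dvd_sub h (dvd_add hx hz)
    rcases hpp.dvd_or_dvd this with h | h
    · exact not_dvd_small hp5 2 (by norm_num) (by norm_num) h
    · exact hρ h
  have hpτ : ¬ (p:ℤ) ∣ τ := by
    intro h
    have : (p:ℤ) ∣ 2 * ρ := by
      have e : 2 * ρ = τ - ((w - ρ) + (y - ρ)) := by rw [hτ]; ring
      rw [e]; exact dvd_sub h (dvd_add hw hy)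
    rcases hpp.dvd_or_dvd this with h | h
    · exact not_dvd_small hp5 2 (by norm_num) (by norm_num) h
    · exact hρ h
  obtain ⟨r, hr⟩ := h2
  obtain ⟨s, hs⟩ := h3
  set P := (p:ℤ) ^ n
  have q2 : D * σ - E * τ = P * r := by rw [← hr, hD, hσ, hE, hτ]; ring
  have q3 : D * (3 * σ ^ 2 + D ^ 2) - E * (3 * τ ^ 2 + E ^ 2) = P * (4 * s) := by
    have : P * (4 * s) = 4 * (P * s) := by ring
    rw [this, ← hs, hD, hσ, hE, hτ]; ring
  have hmain : P ∣ (3 * σ * τ ^ 3 - D ^ 2 * (σ ^ 2 + σ * τ + τ ^ 2)) * (D * (σ - τ)) := by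
    have e : (3 * σ * τ ^ 3 - D ^ 2 * (σ ^ 2 + σ * τ + τ ^ 2)) * (D * (σ - τ)) =
      τ ^ 3 * (D * (3 * σ ^ 2 + D ^ 2) - E * (3 * τ ^ 2 + E ^ 2)) -
        (D * σ - E * τ) * (3 * τ ^ 4 + (D * σ) ^ 2 + (D * σ) * (E * τ) + (E * τ) ^ 2) := by ring
    rw [e, q2, q3]
    exact dvd_sub (Dvd.intro _ (by ring : P * (τ ^ 3 * (4 * s)) = _))
      (Dvd.intro _ (by ring : P * (r * (3 * τ ^ 4 + (D * σ) ^ 2 + (D * σ) * (E * τ) + (E * τ) ^ 2)) = _))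
  have hDs : P ∣ D * (σ - τ) := by
    refine (cop_pow hp n ?_).dvd_of_dvd_mul_left hmain
    intro hd
    have h4 : (p:ℤ) ∣ 3 * σ * τ ^ 3 := by
      have e : 3 * σ * τ ^ 3 = (3 * σ * τ ^ 3 - D ^ 2 * (σ ^ 2 + σ * τ + τ ^ 2)) +
        D * (D * (σ ^ 2 + σ * τ + τ ^ 2)) := by ring
      rw [e]; exact dvd_add hd (hpD.mul_right _)
    rcases hpp.dvd_or_dvd h4 with h5 | h5
    · rcases hpp.dvd_or_dvd h5 with h6 | h6
      · exact not_dvd_small hp5 3 (by norm_num) (by norm_num) h6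
      · exact hpσ h6
    · exact hpτ (hpp.dvd_of_dvd_pow h5)
  have hDE : P ∣ D - E := by
    refine (cop_pow hp n hpτ).dvd_of_dvd_mul_left ?_
    have e : τ * (D - E) = (D * σ - E * τ) - D * (σ - τ) := by ring
    rw [e, q2]; exact dvd_sub (dvd_mul_right _ _) hDs
  refine ⟨?_, ?_⟩
  · have e : x + y - (z + w) = D - E := by rw [hD, hE]; ring
    rw [e]; exact hDE
  · refine (cop_pow hp n (not_dvd_small hp5 2 (by norm_num) (by norm_num))).dvd_of_dvd_mul_left ?_
    have e : 2 * (D * (x - w)) = D * (σ - τ) + (D - E) * D := by rw [hD, hσ, hE, hτ]; ring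
    rw [e]; exact dvd_add hDs (hDE.mul_right _)

end WW

namespace WW
open Finset

lemma mem_vec6 (A B C D E F : Finset ℤ) (x : Fin 6 → ℤ) :
    x ∈ Fintype.piFinset (![A, B, C, D, E, F] : Fin 6 → Finset ℤ) ↔
      x 0 ∈ A ∧ x 1 ∈ B ∧ x 2 ∈ C ∧ x 3 ∈ D ∧ x 4 ∈ E ∧ x 5 ∈ F := by
  rw [Fintype.mem_piFinset]
  constructor
  · intro h
    exact ⟨h 0, h 1, h 2, h 3, h 4, h 5⟩
  · rintro ⟨h0, h1, h2, h3, h4, h5⟩ l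
    fin_cases l <;> assumption

lemma dvd_pow_of (M : ℤ) (b j : ℕ) (p y : ℤ) (h : p ^ b ∣ y) : p ^ (j * b) ∣ y ^ j := by
  have := pow_dvd_pow_of_dvd h j
  rwa [← pow_mul, mul_comm b j] at this

lemma V1_step {p : ℕ} (hp : p.Prime) (hp5 : 5 ≤ p) (X a b : ℕ) (ha : 1 ≤ a) (hab : a ≤ 3 * b)
    (ξ η : ℤ) (hne : ¬ (p : ℤ) ∣ ξ - η) (U : ℝ)
    (hU : ∀ ξ' : ℤ, ¬ (p : ℤ) ∣ ξ' - η → (V1 (cl X (p ^ (3 * b)) ξ') (cl X (p ^ b) η) : ℝ) ≤ U) :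
    (V1 (cl X (p ^ a) ξ) (cl X (p ^ b) η) : ℝ) ≤ (p : ℝ) ^ (3 * b - a) * U := by
  have hpa : 0 < p ^ a := pow_pos hp.pos _
  have hpq : 0 < p ^ (3 * b - a) := pow_pos hp.pos _
  have hmul : p ^ a * p ^ (3 * b - a) = p ^ (3 * b) := by rw [← pow_add]; congr 1; omega
  have hpdvd : ∀ x : ℤ, ((p ^ a : ℕ) : ℤ) ∣ x → (p : ℤ) ∣ x := fun x h =>
    (dvd_pow_self (p:ℤ) (by omega : a ≠ 0)).trans (by exact_mod_cast h)
  have hsub : V1 (cl X (p ^ a) ξ) (cl X (p ^ b) η) ≤ ∑ t ∈ range (p ^ (3 * b - a)),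
      V1 (cl X (p ^ (3 * b)) (ξ + (p ^ a : ℕ) * (t : ℤ))) (cl X (p ^ b) η) := by
    unfold V1 cnt
    refine le_trans (card_le_card ?_) card_biUnion_le
    rintro ⟨x, y⟩ hz
    rw [mem_filter, mem_product, mem_vec6, mem_vec6] at hz
    obtain ⟨⟨⟨x0, x1, x2, x3, x4, x5⟩, ⟨y0, y1, y2, y3, y4, y5⟩⟩, hps⟩ := hz
    simp only at x0 x1 x2 x3 x4 x5 y0 y1 y2 y3 y4 y5 hps
    have hxd := (mem_cl.1 x0).2
    have hyd := (mem_cl.1 y0).2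
    obtain ⟨t, ht, htd⟩ := class_rep (p ^ a) (p ^ (3 * b - a)) hpa hpq ξ (x 0) hxd
    rw [hmul] at htd
    have hcube : (p:ℤ) ^ (3 * b) ∣ (x 0 - η) ^ 3 - (y 0 - η) ^ 3 := by
      have hs := congrFun (psum_shift x y η hps) 2
      unfold psum at hs
      simp only [Fin.sum_univ_six] at hs
      norm_num at hs
      have d : ∀ u, u ∈ cl X (p ^ b) η → (p:ℤ) ^ (3 * b) ∣ (u - η) ^ 3 := fun u hu =>
        dvd_pow_of 0 b 3 _ _ (by exact_mod_cast (mem_cl.1 hu).2)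
      have e : (x 0 - η) ^ 3 - (y 0 - η) ^ 3 = ((y 1 - η) ^ 3 + (y 2 - η) ^ 3 + (y 3 - η) ^ 3 +
        (y 4 - η) ^ 3 + (y 5 - η) ^ 3) - ((x 1 - η) ^ 3 + (x 2 - η) ^ 3 + (x 3 - η) ^ 3 +
        (x 4 - η) ^ 3 + (x 5 - η) ^ 3) := by linarith
      rw [e]
      exact dvd_sub (dvd_add (dvd_add (dvd_add (dvd_add (d _ y1) (d _ y2)) (d _ y3)) (d _ y4)) (d _ y5))
        (dvd_add (dvd_add (dvd_add (dvd_add (d _ x1) (d _ x2)) (d _ x3)) (d _ x4)) (d _ x5))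
    have hxy := cube_step hp hp5 (3 * b) _ _ (ξ - η) hne
      (by have := hpdvd _ hxd; simpa using this) (by have := hpdvd _ hyd; simpa using this) hcube
    have hxy' : ((p ^ (3 * b) : ℕ) : ℤ) ∣ x 0 - y 0 := by
      push_cast; have e : x 0 - η - (y 0 - η) = x 0 - y 0 := by ring
      rwa [e] at hxy
    rw [mem_biUnion]
    refine ⟨t, ht, ?_⟩
    rw [mem_filter, mem_product, mem_vec6, mem_vec6]
    refine ⟨⟨⟨mem_cl.2 ⟨(mem_cl.1 x0).1, htd⟩, x1, x2, x3, x4, x5⟩,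
      ⟨mem_cl.2 ⟨(mem_cl.1 y0).1, ?_⟩, y1, y2, y3, y4, y5⟩⟩, hps⟩
    have := dvd_sub htd hxy'
    have e : x 0 - (ξ + ((p ^ a : ℕ) : ℤ) * (t:ℤ)) - (x 0 - y 0) = y 0 - (ξ + ((p ^ a : ℕ) : ℤ) * (t:ℤ)) := by ring
    rwa [e] at this
  calc (V1 (cl X (p ^ a) ξ) (cl X (p ^ b) η) : ℝ) ≤ ((∑ t ∈ range (p ^ (3 * b - a)),
      V1 (cl X (p ^ (3 * b)) (ξ + (p ^ a : ℕ) * (t : ℤ))) (cl X (p ^ b) η) : ℕ) : ℝ) := by exact_mod_cast hsub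
    _ ≤ ∑ t ∈ range (p ^ (3 * b - a)), U := by
      push_cast
      refine sum_le_sum fun t _ => ?_
      have := hU (ξ + (p ^ a : ℕ) * (t : ℤ)) ?_
      · push_cast at this; exact this
      · intro hd
        apply hne
        have h1 : (p:ℤ) ∣ (p ^ a : ℕ) * (t : ℤ) := (hpdvd _ (dvd_refl _)).mul_right _
        have e : ξ - η = ξ + (p ^ a : ℕ) * (t : ℤ) - η - (p ^ a : ℕ) * (t : ℤ) := by ring
        rw [e]; exact dvd_sub hd h1
    _ = _ := by simp

lemma card_residue (M N : ℕ) (hM : 0 < M) (t0 : ℤ) :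
    ((range (M * N)).filter (fun t : ℕ => (M : ℤ) ∣ t0 - (t : ℤ))).card ≤ N := by
  calc _ ≤ (range N).card := by
        refine card_le_card_of_injOn (fun t => t / M) ?_ ?_
        · intro t ht
          simp only [coe_filter, mem_range, Set.mem_setOf_eq, coe_range, Set.mem_Iio] at ht ⊢
          exact Nat.div_lt_of_lt_mul ht.1
        · intro t ht t' ht' h
          simp only [coe_filter, mem_range, Set.mem_setOf_eq] at ht ht' h
          have hd : (M:ℤ) ∣ (t:ℤ) - t' := by
            have := dvd_sub ht'.2 ht.2
            have e : t0 - (t':ℤ) - (t0 - t) = (t:ℤ) - t' := by ring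
            rwa [e] at this
          have hm : t % M = t' % M := by
            have := Int.emod_eq_emod_iff_emod_sub_eq_zero.2 (Int.emod_eq_zero_of_dvd hd)
            exact_mod_cast this
          rw [← Nat.div_add_mod t M, ← Nat.div_add_mod t' M, h, hm]
    _ = N := card_range N

def sols (M : ℕ) : Finset ((ℕ × ℕ) × (ℕ × ℕ)) :=
  ((range M ×ˢ range M) ×ˢ (range M ×ˢ range M)).filter (fun t =>
    (M : ℤ) ∣ (t.1.1 : ℤ) + t.1.2 - (t.2.1 + t.2.2) ∧
    (M : ℤ) ∣ ((t.1.1 : ℤ) - t.2.1) * ((t.1.1 : ℤ) - t.2.2))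

lemma split_prime_pow {p : ℕ} (hp : p.Prime) (c : ℕ) (v w : ℤ) (h : ((p ^ c : ℕ) : ℤ) ∣ v * w) :
    ∃ i ∈ range (c + 1), ((p ^ i : ℕ) : ℤ) ∣ v ∧ ((p ^ (c - i) : ℕ) : ℤ) ∣ w := by
  have h' : p ^ c ∣ v.natAbs * w.natAbs := by
    rw [← Int.natAbs_mul]; exact Int.natCast_dvd.1 h
  obtain ⟨d1, d2, h1, h2, h3⟩ := (Nat.dvd_mul.1 h')
  obtain ⟨i, hi, rfl⟩ := (Nat.dvd_prime_pow hp).1 (Dvd.intro _ h3 : d1 ∣ p ^ c)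
  refine ⟨i, mem_range.2 (by omega), Int.natCast_dvd.2 h1, Int.natCast_dvd.2 ?_⟩
  have : d2 = p ^ (c - i) := by
    apply Nat.eq_of_mul_eq_mul_left (pow_pos hp.pos i)
    rw [h3, ← pow_add]; congr 1; omega
  rwa [← this]

lemma card_sols {p : ℕ} (hp : p.Prime) (c : ℕ) :
    (sols (p ^ c)).card ≤ (c + 1) * p ^ (2 * c) := by
  set M := p ^ c with hM
  have hM0 : 0 < M := pow_pos hp.pos c
  have s1 : (sols M).card ≤ ((range M).biUnion (fun t0 => (range (c + 1)).biUnion (fun i =>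
      ({t0} : Finset ℕ) ×ˢ (((range M).filter (fun t : ℕ => ((p ^ i : ℕ) : ℤ) ∣ (t0:ℤ) - (t : ℤ))) ×ˢ
      ((range M).filter (fun t : ℕ => ((p ^ (c - i) : ℕ) : ℤ) ∣ (t0:ℤ) - (t : ℤ))))))).card := by
    refine card_le_card_of_injOn (fun t => (t.1.1, (t.2.1, t.2.2))) ?_ ?_
    · rintro ⟨⟨a, b⟩, ⟨d, e⟩⟩ ht
      simp only [sols, coe_filter, mem_product, mem_range, Set.mem_setOf_eq] at ht
      obtain ⟨⟨⟨ha, hb⟩, hd, he⟩, h1, h2⟩ := ht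
      obtain ⟨i, hi, hi1, hi2⟩ := split_prime_pow hp c _ _ h2
      rw [mem_coe, mem_biUnion]
      refine ⟨a, mem_range.2 ha, ?_⟩
      rw [mem_biUnion]
      refine ⟨i, hi, ?_⟩
      simp only [mem_product, mem_singleton, mem_filter, mem_range]
      exact ⟨trivial, ⟨hd, hi1⟩, he, hi2⟩
    · rintro ⟨⟨a, b⟩, ⟨d, e⟩⟩ ht ⟨⟨a', b'⟩, ⟨d', e'⟩⟩ ht' heq
      simp only [sols, coe_filter, mem_product, mem_range, Set.mem_setOf_eq] at ht ht'
      simp only [Prod.mk.injEq] at heq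
      obtain ⟨rfl, rfl, rfl⟩ := heq
      have := dvd_sub ht.2.1 ht'.2.1
      have e3 : ((a:ℤ) + b - (d + e)) - (a + b' - (d + e)) = (b:ℤ) - b' := by ring
      rw [e3] at this
      have := Int.eq_zero_of_abs_lt_dvd this (by rw [abs_lt]; constructor <;> omega)
      have : b = b' := by omega
      rw [this]
  refine s1.trans (card_biUnion_le.trans ?_)
  calc _ ≤ ∑ t0 ∈ range M, ∑ i ∈ range (c + 1), M := by
        refine sum_le_sum fun t0 _ => card_biUnion_le.trans (sum_le_sum fun i hi => ?_)
        rw [mem_range] at hi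
        rw [card_product, card_product, card_singleton, one_mul]
        have e1 : M = p ^ i * p ^ (c - i) := by rw [← pow_add, hM]; congr 1; omega
        have e2 : M = p ^ (c - i) * p ^ i := by rw [← pow_add, hM]; congr 1; omega
        have c1 := card_residue (p ^ i) (p ^ (c - i)) (pow_pos hp.pos _) (t0:ℤ)
        have c2 := card_residue (p ^ (c - i)) (p ^ i) (pow_pos hp.pos _) (t0:ℤ)
        rw [← e1] at c1
        rw [← e2] at c2
        calc _ ≤ p ^ (c - i) * p ^ i := Nat.mul_le_mul c1 c2
          _ = M := e2.symm
    _ = (c + 1) * p ^ (2 * c) := by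
        simp only [sum_const, card_range, smul_eq_mul]
        rw [hM]; ring

lemma V2_step {p : ℕ} (hp : p.Prime) (hp5 : 5 ≤ p) (X a b : ℕ) (ha : 1 ≤ a) (hab : a ≤ b)
    (ξ η : ℤ) (hne : ¬ (p : ℤ) ∣ ξ - η) (U : ℝ) (hU0 : 0 ≤ U)
    (hU : ∀ ξ' : ℤ, ¬ (p : ℤ) ∣ ξ' - η → (V2 (cl X (p ^ (2 * b - a)) ξ') (cl X (p ^ b) η) : ℝ) ≤ U) :
    (V2 (cl X (p ^ a) ξ) (cl X (p ^ b) η) : ℝ) ≤ (2 * (b - a : ℕ) + 1) * (p : ℝ) ^ (4 * (b - a)) * U := by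
  set c := 2 * (b - a) with hc
  have hpa : 0 < p ^ a := pow_pos hp.pos _
  have hpc : 0 < p ^ c := pow_pos hp.pos _
  have hmul : p ^ a * p ^ c = p ^ (2 * b - a) := by rw [← pow_add]; congr 1; omega
  have hpdvd : ∀ x : ℤ, ((p ^ a : ℕ) : ℤ) ∣ x → (p : ℤ) ∣ x := fun x h =>
    (dvd_pow_self (p:ℤ) (by omega : a ≠ 0)).trans (by exact_mod_cast h)
  set A : ℕ → Finset ℤ := fun t => cl X (p ^ (2 * b - a)) (ξ + (p ^ a : ℕ) * (t : ℤ)) with hA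
  set B := cl X (p ^ b) η with hB
  have hsub : V2 (cl X (p ^ a) ξ) B ≤ ∑ t ∈ sols (p ^ c),
      cnt ![A t.1.1, A t.1.2, B, B, B, B] ![A t.2.1, A t.2.2, B, B, B, B] := by
    unfold V2 cnt
    refine le_trans (card_le_card ?_) card_biUnion_le
    rintro ⟨x, y⟩ hz
    rw [mem_filter, mem_product, mem_vec6, mem_vec6] at hz
    obtain ⟨⟨⟨x0, x1, x2, x3, x4, x5⟩, ⟨y0, y1, y2, y3, y4, y5⟩⟩, hps⟩ := hz
    simp only at x0 x1 x2 x3 x4 x5 y0 y1 y2 y3 y4 y5 hps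
    obtain ⟨s0, hs0, ds0⟩ := class_rep (p ^ a) (p ^ c) hpa hpc ξ (x 0) (mem_cl.1 x0).2
    obtain ⟨s1, hs1, ds1⟩ := class_rep (p ^ a) (p ^ c) hpa hpc ξ (x 1) (mem_cl.1 x1).2
    obtain ⟨t0, ht0, dt0⟩ := class_rep (p ^ a) (p ^ c) hpa hpc ξ (y 0) (mem_cl.1 y0).2
    obtain ⟨t1, ht1, dt1⟩ := class_rep (p ^ a) (p ^ c) hpa hpc ξ (y 1) (mem_cl.1 y1).2
    have d : ∀ j ≥ 2, ∀ u, u ∈ B → (p:ℤ) ^ (2 * b) ∣ (u - η) ^ j := fun j hj u hu =>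
      (pow_dvd_pow (p:ℤ) (by nlinarith : 2 * b ≤ j * b)).trans
        (dvd_pow_of 0 b j _ _ (by exact_mod_cast (mem_cl.1 hu).2))
    have hshift := psum_shift x y η hps
    have hj : ∀ j ≥ 2, (∑ l, (x l - η) ^ j = ∑ l, (y l - η) ^ j) → (p:ℤ) ^ (2 * b) ∣
        (x 0 - η) ^ j + (x 1 - η) ^ j - ((y 0 - η) ^ j + (y 1 - η) ^ j) := by
      intro j hj hs
      simp only [Fin.sum_univ_six] at hs
      have e : (x 0 - η) ^ j + (x 1 - η) ^ j - ((y 0 - η) ^ j + (y 1 - η) ^ j) =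
        ((y 2 - η) ^ j + (y 3 - η) ^ j + (y 4 - η) ^ j + (y 5 - η) ^ j) -
        ((x 2 - η) ^ j + (x 3 - η) ^ j + (x 4 - η) ^ j + (x 5 - η) ^ j) := by linarith
      rw [e]
      exact dvd_sub (dvd_add (dvd_add (dvd_add (d j hj _ y2) (d j hj _ y3)) (d j hj _ y4)) (d j hj _ y5))
        (dvd_add (dvd_add (dvd_add (d j hj _ x2) (d j hj _ x3)) (d j hj _ x4)) (d j hj _ x5))
    have h2 := hj 2 (le_refl _) (congrFun hshift 1)
    have h3 := hj 3 (by norm_num) (congrFun hshift 2)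
    have hcl : ∀ u, u ∈ cl X (p ^ a) ξ → (p:ℤ) ∣ (u - η) - (ξ - η) := fun u hu => by
      have := hpdvd _ (mem_cl.1 hu).2; simpa using this
    obtain ⟨q1, q2⟩ := quad_step hp hp5 (2 * b) _ _ _ _ (ξ - η) hne (hcl _ x0) (hcl _ x1)
      (hcl _ y0) (hcl _ y1) h2 h3
    rw [mem_biUnion]
    refine ⟨((s0, s1), (t0, t1)), ?_, ?_⟩
    · rw [sols, mem_filter]
      refine ⟨by simp only [mem_product]; exact ⟨⟨hs0, hs1⟩, ht0, ht1⟩, ?_, ?_⟩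
      · have hdd : ((p ^ a * p ^ c : ℕ) : ℤ) ∣ (p ^ a : ℕ) * ((s0:ℤ) + s1 - (t0 + t1)) := by
          have e : ((p ^ a : ℕ) : ℤ) * ((s0:ℤ) + s1 - (t0 + t1)) =
            ((x 0 - η) + (x 1 - η) - ((y 0 - η) + (y 1 - η))) - (x 0 - (ξ + ((p ^ a : ℕ) : ℤ) * s0))
            - (x 1 - (ξ + ((p ^ a : ℕ) : ℤ) * s1)) + (y 0 - (ξ + ((p ^ a : ℕ) : ℤ) * t0))
            + (y 1 - (ξ + ((p ^ a : ℕ) : ℤ) * t1)) := by ring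
          rw [e]
          refine dvd_add (dvd_add (dvd_sub (dvd_sub ?_ ds0) ds1) dt0) dt1
          refine dvd_trans ?_ q1
          rw [hmul]; push_cast
          exact pow_dvd_pow _ (by omega)
        rw [Nat.cast_mul] at hdd
        exact (mul_dvd_mul_iff_left (by positivity)).1 hdd
      · have hdd : ((p ^ a : ℕ) : ℤ) * (((p ^ a : ℕ) : ℤ) * ((p ^ c : ℕ) : ℤ)) ∣
            (p ^ a : ℕ) * ((p ^ a : ℕ) * (((s0:ℤ) - t0) * ((s0:ℤ) - t1))) := by
          obtain ⟨k0, hk0⟩ := ds0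
          obtain ⟨k1, hk1⟩ := dt0
          obtain ⟨k2, hk2⟩ := dt1
          push_cast at hk0 hk1 hk2 q2 ⊢
          have f1 : (p:ℤ) ^ a * ((s0:ℤ) - t0) = (x 0 - y 0) - (p:ℤ) ^ a * (p:ℤ) ^ c * (k0 - k1) := by
            linear_combination hk1 - hk0
          have f2 : (p:ℤ) ^ a * ((s0:ℤ) - t1) = (x 0 - y 1) - (p:ℤ) ^ a * (p:ℤ) ^ c * (k0 - k2) := by
            linear_combination hk2 - hk0
          have e : (p:ℤ) ^ a * ((p:ℤ) ^ a * (((s0:ℤ) - t0) * ((s0:ℤ) - t1))) =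
            (x 0 - η - (y 0 - η)) * (x 0 - η - (y 1 - η)) -
            ((p:ℤ) ^ a * ((p:ℤ) ^ a * (p:ℤ) ^ c)) * (((s0:ℤ) - t0) * (k0 - k2) + ((s0:ℤ) - t1) * (k0 - k1) +
              (p:ℤ) ^ c * (k0 - k1) * (k0 - k2)) := by
            have : (p:ℤ) ^ a * ((p:ℤ) ^ a * (((s0:ℤ) - t0) * ((s0:ℤ) - t1))) =
              ((p:ℤ) ^ a * ((s0:ℤ) - t0)) * ((p:ℤ) ^ a * ((s0:ℤ) - t1)) := by ring
            have g1 : x 0 - y 0 = (p:ℤ) ^ a * ((s0:ℤ) - t0) + (p:ℤ) ^ a * (p:ℤ) ^ c * (k0 - k1) := by linarith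
            have g2 : x 0 - y 1 = (p:ℤ) ^ a * ((s0:ℤ) - t1) + (p:ℤ) ^ a * (p:ℤ) ^ c * (k0 - k2) := by linarith
            have g3 : x 0 - η - (y 0 - η) = x 0 - y 0 := by ring
            have g4 : x 0 - η - (y 1 - η) = x 0 - y 1 := by ring
            rw [g3, g4, g1, g2]; ring
          rw [e]
          refine dvd_sub ?_ (dvd_mul_right _ _)
          refine dvd_trans ?_ q2
          rw [← pow_add, ← pow_add]
          exact pow_dvd_pow _ (by omega)
        have h0 : ((p ^ a : ℕ) : ℤ) ≠ 0 := by positivity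
        exact (mul_dvd_mul_iff_left h0).1 ((mul_dvd_mul_iff_left h0).1 hdd)
    · rw [hmul] at ds0 ds1 dt0 dt1
      rw [mem_filter, mem_product, mem_vec6, mem_vec6]
      exact ⟨⟨⟨mem_cl.2 ⟨(mem_cl.1 x0).1, ds0⟩, mem_cl.2 ⟨(mem_cl.1 x1).1, ds1⟩, x2, x3, x4, x5⟩,
        ⟨mem_cl.2 ⟨(mem_cl.1 y0).1, dt0⟩, mem_cl.2 ⟨(mem_cl.1 y1).1, dt1⟩, y2, y3, y4, y5⟩⟩, hps⟩
  have hAU : ∀ t, (V2 (A t) B : ℝ) ≤ U := by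
    intro t
    apply hU
    intro hd
    apply hne
    have h1 : (p:ℤ) ∣ (p ^ a : ℕ) * (t : ℤ) := (hpdvd _ (dvd_refl _)).mul_right _
    have e : ξ - η = ξ + (p ^ a : ℕ) * (t : ℤ) - η - (p ^ a : ℕ) * (t : ℤ) := by ring
    rw [e]; exact dvd_sub hd h1
  calc (V2 (cl X (p ^ a) ξ) B : ℝ) ≤ ((∑ t ∈ sols (p ^ c),
      cnt ![A t.1.1, A t.1.2, B, B, B, B] ![A t.2.1, A t.2.2, B, B, B, B] : ℕ) : ℝ) := by
        exact_mod_cast hsub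
    _ ≤ ∑ t ∈ sols (p ^ c), U := by
      push_cast
      refine sum_le_sum fun t _ => ?_
      have := cnt_mix ![A t.1.1, A t.1.2, A t.2.1, A t.2.2] B U (by
        intro i; fin_cases i
        · exact hAU _
        · exact hAU _
        · exact hAU _
        · exact hAU _)
      simpa using this
    _ ≤ _ := by
      rw [sum_const, nsmul_eq_mul]
      have h1 : ((sols (p ^ c)).card : ℝ) ≤ (((c + 1) * p ^ (2 * c) : ℕ) : ℝ) := by
        exact_mod_cast card_sols hp c
      have h2 : (((c + 1) * p ^ (2 * c) : ℕ) : ℝ) = (2 * (b - a : ℕ) + 1) * (p : ℝ) ^ (4 * (b - a)) := by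
        have : 2 * c = 4 * (b - a) := by omega
        rw [this, hc]; push_cast; rfl
      rw [← h2]; gcongr

end WW

namespace WW
open Finset

def JB (Δ c : ℝ) : Prop := ∀ X : ℕ, 1 ≤ X → (JJ X : ℝ) ≤ Real.exp (c + (6 + Δ) * Real.log X)

lemma V0_bd {Δ c : ℝ} (hΔ : 0 ≤ Δ) (h : JB Δ c) (X p b : ℕ) (hp : 0 < p) (hX : p ^ b ≤ X) (ξ : ℤ) :
    (V0 (cl X (p ^ b) ξ) : ℝ) ≤ Real.exp (c + (6 + Δ) * (Real.log 2 + Real.log X - b * Real.log p)) := by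
  have hm : 0 < p ^ b := by positivity
  have h1 : (V0 (cl X (p ^ b) ξ) : ℝ) ≤ JJ (X / p ^ b + 1) := by exact_mod_cast V0_cl X (p ^ b) hm ξ
  refine h1.trans ((h _ (Nat.le_add_left 1 _)).trans ?_)
  apply Real.exp_le_exp.2
  have hp' : (0:ℝ) < (p:ℝ) ^ b := by positivity
  have hX' : (p:ℝ) ^ b ≤ X := by exact_mod_cast hX
  have hX0 : (0:ℝ) < X := lt_of_lt_of_le hp' hX'
  have h2 : ((X / p ^ b + 1 : ℕ) : ℝ) ≤ 2 * X / p ^ b := by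
    push_cast
    have : ((X / p ^ b : ℕ) : ℝ) ≤ X / (p:ℝ) ^ b := by
      have := @Nat.cast_div_le ℝ _ _ _ X (p ^ b)
      simpa using this
    have : (1:ℝ) ≤ X / (p:ℝ) ^ b := by rwa [le_div_iff₀ hp', one_mul]
    rw [mul_div_assoc]; linarith
  have h3 : Real.log ((X / p ^ b + 1 : ℕ) : ℝ) ≤ Real.log 2 + Real.log X - b * Real.log p := by
    refine (Real.log_le_log (by positivity) h2).trans (le_of_eq ?_)
    rw [Real.log_div (by positivity) (by positivity), Real.log_mul (by norm_num) hX0.ne', Real.log_pow]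
  have : 0 ≤ 6 + Δ := by linarith
  nlinarith [mul_le_mul_of_nonneg_left h3 this]

lemma rp {v x θ : ℝ} (hv : 0 ≤ v) (h : v ≤ Real.exp x) (hθ : 0 ≤ θ) : v ^ θ ≤ Real.exp (x * θ) := by
  rw [Real.exp_mul]; exact Real.rpow_le_rpow hv h hθ

lemma npos (n : ℕ) : (0:ℝ) ≤ n := Nat.cast_nonneg n

lemma iter {Δ c : ℝ} (hΔ : 0 ≤ Δ) (h : JB Δ c) (n : ℕ) : ∀ a b : ℕ, 1 ≤ a → a ≤ b → ∃ C : ℝ,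
    ∀ p X : ℕ, p.Prime → 5 ≤ p → p ^ (3 ^ n * b) ≤ X → ∀ ξ η : ℤ, ¬ (p : ℤ) ∣ ξ - η →
    (V2 (cl X (p ^ a) ξ) (cl X (p ^ b) η) : ℝ) ≤
      Real.exp (C + (6 + Δ) * Real.log X - (2 * a + 4 * b + n * Δ * (3 * b - a) / 6) * Real.log p) := by
  induction n with
  | zero =>
    intro a b ha hab
    refine ⟨c + (6 + Δ) * Real.log 2, fun p X hp hp5 hX ξ η hne => ?_⟩
    have hp0 : 0 < p := by omega
    simp only [pow_zero, one_mul] at hX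
    have hXa : p ^ a ≤ X := (Nat.pow_le_pow_right hp0 hab).trans hX
    refine (V2_le_0 _ _).trans ?_
    have e1 := rp (npos _) (V0_bd hΔ h X p a hp0 hXa ξ) (θ := 1/3) (by norm_num)
    have e2 := rp (npos _) (V0_bd hΔ h X p b hp0 hX η) (θ := 1 - 1/3) (by norm_num)
    refine (mul_le_mul e1 e2 (by positivity) (by positivity)).trans ?_
    rw [← Real.exp_add]
    apply Real.exp_le_exp.2
    have hl : 0 ≤ Real.log p := Real.log_natCast_nonneg p
    have : 0 ≤ Δ * ((a:ℝ) + 2 * b) * Real.log p := by positivity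
    push_cast
    nlinarith
  | succ n ih =>
    intro a b ha hab
    obtain ⟨C1, h1⟩ := ih b (2 * b - a) (by omega) (by omega)
    obtain ⟨C2, h2⟩ := ih b (3 * b) (by omega) (by omega)
    have hK : (0:ℝ) < 2 * ((b - a : ℕ) : ℝ) + 1 := by positivity
    refine ⟨Real.log (2 * ((b - a : ℕ) : ℝ) + 1) + C1 / 3 + C2 / 6 + (c + (6 + Δ) * Real.log 2) / 2,
      fun p X hp hp5 hX ξ η hne => ?_⟩
    have hp0 : 0 < p := by omega
    have hpr : (0:ℝ) < p := by exact_mod_cast hp0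
    have hX1 : p ^ (3 ^ n * (2 * b - a)) ≤ X := by
      refine (Nat.pow_le_pow_right hp0 ?_).trans hX
      rw [pow_succ, mul_assoc]; exact Nat.mul_le_mul_left _ (by omega)
    have hX2 : p ^ (3 ^ n * (3 * b)) ≤ X := by
      refine (Nat.pow_le_pow_right hp0 ?_).trans hX
      rw [pow_succ, mul_assoc]
    have hX3 : p ^ b ≤ X := by
      refine (Nat.pow_le_pow_right hp0 ?_).trans hX
      exact Nat.le_mul_of_pos_left _ (by positivity)
    set l := Real.log p with hl'
    have hl : 0 ≤ l := Real.log_natCast_nonneg p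
    set M := (6 + Δ) * Real.log X with hM
    have ppow : ∀ m : ℕ, (p:ℝ) ^ m = Real.exp (m * l) := by
      intro m; rw [hl', Real.exp_nat_mul, Real.exp_log hpr]
    have key : ∀ ξ' : ℤ, ¬ (p:ℤ) ∣ ξ' - η →
        (V2 (cl X (p ^ (2 * b - a)) ξ') (cl X (p ^ b) η) : ℝ) ≤ Real.exp (
          (C1 + M - (2 * b + 4 * ((2 * b - a : ℕ):ℝ) + n * Δ * (3 * ((2 * b - a : ℕ):ℝ) - b) / 6) * l) * (1/3)
          + (((3 * b - (2 * b - a) : ℕ):ℝ) * l + ((C2 + M - (2 * b + 4 * ((3 * b : ℕ):ℝ) + n * Δ * (3 * ((3 * b : ℕ):ℝ) - b) / 6) * l) * (1/4)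
             + (c + (6 + Δ) * (Real.log 2 + Real.log X - b * l)) * (1 - 1/4))) * (1 - 1/3)) := by
      intro ξ' hne'
      have hne2 : ¬ (p:ℤ) ∣ η - ξ' := by rwa [← dvd_neg, neg_sub]
      have e1 := rp (npos _) (h1 p X hp hp5 hX1 η ξ' hne2) (θ := 1/3) (by norm_num)
      have e2 : (V1 (cl X (p ^ (2 * b - a)) ξ') (cl X (p ^ b) η) : ℝ) ≤
          Real.exp (((3 * b - (2 * b - a) : ℕ):ℝ) * l + ((C2 + M - (2 * b + 4 * ((3 * b : ℕ):ℝ) + n * Δ * (3 * ((3 * b : ℕ):ℝ) - b) / 6) * l) * (1/4)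
             + (c + (6 + Δ) * (Real.log 2 + Real.log X - b * l)) * (1 - 1/4))) := by
        rw [Real.exp_add, ← ppow]
        refine V1_step hp hp5 X (2 * b - a) b (by omega) (by omega) ξ' η hne' _ (fun ξ'' hne'' => ?_)
        have hne3 : ¬ (p:ℤ) ∣ η - ξ'' := by rwa [← dvd_neg, neg_sub]
        refine (V1_le _ _).trans ?_
        have f1 := rp (npos _) (h2 p X hp hp5 hX2 η ξ'' hne3) (θ := 1/4) (by norm_num)
        have f2 := rp (npos _) (V0_bd hΔ h X p b hp0 hX3 η) (θ := 1 - 1/4) (by norm_num)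
        refine (mul_le_mul f1 f2 (by positivity) (by positivity)).trans ?_
        rw [← Real.exp_add]
      have e3 := rp (npos _) e2 (θ := 1 - 1/3) (by norm_num)
      refine (V2_le_a _ _).trans ((mul_le_mul e1 e3 (by positivity) (by positivity)).trans ?_)
      rw [← Real.exp_add]
    refine (V2_step hp hp5 X a b ha hab ξ η hne _ (by positivity) key).trans ?_
    rw [ppow]
    nth_rewrite 1 [← Real.exp_log hK]
    rw [← Real.exp_add, ← Real.exp_add]
    apply Real.exp_le_exp.2
    have c1 : ((2 * b - a : ℕ):ℝ) = 2 * b - a := by rw [Nat.cast_sub (by omega)]; push_cast; ring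
    have c2 : ((3 * b - (2 * b - a) : ℕ):ℝ) = a + b := by
      rw [show 3 * b - (2 * b - a) = a + b by omega]; push_cast; ring
    have c3 : ((4 * (b - a) : ℕ):ℝ) = 4 * b - 4 * a := by
      rw [show 4 * (b - a) = 4 * b - 4 * a by omega, Nat.cast_sub (by omega)]; push_cast; ring
    rw [c1, c2, c3]
    have : 0 ≤ Δ * a * l / 6 := by positivity
    push_cast
    rw [hM]
    linarith

lemma JB_triv : JB 6 0 := by
  intro X hX
  have h1 : JJ X ≤ X ^ 12 := by
    unfold JJ V0 cnt
    refine (card_filter_le _ _).trans ?_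
    rw [card_product, Fintype.card_piFinset]
    simp
    rw [← pow_add]
  have hX0 : (0:ℝ) < X := by exact_mod_cast hX
  have : (JJ X : ℝ) ≤ (X:ℝ) ^ 12 := by exact_mod_cast h1
  refine this.trans (le_of_eq ?_)
  rw [zero_add, show (6 + 6 : ℝ) = ((12 : ℕ) : ℝ) by norm_num, Real.exp_nat_mul, Real.exp_log hX0]

lemma JB_mono {Δ Δ' c : ℝ} (h : JB Δ c) (hd : Δ ≤ Δ') : JB Δ' c := by
  intro X hX
  refine (h X hX).trans (Real.exp_le_exp.2 ?_)
  have : 0 ≤ Real.log X := Real.log_natCast_nonneg X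
  nlinarith

lemma find_prime (r X : ℕ) (hr : 0 < r) (hX : 8 ^ r ≤ X) : ∃ p : ℕ, p.Prime ∧ 5 ≤ p ∧ p ^ r ≤ X ∧
    Real.log X / r - Real.log 2 ≤ Real.log p := by
  set z : ℝ := (X:ℝ) ^ (1 / (r:ℝ)) with hz
  have hrr : (0:ℝ) < r := by exact_mod_cast hr
  have hX0 : 0 < X := lt_of_lt_of_le (by positivity) hX
  have hXr : (0:ℝ) < X := by exact_mod_cast hX0
  have hz0 : 0 < z := Real.rpow_pos_of_pos hXr _
  have hzr : z ^ r = X := by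
    rw [hz, ← Real.rpow_natCast, ← Real.rpow_mul hXr.le, one_div_mul_cancel hrr.ne', Real.rpow_one]
  have hz8 : (8:ℝ) ≤ z := by
    by_contra hc
    push Not at hc
    have := pow_lt_pow_left₀ hc hz0.le hr.ne'
    rw [hzr] at this
    have h8 : ((8:ℝ)) ^ r ≤ X := by exact_mod_cast hX
    linarith
  have hZ : 8 ≤ ⌊z⌋₊ := Nat.le_floor (by exact_mod_cast hz8)
  obtain ⟨p, hp, h1, h2⟩ := Nat.exists_prime_lt_and_le_two_mul (⌊z⌋₊ / 2) (by omega)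
  refine ⟨p, hp, by omega, ?_, ?_⟩
  · have h3 : (p:ℝ) ≤ z := by
      have : p ≤ ⌊z⌋₊ := by omega
      exact (Nat.cast_le.2 this).trans (Nat.floor_le hz0.le)
    have := pow_le_pow_left₀ (by positivity) h3 r
    rw [hzr] at this
    exact_mod_cast this
  · have h3 : z / 2 ≤ p := by
      have h4 : ⌊z⌋₊ + 1 ≤ 2 * p := by omega
      have h5 := Nat.lt_floor_add_one z
      have h6 : ((⌊z⌋₊ + 1 : ℕ):ℝ) ≤ 2 * p := by exact_mod_cast h4
      push_cast at h6
      linarith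
    have := Real.log_le_log (by positivity) h3
    rw [Real.log_div hz0.ne' (by norm_num), hz, Real.log_rpow hXr] at this
    refine le_trans (le_of_eq ?_) this
    ring

lemma improve {D : ℝ} (hD : 0 < D) : ∃ δ : ℝ, 0 < δ ∧ ∀ Δ c : ℝ, D ≤ Δ → JB Δ c → ∃ c', JB (Δ - δ) c' := by
  obtain ⟨n, hn⟩ := exists_nat_ge (39 / D)
  rw [div_le_iff₀ hD] at hn
  have hr : 0 < 3 ^ n := by positivity
  have hrr : (0:ℝ) < ((3 ^ n : ℕ) : ℝ) := by exact_mod_cast hr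
  refine ⟨1 / ((3 ^ n : ℕ) : ℝ), by positivity, fun Δ c hΔ h => ?_⟩
  have hΔ0 : 0 ≤ Δ := by linarith
  obtain ⟨C, hC⟩ := iter hΔ0 h n 1 1 le_rfl le_rfl
  set δ : ℝ := 1 / ((3 ^ n : ℕ) : ℝ) with hδ
  have hδ0 : 0 < δ := by positivity
  have hnΔ : 39 ≤ n * Δ := hn.trans (by gcongr)
  set c1 : ℝ := max (c + δ * Real.log ((8 ^ (3 ^ n) : ℕ) : ℝ))
    (Real.log 2 + max (12 * Real.log 2 + (c + (6 + Δ) * Real.log 2)) (12 * Real.log 2 + C) + 5 * Real.log 2) with hc1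
  refine ⟨c1, fun X hX => ?_⟩
  have hX0 : (0:ℝ) < X := by exact_mod_cast hX
  have hlX : 0 ≤ Real.log X := Real.log_natCast_nonneg X
  by_cases hs : 8 ^ 3 ^ n ≤ X
  · obtain ⟨p, hp, hp5, hpX, hpl⟩ := find_prime (3 ^ n) X hr hs
    have hp0 : 0 < p := by omega
    have hpr : (0:ℝ) < p := by exact_mod_cast hp0
    have hpX1 : p ^ 1 ≤ X := (Nat.pow_le_pow_right hp0 hr).trans hpX
    set l := Real.log p with hl'
    have hl : 0 ≤ l := Real.log_natCast_nonneg p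
    have hcov := cover X p hp0 (Real.exp (c + (6 + Δ) * (Real.log 2 + Real.log X - l)))
      (Real.exp (C + (6 + Δ) * Real.log X - (6 + n * Δ / 3) * l))
      (fun ξ => by have := V0_bd hΔ0 h X p 1 hp0 hpX1 ξ; simpa using this)
      (fun ξ η hne => by
        have := hC p X hp hp5 (by simpa using hpX) ξ η hne
        rw [pow_one] at this
        refine this.trans (le_of_eq ?_)
        congr 1; push_cast; ring) (by positivity)
    have hpe : (p:ℝ) = Real.exp l := (Real.exp_log hpr).symm
    have h2e : (2:ℝ) = Real.exp (Real.log 2) := (Real.exp_log (by norm_num)).symm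
    set Q := max (12 * Real.log 2 + (c + (6 + Δ) * Real.log 2)) (12 * Real.log 2 + C) with hQ
    have t1 : (2:ℝ) ^ 12 * (p * Real.exp (c + (6 + Δ) * (Real.log 2 + Real.log X - l))) ≤
        Real.exp (Q + (6 + Δ) * Real.log X - 5 * l) := by
      have : (2:ℝ) ^ 12 = Real.exp (12 * Real.log 2) := by
        rw [show (12:ℝ) = ((12:ℕ):ℝ) by norm_num, Real.exp_nat_mul, ← h2e]
      rw [this, hpe, ← Real.exp_add, ← Real.exp_add]
      apply Real.exp_le_exp.2
      have := le_max_left (12 * Real.log 2 + (c + (6 + Δ) * Real.log 2)) (12 * Real.log 2 + C)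
      have h9 : 0 ≤ Δ * l := by positivity
      nlinarith
    have t2 : (2 * (p:ℝ)) ^ 12 * (p * (p * Real.exp (C + (6 + Δ) * Real.log X - (6 + n * Δ / 3) * l))) ≤
        Real.exp (Q + (6 + Δ) * Real.log X - 5 * l) := by
      have : (2 * (p:ℝ)) ^ 12 = Real.exp (12 * (Real.log 2 + l)) := by
        rw [show (12:ℝ) = ((12:ℕ):ℝ) by norm_num, Real.exp_nat_mul, Real.exp_add, ← h2e, ← hpe]
      rw [this]
      nth_rewrite 1 [hpe]
      nth_rewrite 1 [hpe]
      rw [← Real.exp_add, ← Real.exp_add, ← Real.exp_add]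
      apply Real.exp_le_exp.2
      have := le_max_right (12 * Real.log 2 + (c + (6 + Δ) * Real.log 2)) (12 * Real.log 2 + C)
      have h9 : 39 * l ≤ (n * Δ) * l := by gcongr
      nlinarith
    have t3 : (JJ X : ℝ) ≤ Real.exp (Real.log 2 + (Q + (6 + Δ) * Real.log X - 5 * l)) := by
      rw [Real.exp_add, ← h2e]; linarith
    refine t3.trans (Real.exp_le_exp.2 ?_)
    have := le_max_right (c + δ * Real.log ((8 ^ (3 ^ n) : ℕ) : ℝ)) (Real.log 2 + Q + 5 * Real.log 2)
    rw [← hc1] at this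
    have h10 : Real.log X / ((3 ^ n : ℕ):ℝ) = δ * Real.log X := by rw [hδ]; ring
    rw [h10] at hpl
    have h11 : 0 ≤ δ * Real.log X := by positivity
    nlinarith
  · push Not at hs
    refine (h X hX).trans (Real.exp_le_exp.2 ?_)
    have h2 : Real.log X ≤ Real.log ((8 ^ (3 ^ n) : ℕ) : ℝ) :=
      Real.log_le_log hX0 (by exact_mod_cast hs.le)
    have := le_max_left (c + δ * Real.log ((8 ^ (3 ^ n) : ℕ) : ℝ)) (Real.log 2 + max (12 * Real.log 2 + (c + (6 + Δ) * Real.log 2)) (12 * Real.log 2 + C) + 5 * Real.log 2)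
    rw [← hc1] at this
    nlinarith [mul_le_mul_of_nonneg_left h2 hδ0.le]

theorem vmvt (ε : ℝ) (hε : 0 < ε) : ∃ c, JB ε c := by
  obtain ⟨δ, hδ, h⟩ := improve hε
  have key : ∀ m : ℕ, ∃ c, JB (max ε (6 - m * δ)) c := by
    intro m
    induction m with
    | zero => exact ⟨0, JB_mono JB_triv (by simp)⟩
    | succ m ih =>
      obtain ⟨c, hc⟩ := ih
      obtain ⟨c', hc'⟩ := h _ c (le_max_left _ _) hc
      refine ⟨c', JB_mono hc' ?_⟩
      rw [sub_le_iff_le_add]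
      apply max_le
      · have := le_max_left ε (6 - ((m+1:ℕ):ℝ) * δ); linarith
      · have := le_max_right ε (6 - ((m+1:ℕ):ℝ) * δ); push_cast at this ⊢; linarith
  obtain ⟨m, hm⟩ := exists_nat_ge (6 / δ)
  rw [div_le_iff₀ hδ] at hm
  obtain ⟨c, hc⟩ := key m
  refine ⟨c, JB_mono hc (max_le le_rfl (by linarith))⟩

lemma JJ_bound (ε : ℝ) (hε : 0 < ε) : ∃ C : ℝ, 0 < C ∧ ∀ N : ℕ, 1 ≤ N → (JJ N : ℝ) ≤ C * (N:ℝ) ^ (6 + ε) := by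
  obtain ⟨c, hc⟩ := vmvt ε hε
  refine ⟨Real.exp c, Real.exp_pos _, fun N hN => (hc N hN).trans (le_of_eq ?_)⟩
  have : (0:ℝ) < N := by exact_mod_cast hN
  rw [Real.exp_add, Real.rpow_def_of_pos this, mul_comm (6 + ε)]
end WW

namespace WW
open Finset

lemma div_bound (ε : ℝ) (hε : 0 < ε) : ∃ C : ℝ, 1 ≤ C ∧ ∀ n : ℕ, n ≠ 0 →
    ((n.divisors.card : ℕ) : ℝ) ≤ C * (n:ℝ) ^ ε := by
  obtain ⟨P, hP⟩ := exists_nat_ge ((2:ℝ) ^ (1 / ε))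
  set K : ℝ := max 1 (1 / (ε * Real.log 2)) with hK
  have hl2 : 0 < Real.log 2 := Real.log_pos (by norm_num)
  have hK1 : 1 ≤ K := le_max_left _ _
  have hK2 : 1 ≤ K * (ε * Real.log 2) := by
    have : 1 / (ε * Real.log 2) ≤ K := le_max_right _ _
    rwa [div_le_iff₀ (by positivity)] at this
  refine ⟨K ^ P, one_le_pow₀ hK1, fun n hn => ?_⟩
  have hbern : ∀ v : ℕ, ((v:ℝ) + 1) ≤ 2 ^ v := fun v => by
    have := Nat.lt_two_pow_self (n := v)
    exact_mod_cast this
  have hterm : ∀ p ∈ n.primeFactors, ((n.factorization p + 1 : ℕ) : ℝ) ≤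
      (if p < P then K else 1) * ((p:ℝ) ^ (n.factorization p)) ^ ε := by
    intro p hp
    have hp2 : 2 ≤ p := (Nat.prime_of_mem_primeFactors hp).two_le
    have hp2' : (2:ℝ) ≤ p := by exact_mod_cast hp2
    set v := n.factorization p
    push_cast
    split_ifs with h
    · have h1 : Real.exp (ε * Real.log 2 * v) ≤ ((p:ℝ) ^ v) ^ ε := by
        have : Real.exp (ε * Real.log 2 * v) = ((2:ℝ) ^ v) ^ ε := by
          rw [← Real.rpow_natCast, ← Real.rpow_mul (by norm_num), Real.rpow_def_of_pos (by norm_num)]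
          congr 1; ring
        rw [this]
        gcongr
      have h2 := Real.add_one_le_exp (ε * Real.log 2 * v)
      have hv : (0:ℝ) ≤ v := npos _
      have h3 : K * (ε * Real.log 2 * v + 1) ≤ K * ((p:ℝ) ^ v) ^ ε := by
        gcongr; exact h2.trans h1
      have h4 : 1 * (v:ℝ) ≤ K * (ε * Real.log 2) * v := by gcongr
      nlinarith
    · push Not at h
      rw [one_mul]
      refine (hbern v).trans ?_
      have h1 : (2:ℝ) ≤ (p:ℝ) ^ ε := by
        have h3 : (2:ℝ) ^ (1 / ε) ≤ p := hP.trans (by exact_mod_cast h)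
        have := Real.rpow_le_rpow (by positivity) h3 hε.le
        rwa [← Real.rpow_mul (by norm_num), one_div_mul_cancel hε.ne', Real.rpow_one] at this
      calc (2:ℝ) ^ v ≤ ((p:ℝ) ^ ε) ^ v := by gcongr
        _ = _ := by
          rw [← Real.rpow_natCast, ← Real.rpow_mul (by positivity), ← Real.rpow_natCast, ← Real.rpow_mul (by positivity), mul_comm]
  rw [Nat.card_divisors hn]
  push_cast
  have h1 : ∏ p ∈ n.primeFactors, ((n.factorization p : ℝ) + 1) ≤
      ∏ p ∈ n.primeFactors, ((if p < P then K else 1) * ((p:ℝ) ^ (n.factorization p)) ^ ε) := by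
    apply prod_le_prod
    · intros; positivity
    · intro p hp; have := hterm p hp; push_cast at this; exact this
  refine h1.trans ?_
  rw [prod_mul_distrib]
  have h2 : ∏ p ∈ n.primeFactors, ((p:ℝ) ^ (n.factorization p)) ^ ε = (n:ℝ) ^ ε := by
    rw [Real.finset_prod_rpow _ _ (by intros; positivity)]
    congr 1
    have := Nat.prod_factorization_pow_eq_self hn
    rw [Finsupp.prod, Nat.support_factorization] at this
    nth_rewrite 3 [← this]
    push_cast
    rfl
  rw [h2]
  gcongr
  rw [prod_ite, prod_const, prod_const_one, mul_one]
  apply pow_le_pow_right₀ hK1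
  calc _ ≤ (range P).card := by
        apply card_le_card
        intro p hp
        simp at hp ⊢
        exact hp.2
    _ = P := card_range P
end WW

namespace WW
open Finset

lemma ee_hasSum (x : ℝ) : HasSum (fun m : ℕ => (2 * (Real.pi : ℂ) * Complex.I * ((x:ℝ):ℂ)) ^ m / (m.factorial : ℂ)) (ee x) := by
  have := NormedSpace.expSeries_div_hasSum_exp (2 * (Real.pi : ℂ) * Complex.I * ((x:ℝ):ℂ))
  rw [← Complex.exp_eq_exp_ℂ] at this
  exact this

lemma taylorT {ι σ : Type*} (Q : Finset ι) (S : Finset σ) (w : ι → ℝ) (hw : ∀ p ∈ Q, 0 ≤ w p)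
    (Ψ : ι → σ → ℂ) (B : ℝ) (hB : 0 ≤ B)
    (h : ∀ c : σ → ℝ, (∀ s, 0 ≤ c s ∧ c s ≤ 1) → ∑ p ∈ Q, w p * ‖∑ s ∈ S, (c s : ℂ) * Ψ p s‖ ^ 2 ≤ B)
    (u : σ → ℝ) (hu : ∀ s, 0 ≤ u s ∧ u s ≤ 1) (δ : ι → ℝ) (hδ : ∀ p, 0 ≤ δ p ∧ δ p ≤ 1)
    (c : σ → ℝ) (hc : ∀ s, 0 ≤ c s ∧ c s ≤ 1) :
    ∑ p ∈ Q, w p * ‖∑ s ∈ S, (c s : ℂ) * (Ψ p s * ee (δ p * u s))‖ ^ 2 ≤ Real.exp (4 * Real.pi) * B := by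
  set A : ℕ → ℝ := fun m => (2 * Real.pi) ^ m / (m.factorial : ℝ) with hA
  have hA0 : ∀ m, 0 ≤ A m := fun m => by have := Real.pi_pos; positivity
  set z : ι → ℕ → ℂ := fun p m => ∑ s ∈ S, ((c s * u s ^ m : ℝ) : ℂ) * Ψ p s with hz
  set PM : ℕ → ι → ℂ := fun M p => ∑ s ∈ S, (c s : ℂ) * (Ψ p s *
    ∑ m ∈ range M, (2 * (Real.pi : ℂ) * Complex.I * ((δ p * u s:ℝ):ℂ)) ^ m / (m.factorial : ℂ)) with hPM
  have hPM2 : ∀ M p, PM M p = ∑ m ∈ range M, ((2 * (Real.pi : ℂ) * Complex.I) ^ m / (m.factorial : ℂ) * ((δ p : ℝ):ℂ) ^ m) * z p m := by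
    intro M p
    simp only [hPM, hz, mul_sum]
    rw [sum_comm]
    refine sum_congr rfl fun m _ => sum_congr rfl fun s _ => ?_
    push_cast
    ring
  have hnorm : ∀ M p, ‖PM M p‖ ≤ ∑ m ∈ range M, A m * ‖z p m‖ := by
    intro M p
    rw [hPM2]
    refine (norm_sum_le _ _).trans (sum_le_sum fun m _ => ?_)
    rw [norm_mul, norm_mul, norm_div, norm_pow, norm_pow]
    have h1 : ‖(2 * (Real.pi : ℂ) * Complex.I)‖ = 2 * Real.pi := by
      simp [abs_of_pos Real.pi_pos]
    have h2 : ‖((m.factorial : ℂ))‖ = (m.factorial : ℝ) := by simp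
    have h3 : ‖((δ p : ℝ):ℂ)‖ ≤ 1 := by
      rw [Complex.norm_real, Real.norm_eq_abs, abs_of_nonneg (hδ p).1]; exact (hδ p).2
    rw [h1, h2]
    have h4 : ‖((δ p : ℝ):ℂ)‖ ^ m ≤ 1 := pow_le_one₀ (norm_nonneg _) h3
    calc A m * ‖((δ p : ℝ):ℂ)‖ ^ m * ‖z p m‖ ≤ A m * 1 * ‖z p m‖ := by
          have := hA0 m
          gcongr
      _ = _ := by ring
  have hsumA : ∀ M, ∑ m ∈ range M, A m ≤ Real.exp (2 * Real.pi) := fun M =>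
    Real.sum_le_exp_of_nonneg (by have := Real.pi_pos; positivity) M
  have hzB : ∀ m, ∑ p ∈ Q, w p * ‖z p m‖ ^ 2 ≤ B := by
    intro m
    apply h
    intro s
    have h1 := hc s
    have h2 := hu s
    exact ⟨mul_nonneg h1.1 (pow_nonneg h2.1 _), mul_le_one₀ h1.2 (pow_nonneg h2.1 _) (pow_le_one₀ h2.1 h2.2)⟩
  have hfin : ∀ M, ∑ p ∈ Q, w p * ‖PM M p‖ ^ 2 ≤ Real.exp (4 * Real.pi) * B := by
    intro M
    have hA00 : 0 ≤ ∑ m ∈ range M, A m := sum_nonneg fun m _ => hA0 m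
    calc ∑ p ∈ Q, w p * ‖PM M p‖ ^ 2
        ≤ ∑ p ∈ Q, w p * ((∑ m ∈ range M, A m) * ∑ m ∈ range M, A m * ‖z p m‖ ^ 2) := by
          refine sum_le_sum fun p hp => mul_le_mul_of_nonneg_left ?_ (hw p hp)
          refine (pow_le_pow_left₀ (norm_nonneg _) (hnorm M p) 2).trans ?_
          apply sum_sq_le_sum_mul_sum_of_sq_le_mul
          · intro i _; exact hA0 i
          · intro i _; have := hA0 i; positivity
          · intro i _; apply le_of_eq; ring
      _ = (∑ m ∈ range M, A m) * ∑ m ∈ range M, A m * ∑ p ∈ Q, w p * ‖z p m‖ ^ 2 := by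
          have e : ∑ m ∈ range M, A m * ∑ p ∈ Q, w p * ‖z p m‖ ^ 2 =
              ∑ p ∈ Q, w p * ∑ m ∈ range M, A m * ‖z p m‖ ^ 2 := by
            simp only [mul_sum]
            rw [sum_comm]
            exact sum_congr rfl fun _ _ => sum_congr rfl fun _ _ => by ring
          rw [e, mul_sum]
          exact sum_congr rfl fun _ _ => by ring
      _ ≤ (∑ m ∈ range M, A m) * ∑ m ∈ range M, A m * B := by
          gcongr with m hm
          exact hzB m
      _ = (∑ m ∈ range M, A m) ^ 2 * B := by rw [← sum_mul]; ring
      _ ≤ (Real.exp (2 * Real.pi)) ^ 2 * B := by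
          gcongr; exact hsumA M
      _ = _ := by rw [← Real.exp_nat_mul]; congr 2; push_cast; ring
  refine le_of_tendsto' (f := fun M => ∑ p ∈ Q, w p * ‖PM M p‖ ^ 2) (x := Filter.atTop) ?_ hfin
  refine tendsto_finset_sum _ fun p _ => ?_
  refine Filter.Tendsto.const_mul _ (Filter.Tendsto.pow (Filter.Tendsto.norm ?_) 2)
  refine tendsto_finset_sum _ fun s _ => ?_
  refine Filter.Tendsto.const_mul _ (Filter.Tendsto.const_mul _ ?_)
  exact (ee_hasSum _).tendsto_sum_nat

noncomputable def cell (L : ℕ) (t : ℝ) : ℕ := ⌊Int.fract t * L⌋₊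

lemma cell_lt (L : ℕ) (hL : 0 < L) (t : ℝ) : cell L t < L := by
  unfold cell
  have hL' : (0:ℝ) < L := by exact_mod_cast hL
  rw [Nat.floor_lt (by have := Int.fract_nonneg t; positivity)]
  have := Int.fract_lt_one t
  nlinarith

lemma cell_split (L : ℕ) (hL : 0 < L) (t : ℝ) (n : ℤ) :
    ee (t * n) = ee (cell L t * n / L) * ee (Int.fract (Int.fract t * L) * (n / L)) := by
  have hL' : (0:ℝ) < L := by exact_mod_cast hL
  rw [← ee_add]
  have h1 : t * n = (cell L t * n / L + Int.fract (Int.fract t * L) * (n / L)) + ((⌊t⌋ * n : ℤ):ℝ) := by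
    have h2 : (cell L t : ℝ) + Int.fract (Int.fract t * L) = Int.fract t * L := by
      unfold cell
      rw [natCast_floor_eq_intCast_floor (by have := Int.fract_nonneg t; positivity)]
      exact Int.floor_add_fract _
    have h3 : cell L t * n / L + Int.fract (Int.fract t * L) * (n / L) = ((cell L t : ℝ) + Int.fract (Int.fract t * L)) * (n / L) := by ring
    rw [h3, h2]
    have h4 := Int.floor_add_fract t
    push_cast
    field_simp
    nth_rewrite 1 [← h4]
    ring
  rw [h1, ee_add_int]

lemma large_sieve {ι σ : Type*} (Q : Finset ι) (S : Finset σ) (w : ι → ℝ) (hw : ∀ p ∈ Q, 0 ≤ w p)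
    (L : Fin 3 → ℕ) (hL : ∀ i, 0 < L i) (Φ : σ → Fin 3 → ℤ) (hΦ : ∀ s ∈ S, ∀ i, 0 ≤ Φ s i ∧ Φ s i ≤ L i - 1)
    (τ : ι → Fin 3 → ℝ) (K : ℝ) (hK0 : 0 ≤ K)
    (hK : ∀ j : Fin 3 → ℕ, ∑ p ∈ Q.filter (fun p => ∀ i, cell (L i) (τ p i) = j i), w p ≤ K) :
    ∑ p ∈ Q, w p * ‖∑ s ∈ S, ee (∑ i, τ p i * Φ s i)‖ ^ 2 ≤
      Real.exp (4 * Real.pi) ^ 3 * (K * ((∏ i, (L i : ℝ)) * ((S ×ˢ S).filter (fun z => Φ z.1 = Φ z.2)).card)) := by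
  classical
  set J : ℝ := (((S ×ˢ S).filter (fun z => Φ z.1 = Φ z.2)).card : ℝ) with hJ
  set jj : ι → Fin 3 → ℕ := fun p i => cell (L i) (τ p i) with hjj
  have base : ∀ c : σ → ℝ, (∀ s, 0 ≤ c s ∧ c s ≤ 1) →
      ∑ p ∈ Q, w p * ‖∑ s ∈ S, (c s : ℂ) * ee (∑ i, (jj p i : ℝ) * Φ s i / L i)‖ ^ 2 ≤ K * ((∏ i, (L i : ℝ)) * J) := by
    intro c hc
    set G : (Fin 3 → ℕ) → ℝ := fun j => ‖∑ s ∈ S, (c s : ℂ) * ee (∑ i, (j i : ℝ) * Φ s i / L i)‖ ^ 2 with hG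
    have h1 : ∑ p ∈ Q, w p * G (jj p) = ∑ j ∈ Fintype.piFinset (fun i => range (L i)), (∑ p ∈ Q.filter (fun p => jj p = j), w p) * G j := by
      rw [← sum_fiberwise_of_maps_to (s := Q) (t := Fintype.piFinset (fun i => range (L i))) (g := jj)]
      · refine sum_congr rfl fun j _ => ?_
        rw [sum_mul]
        refine sum_congr rfl fun p hp => ?_
        rw [(mem_filter.1 hp).2]
      · intro p _
        simp only [Fintype.mem_piFinset, mem_range]
        intro i; exact cell_lt _ (hL i) _
    have h2 : ∑ j ∈ Fintype.piFinset (fun i => range (L i)), (∑ p ∈ Q.filter (fun p => jj p = j), w p) * G j ≤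
        ∑ j ∈ Fintype.piFinset (fun i => range (L i)), K * G j := by
      refine sum_le_sum fun j _ => mul_le_mul_of_nonneg_right ?_ (by positivity)
      refine le_trans (le_of_eq ?_) (hK j)
      congr 1
      ext p
      simp [hjj, funext_iff]
    have h3 : ∑ j ∈ Fintype.piFinset (fun i => range (L i)), G j ≤ (∏ i, (L i : ℝ)) * J := by
      have ho := orth3 S S (fun s => (c s : ℂ)) (fun s => (c s : ℂ)) L hL Φ Φ
      have e1 : ((∑ j ∈ Fintype.piFinset (fun i => range (L i)), G j : ℝ) : ℂ) =
          (∏ i, (L i : ℂ)) * ∑ s ∈ S, ∑ t ∈ S, (if ∀ i, (L i : ℤ) ∣ Φ s i - Φ t i then (c s : ℂ) * (starRingEnd ℂ) (c t : ℂ) else 0) := by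
        rw [← ho]
        push_cast
        refine sum_congr rfl fun j _ => ?_
        rw [Complex.mul_conj, hG]
        simp only
        rw [Complex.normSq_eq_norm_sq]
      have e2 : ((∑ j ∈ Fintype.piFinset (fun i => range (L i)), G j : ℝ) : ℂ) =
          (((∏ i, (L i : ℝ)) * ∑ s ∈ S, ∑ t ∈ S, (if ∀ i, (L i : ℤ) ∣ Φ s i - Φ t i then c s * c t else 0) : ℝ) : ℂ) := by
        rw [e1]
        push_cast
        congr 1
        refine sum_congr rfl fun s _ => sum_congr rfl fun t _ => ?_
        split_ifs <;> simp
      have e3 := Complex.ofReal_injective e2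
      rw [e3]
      refine mul_le_mul_of_nonneg_left ?_ (by positivity)
      rw [hJ, card_filter]
      push_cast
      rw [sum_product]
      refine sum_le_sum fun s hs => sum_le_sum fun t ht => ?_
      by_cases hd : ∀ i, (L i : ℤ) ∣ Φ s i - Φ t i
      · have heq : Φ s = Φ t := by
          ext i
          have b1 := hΦ s hs i
          have b2 := hΦ t ht i
          have := Int.eq_zero_of_abs_lt_dvd (hd i) (by rw [abs_lt]; constructor <;> omega)
          omega
        rw [if_pos hd, if_pos heq]
        exact mul_le_one₀ (hc s).2 (hc t).1 (hc t).2
      · rw [if_neg hd]; split_ifs <;> norm_num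
    calc _ = ∑ p ∈ Q, w p * G (jj p) := rfl
      _ ≤ ∑ j ∈ Fintype.piFinset (fun i => range (L i)), K * G j := h1 ▸ h2
      _ = K * ∑ j ∈ Fintype.piFinset (fun i => range (L i)), G j := by rw [mul_sum]
      _ ≤ _ := by gcongr
  -- restrict to S by truncation
  set u : Fin 3 → σ → ℝ := fun i s => if s ∈ S then (Φ s i : ℝ) / L i else 0 with hu
  have hu1 : ∀ i s, 0 ≤ u i s ∧ u i s ≤ 1 := by
    intro i s
    simp only [hu]
    split_ifs with hs
    · have b := hΦ s hs i
      have hL' : (0:ℝ) < L i := by exact_mod_cast hL i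
      have b1 : (0:ℝ) ≤ Φ s i := by exact_mod_cast b.1
      have b2 : (Φ s i : ℝ) ≤ L i := by
        have : Φ s i ≤ (L i : ℤ) := by omega
        exact_mod_cast this
      exact ⟨by positivity, (div_le_one hL').2 b2⟩
    · norm_num
  set δ : Fin 3 → ι → ℝ := fun i p => Int.fract (Int.fract (τ p i) * L i) with hδ
  have hδ1 : ∀ i p, 0 ≤ δ i p ∧ δ i p ≤ 1 := fun i p => ⟨Int.fract_nonneg _, (Int.fract_lt_one _).le⟩
  have hBB : 0 ≤ K * ((∏ i, (L i : ℝ)) * J) := by positivity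
  have E0 := Real.exp_pos (4 * Real.pi)
  have s1 := taylorT Q S w hw _ _ hBB base (u 0) (hu1 0) (δ 0) (hδ1 0)
  have s2 := taylorT Q S w hw _ _ (by positivity) s1 (u 1) (hu1 1) (δ 1) (hδ1 1)
  have s3 := taylorT Q S w hw _ _ (by positivity) s2 (u 2) (hu1 2) (δ 2) (hδ1 2) (fun _ => 1) (fun _ => by norm_num)
  refine le_trans (le_of_eq ?_) (s3.trans (le_of_eq (by ring)))
  refine sum_congr rfl fun p _ => ?_
  congr 3
  refine sum_congr rfl fun s hs => ?_
  simp only [Complex.ofReal_one, one_mul]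
  rw [ee_sum, ee_sum, Fin.prod_univ_three, Fin.prod_univ_three]
  simp only [hu, if_pos hs, hδ, hjj]
  rw [cell_split (L 0) (hL 0), cell_split (L 1) (hL 1), cell_split (L 2) (hL 2)]
  ring
end WW

namespace WW
open Finset

lemma sum_Icc_int (f : ℤ → ℂ) (u : ℤ) (n : ℕ) : ∑ y ∈ Icc u (u + n), f y = ∑ i ∈ range (n + 1), f (u + i) := by
  refine sum_bij' (fun y _ => (y - u).toNat) (fun i _ => u + (i:ℤ)) ?_ ?_ ?_ ?_ ?_
  · intro a ha; simp at ha ⊢; omega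
  · intro a ha; simp at ha ⊢; omega
  · intro a ha; simp at ha ⊢; omega
  · intro a ha; simp
  · intro a ha; simp at ha; congr 1; omega

lemma geom_bd (θ : ℝ) (u v : ℤ) : ‖ee θ - 1‖ * ‖∑ y ∈ Icc u v, ee (θ * y)‖ ≤ 2 := by
  by_cases h : u ≤ v
  · obtain ⟨n, rfl⟩ := Int.le.dest h
    rw [sum_Icc_int, ← norm_mul]
    have : (ee θ - 1) * ∑ i ∈ range (n + 1), ee (θ * ((u + i : ℤ):ℝ)) = ee (θ * (u + (n + 1:ℕ))) - ee (θ * u) := by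
      induction n with
      | zero => simp only [zero_add, sum_range_one, mul_add, ee_add]; simp [ee_zero]; ring
      | succ n ih =>
        rw [sum_range_succ, mul_add, ih (by omega)]
        push_cast
        simp only [mul_add, ee_add, mul_one]
        ring
    rw [this]
    refine (norm_sub_le _ _).trans ?_
    rw [norm_ee, norm_ee]; norm_num
  · rw [Icc_eq_empty h]; simp

lemma norm_ee_sub_one (θ : ℝ) (h0 : 0 ≤ θ) (h1 : θ ≤ 1) : 4 * min θ (1 - θ) ≤ ‖ee θ - 1‖ := by
  have e : ee θ = Complex.exp (Complex.I * ((2 * Real.pi * θ : ℝ) : ℂ)) := by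
    unfold ee; congr 1; push_cast; ring
  have hp := Real.pi_pos
  rw [e, Complex.norm_exp_I_mul_ofReal_sub_one, Real.norm_eq_abs]
  rw [show 2 * Real.pi * θ / 2 = Real.pi * θ by ring]
  have key : 2 * min θ (1 - θ) ≤ Real.sin (Real.pi * θ) := by
    rcases le_total θ (1 - θ) with h | h
    · rw [min_eq_left h]
      have := Real.mul_le_sin (x := Real.pi * θ) (by positivity) (by nlinarith)
      refine le_trans (le_of_eq ?_) this
      field_simp
    · rw [min_eq_right h, ← Real.sin_pi_sub]
      have := Real.mul_le_sin (x := Real.pi - Real.pi * θ) (by nlinarith) (by nlinarith)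
      refine le_trans (le_of_eq ?_) this
      field_simp
  exact le_trans (by linarith) (le_abs_self _)

lemma dir_bd (M r : ℕ) (h0 : 0 < r) (h1 : r < M) (u v : ℤ) :
    ‖∑ y ∈ Icc u v, ee (-((r:ℝ) * y / M))‖ ≤ M * ((r:ℝ)⁻¹ + ((M - r : ℕ) : ℝ)⁻¹) := by
  have hM : (0:ℝ) < M := by exact_mod_cast (by omega : 0 < M)
  have hr : (0:ℝ) < r := by exact_mod_cast h0
  have hr1 : (r:ℝ) < M := by exact_mod_cast h1
  have e : ‖∑ y ∈ Icc u v, ee (-((r:ℝ) * y / M))‖ = ‖∑ y ∈ Icc u v, ee ((r / M : ℝ) * y)‖ := by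
    rw [← Complex.norm_conj, map_sum]
    congr 1
    refine sum_congr rfl fun y _ => ?_
    rw [conj_ee]; congr 1; ring
  rw [e]
  have g := geom_bd (r / M) u v
  have n := norm_ee_sub_one (r / M) (by positivity) ((div_le_one hM).2 hr1.le)
  set Z := ‖∑ y ∈ Icc u v, ee ((r / M : ℝ) * y)‖
  have hZ : 0 ≤ Z := norm_nonneg _
  have hc : ((M - r : ℕ) : ℝ) = M - r := Nat.cast_sub h1.le
  rw [hc]
  have hMr : 0 < (M:ℝ) - r := by linarith
  have g2 : 4 * min ((r:ℝ) / M) (1 - r / M) * Z ≤ 2 := (mul_le_mul_of_nonneg_right n hZ).trans g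
  rw [mul_add]
  have p1 : 0 < (M:ℝ) * (r:ℝ)⁻¹ := by positivity
  have p2 : 0 < (M:ℝ) * ((M:ℝ) - r)⁻¹ := by positivity
  rcases min_choice ((r:ℝ) / M) (1 - r / M) with h | h
  · rw [h] at g2
    have : Z ≤ M * (r:ℝ)⁻¹ := by
      rw [← div_eq_mul_inv, le_div_iff₀ hr]
      have : 4 * (r / M) * Z * M = 4 * (Z * r) := by field_simp
      nlinarith [mul_le_mul_of_nonneg_right g2 hM.le]
    linarith
  · rw [h] at g2
    have : Z ≤ M * ((M:ℝ) - r)⁻¹ := by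
      rw [← div_eq_mul_inv, le_div_iff₀ hMr]
      have : 4 * (1 - r / M) * Z * M = 4 * (Z * (M - r)) := by field_simp
      nlinarith [mul_le_mul_of_nonneg_right g2 hM.le]
    linarith

lemma harm (M : ℕ) : ∑ r ∈ Ico 1 M, (r:ℝ)⁻¹ ≤ 1 + Real.log M := by
  have h := harmonic_le_one_add_log M
  refine le_trans ?_ h
  rw [harmonic_eq_sum_Icc]
  push_cast
  apply sum_le_sum_of_subset_of_nonneg
  · intro x hx; simp at hx ⊢; omega
  · intros; positivity

lemma complete (M : ℕ) (hM : 0 < M) (F : ℤ → ℂ) (u v : ℤ) (hu : 1 ≤ u) (hv : v ≤ M) :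
    ∃ r : ℕ, ‖∑ z ∈ Icc u v, F z‖ ≤ (3 + 2 * Real.log M) * ‖∑ z ∈ Icc 1 (M:ℤ), F z * ee ((r:ℝ) * z / M)‖ := by
  have hMr : (0:ℝ) < M := by exact_mod_cast hM
  obtain ⟨r0, hr0, hmax⟩ := exists_max_image (range M) (fun r : ℕ => ‖∑ z ∈ Icc 1 (M:ℤ), F z * ee ((r:ℝ) * z / M)‖) ⟨0, by simpa⟩
  refine ⟨r0, ?_⟩
  set E := ‖∑ z ∈ Icc 1 (M:ℤ), F z * ee ((r0:ℝ) * z / M)‖ with hE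
  have hE0 : 0 ≤ E := norm_nonneg _
  have id1 : (M:ℂ) * ∑ z ∈ Icc u v, F z = ∑ r ∈ range M, (∑ y ∈ Icc u v, ee (-((r:ℝ) * y / M))) * ∑ z ∈ Icc 1 (M:ℤ), F z * ee ((r:ℝ) * z / M) := by
    have e1 : ∀ y ∈ Icc u v, (M:ℂ) * F y = ∑ z ∈ Icc 1 (M:ℤ), F z * ∑ r ∈ range M, ee ((r:ℝ) * ((z - y : ℤ):ℝ) / M) := by
      intro y hy
      simp at hy
      rw [sum_eq_single y]
      · rw [orth1 M hM]; simp; ring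
      · intro z hz hne
        rw [orth1 M hM, if_neg, mul_zero]
        intro hd
        simp at hz
        have := Int.eq_zero_of_abs_lt_dvd hd (by rw [abs_lt]; constructor <;> omega)
        omega
      · intro hn; exfalso; apply hn; simp; omega
    rw [mul_sum, sum_congr rfl e1]
    simp only [mul_sum, sum_mul]
    rw [sum_comm]
    simp_rw [sum_comm (s := Icc u v)]
    rw [sum_comm]
    refine sum_congr rfl fun r _ => sum_congr rfl fun z _ => sum_congr rfl fun y _ => ?_
    rw [show (r:ℝ) * ((z - y : ℤ):ℝ) / M = (-((r:ℝ) * y / M)) + ((r:ℝ) * z / M) by push_cast; ring, ee_add]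
    ring
  have b1 : (M:ℝ) * ‖∑ z ∈ Icc u v, F z‖ ≤ ∑ r ∈ range M, ‖∑ y ∈ Icc u v, ee (-((r:ℝ) * y / M))‖ * E := by
    have : (M:ℝ) * ‖∑ z ∈ Icc u v, F z‖ = ‖(M:ℂ) * ∑ z ∈ Icc u v, F z‖ := by simp
    rw [this, id1]
    refine (norm_sum_le _ _).trans (sum_le_sum fun r hr => ?_)
    rw [norm_mul]
    exact mul_le_mul_of_nonneg_left (hmax r hr) (norm_nonneg _)
  have b2 : ∑ r ∈ range M, ‖∑ y ∈ Icc u v, ee (-((r:ℝ) * y / M))‖ ≤ M * (3 + 2 * Real.log M) := by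
    rw [range_eq_Ico, sum_eq_sum_Ico_succ_bot hM]
    have c1 : ‖∑ y ∈ Icc u v, ee (-(((0:ℕ):ℝ) * y / M))‖ ≤ M := by
      refine (norm_sum_le _ _).trans ?_
      simp only [norm_ee, sum_const, nsmul_eq_mul, mul_one, Int.card_Icc]
      have : (v + 1 - u).toNat ≤ M := by omega
      exact_mod_cast this
    have c2 : ∑ r ∈ Ico (0 + 1) M, ‖∑ y ∈ Icc u v, ee (-((r:ℝ) * y / M))‖ ≤ ∑ r ∈ Ico 1 M, M * ((r:ℝ)⁻¹ + ((M - r : ℕ) : ℝ)⁻¹) := by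
      refine sum_le_sum fun r hr => ?_
      simp at hr
      exact dir_bd M r (by omega) hr.2 u v
    have c3 : ∑ r ∈ Ico 1 M, ((M - r : ℕ) : ℝ)⁻¹ = ∑ r ∈ Ico 1 M, (r:ℝ)⁻¹ := by
      refine sum_bij' (fun r _ => M - r) (fun r _ => M - r) ?_ ?_ ?_ ?_ ?_ <;> intro a ha <;> simp at ha ⊢ <;> omega
    rw [← mul_sum, sum_add_distrib, c3] at c2
    have := mul_le_mul_of_nonneg_left (harm M) hMr.le
    nlinarith
  rw [← sum_mul] at b1
  have b3 := b1.trans (mul_le_mul_of_nonneg_right b2 hE0)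
  rw [mul_assoc] at b3
  exact le_of_mul_le_mul_left b3 hMr
end WW

namespace WW
open Finset

noncomputable def cs (γ b c d : ℝ) (u v : ℤ) : ℂ :=
  ∑ x ∈ Icc u v, ee (γ * (x:ℝ) ^ 3 + b * (x:ℝ) ^ 2 + c * x + d)

def WS (N : ℕ) (γ : ℝ) : Set ℝ :=
  {y | ∃ b c d : ℝ, ∃ u v : ℤ, 1 ≤ u ∧ v ≤ N ∧ y = ‖cs γ b c d u v‖}

noncomputable def Wf (N : ℕ) (γ : ℝ) : ℝ := sSup (WS N γ)

lemma cs_le (N : ℕ) (γ b c d : ℝ) (u v : ℤ) (hu : 1 ≤ u) (hv : v ≤ N) : ‖cs γ b c d u v‖ ≤ N := by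
  unfold cs
  refine (norm_sum_le _ _).trans ?_
  simp only [norm_ee, sum_const, nsmul_eq_mul, mul_one, Int.card_Icc]
  have : (v + 1 - u).toNat ≤ N := by omega
  exact_mod_cast this

lemma WS_bdd (N : ℕ) (γ : ℝ) : BddAbove (WS N γ) := by
  refine ⟨N, ?_⟩
  rintro y ⟨b, c, d, u, v, hu, hv, rfl⟩
  exact cs_le N γ b c d u v hu hv

lemma WS_ne (N : ℕ) (γ : ℝ) : (WS N γ).Nonempty := ⟨_, 0, 0, 0, 1, 0, le_rfl, by simp, rfl⟩

lemma le_Wf (N : ℕ) (γ b c d : ℝ) (u v : ℤ) (hu : 1 ≤ u) (hv : v ≤ N) : ‖cs γ b c d u v‖ ≤ Wf N γ :=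
  le_csSup (WS_bdd N γ) ⟨b, c, d, u, v, hu, hv, rfl⟩

lemma Wf_nonneg (N : ℕ) (γ : ℝ) : 0 ≤ Wf N γ :=
  (norm_nonneg _).trans (le_Wf N γ 0 0 0 1 0 le_rfl (by simp))

lemma Wf_le (N : ℕ) (γ : ℝ) : Wf N γ ≤ N := by
  apply csSup_le (WS_ne N γ)
  rintro y ⟨b, c, d, u, v, hu, hv, rfl⟩
  exact cs_le N γ b c d u v hu hv

lemma Wf_near (N : ℕ) (γ : ℝ) : ∃ b c d : ℝ, ∃ u v : ℤ, 1 ≤ u ∧ v ≤ N ∧ Wf N γ ≤ 2 * ‖cs γ b c d u v‖ := by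
  rcases (Wf_nonneg N γ).eq_or_lt with h | h
  · refine ⟨0, 0, 0, 1, 0, le_rfl, by simp, ?_⟩
    rw [← h]; positivity
  · obtain ⟨y, ⟨b, c, d, u, v, hu, hv, rfl⟩, hy⟩ := exists_lt_of_lt_csSup (WS_ne N γ) (half_lt_self h)
    exact ⟨b, c, d, u, v, hu, hv, by change _ < ‖_‖ at hy; rw [show sSup (WS N γ) = Wf N γ from rfl] at hy; linarith⟩

noncomputable def ff (M : ℕ) (τ : Fin 3 → ℝ) : ℂ := ∑ z ∈ Icc 1 (M:ℤ), ee (∑ i, τ i * ((z:ℝ) ^ ((i:ℕ) + 1)))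

lemma shiftW (N : ℕ) (hN : 1 ≤ N) (γ : ℝ) : ∃ b : ℝ, ∀ t : ℕ, 1 ≤ t → t ≤ N → ∃ τ0 : ℝ,
    Wf N γ ≤ 2 * (3 + 2 * Real.log ((2 * N : ℕ):ℝ)) * ‖ff (2 * N) ![τ0, b - 3 * γ * t, γ]‖ := by
  obtain ⟨b, c, d, u, v, hu, hv, hW⟩ := Wf_near N γ
  refine ⟨b, fun t ht1 htN => ?_⟩
  obtain ⟨r, hr⟩ := complete (2 * N) (by omega)
    (fun z => ee (γ * ((z:ℝ) - t) ^ 3 + b * ((z:ℝ) - t) ^ 2 + c * ((z:ℝ) - t) + d)) (u + t) (v + t) (by omega) (by push_cast; omega)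
  refine ⟨c - 2 * b * t + 3 * γ * t ^ 2 + r / ((2 * N : ℕ):ℝ), ?_⟩
  have e1 : cs γ b c d u v = ∑ z ∈ Icc (u + t) (v + t), ee (γ * ((z:ℝ) - t) ^ 3 + b * ((z:ℝ) - t) ^ 2 + c * ((z:ℝ) - t) + d) := by
    unfold cs
    refine sum_bij' (fun x _ => x + t) (fun z _ => z - t) ?_ ?_ ?_ ?_ ?_ <;> intro a ha <;> simp at ha ⊢
    all_goals omega
  have e2 : ∑ z ∈ Icc 1 ((2 * N : ℕ):ℤ), ee (γ * ((z:ℝ) - t) ^ 3 + b * ((z:ℝ) - t) ^ 2 + c * ((z:ℝ) - t) + d) * ee ((r:ℝ) * z / ((2 * N : ℕ):ℝ)) =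
      ee (-γ * t ^ 3 + b * t ^ 2 - c * t + d) * ff (2 * N) ![c - 2 * b * t + 3 * γ * t ^ 2 + r / ((2 * N : ℕ):ℝ), b - 3 * γ * t, γ] := by
    unfold ff
    rw [mul_sum]
    refine sum_congr rfl fun z _ => ?_
    rw [← ee_add, ← ee_add]
    congr 1
    rw [Fin.sum_univ_three]
    simp
    ring
  rw [e2, norm_mul, norm_ee, one_mul, ← e1] at hr
  linarith

lemma ff_pow (M : ℕ) (τ : Fin 3 → ℝ) : ff M τ ^ 6 =
    ∑ x ∈ Fintype.piFinset (fun _ : Fin 6 => Icc 1 (M:ℤ)), ee (∑ i, τ i * psum x i) := by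
  have h := prod_univ_sum (fun _ : Fin 6 => Icc 1 (M:ℤ)) (fun _ z => ee (∑ i : Fin 3, τ i * ((z:ℝ) ^ ((i:ℕ) + 1))))
  unfold ff
  rw [prod_const, card_univ, Fintype.card_fin] at h
  rw [h]
  refine sum_congr rfl fun x _ => ?_
  rw [← ee_sum]
  congr 1
  rw [sum_comm]
  refine sum_congr rfl fun i _ => ?_
  unfold psum
  push_cast
  rw [mul_sum]

def LL (N : ℕ) : Fin 3 → ℕ := ![13 * N, 25 * N ^ 2, 49 * N ^ 3]

lemma LL_pos (N : ℕ) (hN : 1 ≤ N) (i : Fin 3) : 0 < LL N i := by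
  fin_cases i <;> simp [LL] <;> first | omega | positivity

lemma psum_rng (N : ℕ) (hN : 1 ≤ N) (x : Fin 6 → ℤ) (hx : x ∈ Fintype.piFinset (fun _ : Fin 6 => Icc 1 ((2 * N : ℕ):ℤ))) (i : Fin 3) :
    0 ≤ psum x i ∧ psum x i ≤ LL N i - 1 := by
  simp only [Fintype.mem_piFinset, mem_Icc] at hx
  have h1 : psum x i ≤ ∑ l : Fin 6, ((2 * N : ℕ):ℤ) ^ ((i:ℕ) + 1) := by
    unfold psum
    refine sum_le_sum fun l _ => pow_le_pow_left₀ ?_ (hx l).2 _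
    have := (hx l).1; omega
  constructor
  · unfold psum
    refine sum_nonneg fun l _ => pow_nonneg ?_ _
    have := (hx l).1; omega
  · refine h1.trans ?_
    have hN' : (1:ℤ) ≤ N := by exact_mod_cast hN
    have q2 : (1:ℤ) ≤ (N:ℤ) ^ 2 := one_le_pow₀ hN'
    have q3 : (1:ℤ) ≤ (N:ℤ) ^ 3 := one_le_pow₀ hN'
    fin_cases i <;> simp [LL] <;> ring_nf <;> omega

noncomputable def MM (N : ℕ) (γ : ℝ) : ℕ := by
  classical exact ((Icc 1 N).filter (fun d : ℕ => ∃ z : ℤ, |3 * γ * d - z| < 1 / ((25 * N ^ 2 : ℕ):ℝ))).card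

/-- the spacing hypothesis -/
def Sp {ι : Type*} (N : ℕ) (Q : Finset ι) (γ : ι → ℝ) (ρ : ℝ) : Prop :=
  ∀ T : Finset ι, T ⊆ Q → ∀ x : ℝ, (∀ i ∈ T, ∃ z : ℤ, |γ i - x - z| ≤ 1 / ((49 * N ^ 3 : ℕ):ℝ)) → (T.card : ℝ) ≤ ρ

lemma cell_near (L : ℕ) (hL : 0 < L) (t : ℝ) : ∃ z : ℤ, 0 ≤ t - (cell L t : ℝ) / L - z ∧ t - (cell L t : ℝ) / L - z < 1 / L := by
  have hL' : (0:ℝ) < L := by exact_mod_cast hL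
  refine ⟨⌊t⌋, ?_⟩
  have h2 : (cell L t : ℝ) + Int.fract (Int.fract t * L) = Int.fract t * L := by
    unfold cell
    rw [natCast_floor_eq_intCast_floor (by have := Int.fract_nonneg t; positivity)]
    exact Int.floor_add_fract _
  have h3 : t - (cell L t : ℝ) / L - ⌊t⌋ = Int.fract (Int.fract t * L) / L := by
    have := Int.floor_add_fract t
    rw [eq_div_iff hL'.ne', sub_mul, sub_mul, div_mul_cancel₀ _ hL'.ne']
    have h5 : Int.fract t * L = (t - ⌊t⌋) * L := by rw [Int.fract]
    linarith
  rw [h3]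
  exact ⟨div_nonneg (Int.fract_nonneg _) hL'.le, by gcongr; exact Int.fract_lt_one _⟩

lemma fibre_le (N : ℕ) (hN : 1 ≤ N) (γ b : ℝ) (j : ℕ) :
    ((Icc 1 N).filter (fun t : ℕ => cell (25 * N ^ 2) (b - 3 * γ * t) = j)).card ≤ 1 + MM N γ := by
  classical
  set T := (Icc 1 N).filter (fun t : ℕ => cell (25 * N ^ 2) (b - 3 * γ * t) = j) with hT
  by_cases hne : T.Nonempty
  · set t0 := T.min' hne with ht0
    have ht0m : t0 ∈ T := min'_mem _ _
    have h1 : (T.erase t0).card ≤ MM N γ := by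
      unfold MM
      apply card_le_card_of_injOn (fun t => t - t0)
      · intro t ht
        simp only [coe_erase, Set.mem_diff, mem_coe, Set.mem_singleton_iff] at ht
        have hle : t0 ≤ t := min'_le _ _ ht.1
        have hlt : t0 < t := lt_of_le_of_ne hle (Ne.symm ht.2)
        have a1 := (mem_filter.1 ht.1)
        have a2 := (mem_filter.1 ht0m)
        simp only [coe_filter, mem_Icc, Set.mem_setOf_eq]
        have b1 := mem_Icc.1 a1.1
        refine ⟨by omega, ?_⟩
        obtain ⟨z1, c1, c2⟩ := cell_near (25 * N ^ 2) (by positivity) (b - 3 * γ * t)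
        obtain ⟨z2, c3, c4⟩ := cell_near (25 * N ^ 2) (by positivity) (b - 3 * γ * t0)
        rw [a1.2] at c1 c2
        rw [a2.2] at c3 c4
        refine ⟨z2 - z1, ?_⟩
        rw [Nat.cast_sub hle, abs_lt]
        push_cast at c1 c2 c3 c4 ⊢
        constructor <;> linarith
      · intro t ht t' ht' he
        simp only [coe_erase, Set.mem_diff, mem_coe] at ht ht'
        have h1 : t0 ≤ t := min'_le _ _ ht.1
        have h2 : t0 ≤ t' := min'_le _ _ ht'.1
        simp only at he
        omega
    have := card_erase_of_mem ht0m
    omega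
  · rw [not_nonempty_iff_eq_empty.1 hne]; simp

lemma sieveW {ι : Type*} (N : ℕ) (hN : 1 ≤ N) (Q : Finset ι) (γ : ι → ℝ) (ρ : ℝ) (hρ : 0 ≤ ρ) (hS : Sp N Q γ ρ) :
    N * ∑ i ∈ Q, Wf N (γ i) ^ 12 / (1 + MM N (γ i)) ≤
      (2 * (3 + 2 * Real.log ((2 * N : ℕ):ℝ))) ^ 12 *
      (Real.exp (4 * Real.pi) ^ 3 * (ρ * ((13 * 25 * 49) * (N:ℝ) ^ 6 * JJ (2 * N)))) := by
  classical
  choose b hb using fun γ => shiftW N hN γ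
  choose! τ0 hτ using hb
  set Λ := 2 * (3 + 2 * Real.log ((2 * N : ℕ):ℝ)) with hΛ
  set τ : ι × ℕ → Fin 3 → ℝ := fun p => ![τ0 (γ p.1) p.2, b (γ p.1) - 3 * γ p.1 * p.2, γ p.1] with hτd
  set w : ι × ℕ → ℝ := fun p => 1 / (1 + (MM N (γ p.1) : ℝ)) with hw
  have hw0 : ∀ p, 0 ≤ w p := fun p => by simp only [hw]; positivity
  have ls := large_sieve (Q ×ˢ Icc 1 N) (Fintype.piFinset (fun _ : Fin 6 => Icc 1 ((2 * N : ℕ):ℤ))) w (fun p _ => hw0 p)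
    (LL N) (LL_pos N hN) psum (fun s hs i => psum_rng N hN s hs i) τ ρ hρ ?_
  · have hL : (∏ i, (LL N i : ℝ)) = (13 * 25 * 49) * (N:ℝ) ^ 6 := by
      rw [Fin.prod_univ_three]; simp [LL]; ring
    have hJ : ((((Fintype.piFinset (fun _ : Fin 6 => Icc 1 ((2 * N : ℕ):ℤ))) ×ˢ (Fintype.piFinset (fun _ : Fin 6 => Icc 1 ((2 * N : ℕ):ℤ)))).filter (fun z => psum z.1 = psum z.2)).card : ℝ) = JJ (2 * N) := by
      unfold JJ V0 cnt
      congr!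
    rw [hL, hJ] at ls
    refine le_trans ?_ (mul_le_mul_of_nonneg_left ls (by positivity))
    rw [sum_product, mul_sum, mul_sum]
    refine sum_le_sum fun i hi => ?_
    have : (N:ℝ) * (Wf N (γ i) ^ 12 / (1 + MM N (γ i))) = ∑ t ∈ Icc 1 N, Wf N (γ i) ^ 12 / (1 + MM N (γ i)) := by
      rw [sum_const, Nat.card_Icc, nsmul_eq_mul]; simp
    rw [this, mul_sum]
    refine sum_le_sum fun t ht => ?_
    have ht' := mem_Icc.1 ht
    rw [← ff_pow, norm_pow, ← pow_mul]
    simp only [hw]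
    have h1 := pow_le_pow_left₀ (Wf_nonneg N (γ i)) (hτ (γ i) t ht'.1 ht'.2) 12
    rw [mul_pow] at h1
    rw [div_eq_mul_one_div]
    calc _ ≤ (Λ ^ 12 * ‖ff (2 * N) (τ (i, t))‖ ^ 12) * (1 / (1 + (MM N (γ i) : ℝ))) := by
          gcongr
      _ = _ := by ring
  · intro j
    set P := (Q ×ˢ Icc 1 N).filter (fun p => ∀ i, cell (LL N i) (τ p i) = j i) with hP
    set T := Q.filter (fun i => cell (49 * N ^ 3) (γ i) = j 2) with hT
    have hsub : P ⊆ (T ×ˢ Icc 1 N).filter (fun p => cell (25 * N ^ 2) (b (γ p.1) - 3 * γ p.1 * p.2) = j 1) := by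
      intro p hp
      simp only [hP, mem_filter, mem_product] at hp
      have a1 := hp.2 1
      have a2 := hp.2 2
      simp [LL, hτd] at a1 a2
      simp only [mem_filter, mem_product, hT]
      exact ⟨⟨⟨hp.1.1, a2⟩, hp.1.2⟩, a1⟩
    refine (sum_le_sum_of_subset_of_nonneg hsub (fun p _ _ => hw0 p)).trans ?_
    rw [sum_filter, sum_product]
    have hT1 : (T.card : ℝ) ≤ ρ := by
      refine hS T (filter_subset _ _) ((j 2 : ℝ) / ((49 * N ^ 3 : ℕ):ℝ)) fun i hi => ?_
      have hc := (mem_filter.1 hi).2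
      obtain ⟨z, c1, c2⟩ := cell_near (49 * N ^ 3) (by positivity) (γ i)
      rw [hc] at c1 c2
      exact ⟨z, by rw [abs_of_nonneg c1]; exact c2.le⟩
    calc _ ≤ ∑ i ∈ T, (1:ℝ) := by
          refine sum_le_sum fun i hi => ?_
          rw [← sum_filter]
          simp only [hw]
          rw [sum_const, nsmul_eq_mul, mul_one_div, div_le_one (by positivity)]
          exact_mod_cast fibre_le N hN (γ i) (b (γ i)) (j 1)
      _ = T.card := by simp
      _ ≤ ρ := hT1
end WW

namespace WW
open Finset

lemma cover_count {ι : Type*} (N : ℕ) (hN : 1 ≤ N) (Q : Finset ι) (γ : ι → ℝ) (ρ : ℝ) (hS : Sp N Q γ ρ)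
    (T : Finset ι) (hT : T ⊆ Q) (y R : ℝ) (hR : 0 ≤ R) (h : ∀ i ∈ T, ∃ z : ℤ, |γ i - y - z| ≤ R) :
    (T.card : ℝ) ≤ (R * ((49 * N ^ 3 : ℕ):ℝ) + 1) * ρ := by
  classical
  have hρ : 0 ≤ ρ := by simpa using hS ∅ (empty_subset _) 0 (by simp)
  set L : ℝ := ((49 * N ^ 3 : ℕ):ℝ) with hL
  have hL0 : 0 < L := by rw [hL]; positivity
  choose! z hz using h
  set jf : ι → ℕ := fun i => ⌊(γ i - y - z i + R) * L / 2⌋₊ with hjf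
  have hs0 : ∀ i ∈ T, 0 ≤ (γ i - y - z i + R) * L / 2 := fun i hi => by
    have := (abs_le.1 (hz i hi)).1
    have : 0 ≤ γ i - y - z i + R := by linarith
    positivity
  have hmap : ∀ i ∈ T, jf i ∈ range (⌊R * L⌋₊ + 1) := fun i hi => by
    rw [mem_range, Nat.lt_succ_iff]
    apply Nat.floor_le_floor
    have := (abs_le.1 (hz i hi)).2
    nlinarith
  rw [card_eq_sum_card_fiberwise hmap]
  push_cast
  have : ∀ j ∈ range (⌊R * L⌋₊ + 1), ((T.filter (fun i => jf i = j)).card : ℝ) ≤ ρ := by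
    intro j _
    refine hS _ ((filter_subset _ _).trans hT) (y - R + (2 * j + 1) / L) fun i hi => ⟨z i, ?_⟩
    obtain ⟨hi1, hi2⟩ := mem_filter.1 hi
    have f1 := Nat.floor_le (hs0 i hi1)
    have f2 := Nat.lt_floor_add_one ((γ i - y - z i + R) * L / 2)
    change jf i = j at hi2
    simp only [hjf] at hi2
    rw [hi2] at f1 f2
    rw [← hL, abs_le]
    have e : γ i - (y - R + (2 * j + 1) / L) - z i = ((γ i - y - z i + R) * L - (2 * j + 1)) / L := by
      field_simp; ring
    rw [e]
    constructor
    · rw [← neg_div]; gcongr; linarith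
    · gcongr; linarith
  refine (sum_le_sum this).trans ?_
  rw [sum_const, card_range, nsmul_eq_mul]
  push_cast
  gcongr
  exact Nat.floor_le (by positivity)

def Ec (N : ℕ) (γ : ℝ) (d : ℕ) : Prop := ∃ z : ℤ, |3 * γ * d - z| < 1 / ((25 * N ^ 2 : ℕ):ℝ)

lemma pair_arith (N : ℕ) (hN : 1 ≤ N) (γ : ℝ) (d d' : ℕ) (h1 : 1 ≤ d') (h2 : d' ≤ d) (h3 : d ≤ N)
    (e1 : Ec N γ d) (e2 : Ec N γ d') : ∃ c : ℤ, |3 * γ * (Nat.gcd d d') - c| ≤ (Nat.gcd d d') / (d * ((25 * N ^ 2 : ℕ):ℝ)) := by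
  obtain ⟨m, hm⟩ := e1
  obtain ⟨m', hm'⟩ := e2
  set L : ℝ := ((25 * N ^ 2 : ℕ):ℝ) with hL
  have hN' : (1:ℝ) ≤ N := by exact_mod_cast hN
  have hL0 : 0 < L := by rw [hL]; positivity
  have hd : (0:ℝ) < d := by exact_mod_cast (by omega : 0 < d)
  have hd' : (0:ℝ) < d' := by exact_mod_cast (by omega : 0 < d')
  have hdN : (d:ℝ) ≤ N := by exact_mod_cast h3
  have hdN' : (d':ℝ) ≤ N := by exact_mod_cast h2.trans h3
  have hLN : 2 * N / L < 1 := by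
    rw [div_lt_one hL0, hL]; push_cast; nlinarith
  have hz : m * d' - m' * d = 0 := by
    rw [← Int.abs_lt_one_iff]
    have : |((m * d' - m' * d : ℤ):ℝ)| < 1 := by
      have e : ((m * d' - m' * d : ℤ):ℝ) = (3 * γ * d' - m') * d - (3 * γ * d - m) * d' := by push_cast; ring
      rw [e]
      calc _ ≤ |3 * γ * d' - m'| * d + |3 * γ * d - m| * d' := by
            refine (abs_sub _ _).trans (le_of_eq ?_)
            rw [abs_mul, abs_mul, abs_of_pos hd, abs_of_pos hd']
        _ ≤ (1 / L) * N + (1 / L) * N := by gcongr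
        _ = 2 * N / L := by ring
        _ < 1 := hLN
    exact_mod_cast this
  set g := Nat.gcd d d' with hg
  have hg0 : 0 < g := Nat.gcd_pos_of_pos_left _ (by omega)
  obtain ⟨d1, hd1⟩ := Nat.gcd_dvd_left d d'
  obtain ⟨d2, hd2⟩ := Nat.gcd_dvd_right d d'
  rw [← hg] at hd1 hd2
  have hcop : Nat.Coprime d1 d2 := by
    have := Nat.coprime_div_gcd_div_gcd (m := d) (n := d') hg0
    rw [← hg] at this
    rw [hd1, hd2, Nat.mul_div_cancel_left _ hg0, Nat.mul_div_cancel_left _ hg0] at this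
    exact this
  have hmd : (d1 : ℤ) ∣ m := by
    have : m * d2 = m' * d1 := by
      have hgz : (g:ℤ) ≠ 0 := by exact_mod_cast hg0.ne'
      apply mul_left_cancel₀ hgz
      have c1 : (d:ℤ) = g * d1 := by exact_mod_cast hd1
      have c2 : (d':ℤ) = g * d2 := by exact_mod_cast hd2
      rw [c1, c2] at hz
      linarith
    have h5 : (d1:ℤ) ∣ m * d2 := ⟨m', by rw [this]; ring⟩
    exact (Nat.isCoprime_iff_coprime.2 hcop).dvd_of_dvd_mul_right h5
  obtain ⟨c, hc⟩ := hmd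
  refine ⟨c, ?_⟩
  have hd1r : (d:ℝ) = g * d1 := by exact_mod_cast hd1
  have hgr : (0:ℝ) < g := by exact_mod_cast hg0
  have hd10 : (0:ℝ) < d1 := by
    rw [hd1r] at hd; exact pos_of_mul_pos_right hd hgr.le
  rw [hd1r, hc] at hm
  push_cast at hm
  rw [hd1r, show (g:ℝ) / (g * d1 * L) = (1 / L) / d1 by field_simp, le_div_iff₀ hd10]
  have : |3 * γ * g - c| * d1 = |3 * γ * (g * d1) - d1 * c| := by
    rw [show 3 * γ * (g * d1) - d1 * c = (3 * γ * g - c) * d1 by ring, abs_mul, abs_of_pos hd10]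
  rw [this]; exact hm.le

lemma pair_count {ι : Type*} (N : ℕ) (hN : 1 ≤ N) (Q : Finset ι) (γ : ι → ℝ) (ρ : ℝ) (hS : Sp N Q γ ρ)
    (T : Finset ι) (hT : T ⊆ Q) (d d' : ℕ) (h1 : 1 ≤ d') (h2 : d' ≤ d) (h3 : d ≤ N)
    (h : ∀ i ∈ T, Ec N (γ i) d ∧ Ec N (γ i) d') :
    (T.card : ℝ) ≤ 6 * (Nat.gcd d d') * N * ρ / d := by
  classical
  have hρ : 0 ≤ ρ := by simpa using hS ∅ (empty_subset _) 0 (by simp)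
  set g := Nat.gcd d d' with hg
  have hg0 : 0 < g := Nat.gcd_pos_of_pos_left _ (by omega)
  have hgr : (0:ℝ) < g := by exact_mod_cast hg0
  have hd : (0:ℝ) < d := by exact_mod_cast (by omega : 0 < d)
  have hdN : (d:ℝ) ≤ N := by exact_mod_cast h3
  have hN' : (1:ℝ) ≤ N := by exact_mod_cast hN
  have : ∀ i ∈ T, ∃ c : ℤ, |3 * γ i * g - c| ≤ g / (d * ((25 * N ^ 2 : ℕ):ℝ)) := fun i hi =>
    pair_arith N hN (γ i) d d' h1 h2 h3 (h i hi).1 (h i hi).2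
  choose! c hc using this
  set cf : ι → ℕ := fun i => (c i % (3 * g : ℕ)).toNat with hcf
  have h3g : ((3 * g : ℕ) : ℤ) ≠ 0 := by positivity
  have hmap : ∀ i ∈ T, cf i ∈ range (3 * g) := fun i _ => by
    have a1 := Int.emod_nonneg (c i) h3g
    have a2 := Int.emod_lt_of_pos (c i) (by positivity : (0:ℤ) < ((3 * g : ℕ) : ℤ))
    simp only [hcf, mem_range]; omega
  rw [card_eq_sum_card_fiberwise hmap]
  push_cast
  have hb : ∀ j ∈ range (3 * g), ((T.filter (fun i => cf i = j)).card : ℝ) ≤ 2 * N * ρ / d := by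
    intro j _
    have := cover_count N hN Q γ ρ hS (T.filter (fun i => cf i = j)) ((filter_subset _ _).trans hT) (j / (3 * g))
      (1 / (3 * d * ((25 * N ^ 2 : ℕ):ℝ))) (by positivity) (fun i hi => by
        obtain ⟨hi1, hi2⟩ := mem_filter.1 hi
        refine ⟨c i / ((3 * g : ℕ):ℤ), ?_⟩
        have hh := hc i hi1
        have e1 : (c i : ℝ) = (3 * g) * ((c i / ((3 * g : ℕ):ℤ) : ℤ):ℝ) + j := by
          have a0 := Int.mul_ediv_add_emod (c i) ((3 * g : ℕ):ℤ)
          have a1 := Int.emod_nonneg (c i) h3g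
          have a3 : (j:ℤ) = c i % ((3 * g : ℕ):ℤ) := by simp only [hcf] at hi2; omega
          rw [← a3] at a0
          have : (((3 * g : ℕ):ℤ) * (c i / ((3 * g : ℕ):ℤ)) + j : ℤ) = ((c i : ℤ) : ℝ) := by exact_mod_cast a0
          rw [← this]; push_cast; ring
        rw [e1] at hh
        have e2 : 3 * γ i * g - ((3 * g) * ((c i / ((3 * g : ℕ):ℤ) : ℤ):ℝ) + j) = (γ i - j / (3 * g) - ((c i / ((3 * g : ℕ):ℤ) : ℤ):ℝ)) * (3 * g) := by
          field_simp; ring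
        rw [e2, abs_mul, abs_of_pos (by positivity : (0:ℝ) < 3 * g), ← le_div_iff₀ (by positivity)] at hh
        refine hh.trans (le_of_eq ?_)
        field_simp)
    refine this.trans ?_
    have e3 : 1 / (3 * (d:ℝ) * ((25 * N ^ 2 : ℕ):ℝ)) * ((49 * N ^ 3 : ℕ):ℝ) = 49 / 75 * (N / d) := by
      push_cast; field_simp; norm_num
    rw [e3]
    have e4 : 1 ≤ (N:ℝ) / d := by rwa [le_div_iff₀ hd, one_mul]
    calc _ ≤ (2 * (N / d)) * ρ := by gcongr; linarith
      _ = _ := by ring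
  refine (sum_le_sum hb).trans (le_of_eq ?_)
  rw [sum_const, card_range, nsmul_eq_mul]
  push_cast; ring

lemma gcd_sum (d : ℕ) : ∑ d' ∈ Icc 1 d, Nat.gcd d d' ≤ d * d.divisors.card := by
  rcases Nat.eq_zero_or_pos d with rfl | hd
  · simp
  have hmap : ∀ d' ∈ Icc 1 d, Nat.gcd d d' ∈ d.divisors := fun d' _ => by
    simp [Nat.gcd_dvd_left]; omega
  rw [← sum_fiberwise_of_maps_to hmap]
  calc _ ≤ ∑ g ∈ d.divisors, d := by
        refine sum_le_sum fun g hg => ?_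
        rw [sum_congr rfl (fun x hx => (mem_filter.1 hx).2), sum_const, smul_eq_mul]
        have h1 : ((Icc 1 d).filter (fun x => Nat.gcd d x = g)).card ≤ d / g := by
          rw [← Nat.Ioc_filter_dvd_card_eq_div]
          apply card_le_card
          intro x hx
          simp at hx ⊢
          exact ⟨by omega, hx.2 ▸ Nat.gcd_dvd_right _ _⟩
        calc _ ≤ d / g * g := Nat.mul_le_mul_right _ h1
          _ ≤ d := Nat.div_mul_le_self d g
    _ = _ := by rw [sum_const, smul_eq_mul, mul_comm]

lemma sumMM {ι : Type*} (N : ℕ) (hN : 1 ≤ N) (Q : Finset ι) (γ : ι → ℝ) (ρ : ℝ) (hS : Sp N Q γ ρ) (D : ℝ)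
    (hD : ∀ d ∈ Icc 1 N, ((d.divisors.card : ℕ):ℝ) ≤ D) :
    ∑ i ∈ Q, (MM N (γ i) : ℝ) ^ 2 ≤ 12 * N ^ 2 * ρ * D := by
  classical
  have hρ : 0 ≤ ρ := by simpa using hS ∅ (empty_subset _) 0 (by simp)
  have e1 : ∀ i, (MM N (γ i) : ℝ) ^ 2 = ∑ d ∈ Icc 1 N, ∑ d' ∈ Icc 1 N, if (Ec N (γ i) d ∧ Ec N (γ i) d') then (1:ℝ) else 0 := by
    intro i
    have : (MM N (γ i) : ℝ) = ∑ d ∈ Icc 1 N, if Ec N (γ i) d then (1:ℝ) else 0 := by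
      unfold MM
      rw [card_filter]
      push_cast
      refine sum_congr rfl fun d _ => ?_
      unfold Ec
      push_cast
      rfl
    rw [this, sq, sum_mul_sum]
    refine sum_congr rfl fun d _ => sum_congr rfl fun d' _ => ?_
    by_cases h1 : Ec N (γ i) d <;> by_cases h2 : Ec N (γ i) d' <;> simp [h1, h2]
  simp only [e1]
  rw [sum_comm]
  have e2 : ∀ d ∈ Icc 1 N, ∑ i ∈ Q, ∑ d' ∈ Icc 1 N, (if (Ec N (γ i) d ∧ Ec N (γ i) d') then (1:ℝ) else 0) =
      ∑ d' ∈ Icc 1 N, ((Q.filter (fun i => Ec N (γ i) d ∧ Ec N (γ i) d')).card : ℝ) := by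
    intro d _
    rw [sum_comm]
    refine sum_congr rfl fun d' _ => ?_
    rw [card_filter]; push_cast; rfl
  rw [sum_congr rfl e2]
  set H : ℕ → ℕ → ℝ := fun d d' => if d' ≤ d then 6 * (Nat.gcd d d') * N * ρ / d else 0 with hH
  have hH0 : ∀ d d', 0 ≤ H d d' := fun d d' => by simp only [hH]; split_ifs <;> positivity
  have e3 : ∀ d ∈ Icc 1 N, ∀ d' ∈ Icc 1 N, ((Q.filter (fun i => Ec N (γ i) d ∧ Ec N (γ i) d')).card : ℝ) ≤ H d d' + H d' d := by
    intro d hd d' hd'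
    simp only [mem_Icc] at hd hd'
    rcases le_total d' d with h | h
    · have := pair_count N hN Q γ ρ hS (Q.filter (fun i => Ec N (γ i) d ∧ Ec N (γ i) d')) (filter_subset _ _) d d' hd'.1 h hd.2
        (fun i hi => (mem_filter.1 hi).2)
      have h2 : H d d' = 6 * (Nat.gcd d d') * N * ρ / d := by simp only [hH, if_pos h]
      have := hH0 d' d
      linarith
    · have := pair_count N hN Q γ ρ hS (Q.filter (fun i => Ec N (γ i) d ∧ Ec N (γ i) d')) (filter_subset _ _) d' d hd.1 h hd'.2
        (fun i hi => (mem_filter.1 hi).2.symm)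
      have h2 : H d' d = 6 * (Nat.gcd d' d) * N * ρ / d' := by simp only [hH, if_pos h]
      have := hH0 d d'
      linarith
  have e4 : ∑ d ∈ Icc 1 N, ∑ d' ∈ Icc 1 N, H d d' ≤ 6 * N ^ 2 * ρ * D := by
    calc _ ≤ ∑ d ∈ Icc 1 N, 6 * N * ρ * D := by
          refine sum_le_sum fun d hd => ?_
          have hd1 := mem_Icc.1 hd
          have hd0 : (0:ℝ) < d := by exact_mod_cast (by omega : 0 < d)
          simp only [hH]
          rw [← sum_filter]
          have hs : (Icc 1 N).filter (fun d' => d' ≤ d) = Icc 1 d := by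
            ext x; simp; omega
          rw [hs]
          have e5 : ∑ d' ∈ Icc 1 d, 6 * (Nat.gcd d d' : ℝ) * N * ρ / d = 6 * N * ρ / d * ((∑ d' ∈ Icc 1 d, Nat.gcd d d' : ℕ):ℝ) := by
            push_cast
            rw [mul_sum]
            exact sum_congr rfl fun _ _ => by ring
          rw [e5]
          have e6 : ((∑ d' ∈ Icc 1 d, Nat.gcd d d' : ℕ):ℝ) ≤ d * D := by
            have : ((∑ d' ∈ Icc 1 d, Nat.gcd d d' : ℕ):ℝ) ≤ d * (d.divisors.card : ℝ) := by exact_mod_cast gcd_sum d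
            exact this.trans (by gcongr; exact hD d hd)
          calc _ ≤ 6 * N * ρ / d * (d * D) := by gcongr
            _ = _ := by field_simp
      _ = _ := by rw [sum_const, Nat.card_Icc, nsmul_eq_mul]; simp; ring
  calc _ ≤ ∑ d ∈ Icc 1 N, ∑ d' ∈ Icc 1 N, (H d d' + H d' d) :=
        sum_le_sum fun d hd => sum_le_sum fun d' hd' => e3 d hd d' hd'
    _ = ∑ d ∈ Icc 1 N, ∑ d' ∈ Icc 1 N, H d d' + ∑ d ∈ Icc 1 N, ∑ d' ∈ Icc 1 N, H d d' := by
        simp only [sum_add_distrib]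
        congr 1
        rw [sum_comm]
    _ ≤ _ := by linarith
end WW

namespace WW
open Finset

lemma holder_one {ι : Type*} (s : Finset ι) (f : ι → ℝ) (hf : ∀ i ∈ s, 0 ≤ f i) (n : ℕ) (hn : 2 ≤ n) :
    ∑ i ∈ s, f i ≤ (∑ i ∈ s, f i ^ n) ^ (1 / (n:ℝ)) * (s.card : ℝ) ^ (1 - 1 / (n:ℝ)) := by
  have hn' : (2:ℝ) ≤ n := by exact_mod_cast hn
  have h := holder s (fun i => f i ^ n) (fun _ => 1) (fun i hi => pow_nonneg (hf i hi) n) (fun _ _ => zero_le_one)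
    (1 / (n:ℝ)) (by positivity) (by rw [div_lt_one (by positivity)]; linarith)
  simp only [Real.one_rpow, mul_one, sum_const, nsmul_eq_mul] at h
  refine le_trans (le_of_eq ?_) h
  refine sum_congr rfl fun i hi => ?_
  rw [← Real.rpow_natCast, ← Real.rpow_mul (hf i hi), mul_one_div_cancel (by positivity), Real.rpow_one]

lemma Lam_bound (η : ℝ) (hη : 0 < η) : ∃ C : ℝ, 0 < C ∧ ∀ N : ℕ, 1 ≤ N →
    2 * (3 + 2 * Real.log ((2 * N : ℕ):ℝ)) ≤ C * (N:ℝ) ^ η := by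
  have hl2 : 0 < Real.log 2 := Real.log_pos (by norm_num)
  refine ⟨6 + 4 * Real.log 2 + 4 / η, by positivity, fun N hN => ?_⟩
  have hN' : (1:ℝ) ≤ N := by exact_mod_cast hN
  have h1 : 1 ≤ (N:ℝ) ^ η := Real.one_le_rpow hN' hη.le
  have h2 := Real.log_le_rpow_div (x := (N:ℝ)) (by positivity) hη
  push_cast
  rw [Real.log_mul (by norm_num) (by positivity)]
  have : (N:ℝ) ^ η / η = 1 / η * (N:ℝ) ^ η := by ring
  have h3 : (6 + 4 * Real.log 2) * 1 ≤ (6 + 4 * Real.log 2) * (N:ℝ) ^ η := by gcongr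
  have h4 : 4 / η * (N:ℝ) ^ η = 4 * (1 / η * (N:ℝ) ^ η) := by ring
  nlinarith

lemma two_bounds (ε : ℝ) (hε : 0 < ε) : ∃ K : ℝ, 1 ≤ K ∧ ∀ N : ℕ, 1 ≤ N → ∀ (Q : Finset ℤ) (γ : ℤ → ℝ) (ρ : ℝ),
    0 ≤ ρ → Sp N Q γ ρ →
    (∑ i ∈ Q, Wf N (γ i) ^ 12 / (1 + MM N (γ i)) ≤ K * (N:ℝ) ^ ε * ρ * (N:ℝ) ^ 11) ∧
    (∑ i ∈ Q, (MM N (γ i) : ℝ) ^ 2 ≤ K * (N:ℝ) ^ ε * ρ * (N:ℝ) ^ 2) := by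
  obtain ⟨C1, h1, hC1⟩ := Lam_bound (ε / 13) (by positivity)
  obtain ⟨C2, h2, hC2⟩ := JJ_bound (ε / 13) (by positivity)
  obtain ⟨C3, h3, hC3⟩ := div_bound ε hε
  set K1 := C1 ^ 12 * (Real.exp (4 * Real.pi) ^ 3 * ((13 * 25 * 49) * (C2 * 2 ^ (6 + ε / 13)))) with hK1
  refine ⟨max K1 (12 * C3), le_trans (by linarith) (le_max_right _ _), fun N hN Q γ ρ hρ hS => ⟨?_, ?_⟩⟩
  · have hN0 : (0:ℝ) < N := by exact_mod_cast hN
    have s := sieveW N hN Q γ ρ hρ hS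
    have hJ : (JJ (2 * N) : ℝ) ≤ C2 * 2 ^ (6 + ε / 13) * ((N:ℝ) ^ 6 * (N:ℝ) ^ (ε / 13)) := by
      refine (hC2 (2 * N) (by omega)).trans (le_of_eq ?_)
      push_cast
      rw [Real.mul_rpow (by norm_num) hN0.le, Real.rpow_add hN0, show (6:ℝ) = ((6:ℕ):ℝ) by norm_num, Real.rpow_natCast]
      ring
    have hΛ0 : 0 ≤ 2 * (3 + 2 * Real.log ((2 * N : ℕ):ℝ)) := by
      have := Real.log_natCast_nonneg (2 * N); positivity
    have hΛ := pow_le_pow_left₀ hΛ0 (hC1 N hN) 12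
    have key : N * ∑ i ∈ Q, Wf N (γ i) ^ 12 / (1 + MM N (γ i)) ≤ N * (K1 * (N:ℝ) ^ ε * ρ * (N:ℝ) ^ 11) := by
      refine s.trans ?_
      calc _ ≤ (C1 * (N:ℝ) ^ (ε / 13)) ^ 12 * (Real.exp (4 * Real.pi) ^ 3 * (ρ * ((13 * 25 * 49) * (N:ℝ) ^ 6 * (C2 * 2 ^ (6 + ε / 13) * ((N:ℝ) ^ 6 * (N:ℝ) ^ (ε / 13)))))) := by gcongr
        _ = N * (K1 * ((N:ℝ) ^ (ε / 13)) ^ 13 * ρ * (N:ℝ) ^ 11) := by rw [hK1]; ring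
        _ = _ := by
          rw [← Real.rpow_natCast ((N:ℝ) ^ (ε / 13)), ← Real.rpow_mul hN0.le]
          norm_num
    have := le_of_mul_le_mul_left key hN0
    refine this.trans ?_
    gcongr
    exact le_max_left _ _
  · have hN0 : (0:ℝ) < N := by exact_mod_cast hN
    have s := sumMM N hN Q γ ρ hS (C3 * (N:ℝ) ^ ε) (fun d hd => by
      have hd := mem_Icc.1 hd
      refine (hC3 d (by omega)).trans ?_
      gcongr
      exact_mod_cast hd.2)
    refine s.trans ?_
    calc _ = (12 * C3) * (N:ℝ) ^ ε * ρ * (N:ℝ) ^ 2 := by ring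
      _ ≤ _ := by gcongr; exact le_max_right _ _

lemma rp_le_self {y θ : ℝ} (hy : 1 ≤ y) (hθ : θ ≤ 1) : y ^ θ ≤ y := by
  calc y ^ θ ≤ y ^ (1:ℝ) := Real.rpow_le_rpow_of_exponent_le hy hθ
    _ = y := Real.rpow_one y

theorem meanW (ε : ℝ) (hε : 0 < ε) : ∃ C : ℝ, 0 < C ∧ ∀ N : ℕ, 1 ≤ N → ∀ (Q : Finset ℤ) (γ : ℤ → ℝ) (ρ : ℝ),
    0 ≤ ρ → Sp N Q γ ρ →
    ∑ i ∈ Q, Wf N (γ i) ≤ C * (N:ℝ) ^ ε * ((Q.card:ℝ) ^ (7/8:ℝ) * ρ ^ (1/8:ℝ) * N +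
      (Q.card:ℝ) ^ (11/12:ℝ) * ρ ^ (1/12:ℝ) * (N:ℝ) ^ (11/12:ℝ)) := by
  classical
  obtain ⟨K, hK, hb⟩ := two_bounds ε hε
  refine ⟨4 * K, by linarith, fun N hN Q γ ρ hρ hS => ?_⟩
  obtain ⟨b1, b2⟩ := hb N hN Q γ ρ hρ hS
  have hN1 : (1:ℝ) ≤ N := by exact_mod_cast hN
  have hN0 : (0:ℝ) < N := by linarith
  set E := (N:ℝ) ^ ε with hE
  have hE1 : 1 ≤ E := Real.one_le_rpow hN1 hε.le
  have hKE : 1 ≤ K * E := by nlinarith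
  have hKE0 : 0 ≤ K * E := by linarith
  rw [← sum_filter_add_sum_filter_not Q (fun i => MM N (γ i) = 0)]
  set Q0 := Q.filter (fun i => MM N (γ i) = 0) with hQ0
  set Q1 := Q.filter (fun i => ¬ MM N (γ i) = 0) with hQ1
  have hW := fun i => Wf_nonneg N (γ i)
  -- minor
  have m1 : ∑ i ∈ Q0, Wf N (γ i) ^ 12 ≤ K * E * ρ * (N:ℝ) ^ 11 := by
    refine le_trans ?_ b1
    calc _ = ∑ i ∈ Q0, Wf N (γ i) ^ 12 / (1 + MM N (γ i)) := by
          refine sum_congr rfl fun i hi => ?_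
          rw [(mem_filter.1 hi).2]; simp
      _ ≤ _ := sum_le_sum_of_subset_of_nonneg (filter_subset _ _) (fun i _ _ => by have := hW i; positivity)
  have m2 : ∑ i ∈ Q0, Wf N (γ i) ≤ (K * E) * ((Q.card:ℝ) ^ (11/12:ℝ) * ρ ^ (1/12:ℝ) * (N:ℝ) ^ (11/12:ℝ)) := by
    refine (holder_one Q0 (fun i => Wf N (γ i)) (fun i _ => hW i) 12 (by norm_num)).trans ?_
    have c1 : (∑ i ∈ Q0, Wf N (γ i) ^ 12) ^ (1 / ((12:ℕ):ℝ)) ≤ (K * E) * (ρ ^ (1/12:ℝ) * (N:ℝ) ^ (11/12:ℝ)) := by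
      calc _ ≤ (K * E * ρ * (N:ℝ) ^ 11) ^ (1 / ((12:ℕ):ℝ)) :=
            Real.rpow_le_rpow (sum_nonneg fun i _ => by have := hW i; positivity) m1 (by positivity)
        _ = (K * E) ^ (1 / 12:ℝ) * (ρ ^ (1/12:ℝ) * (N:ℝ) ^ (11/12:ℝ)) := by
            rw [Real.mul_rpow (by positivity) (by positivity), Real.mul_rpow hKE0 hρ, ← Real.rpow_natCast, ← Real.rpow_mul hN0.le]
            push_cast
            norm_num
            ring
        _ ≤ _ := by gcongr; exact rp_le_self hKE (by norm_num)
    have c2 : (Q0.card:ℝ) ^ (1 - 1 / ((12:ℕ):ℝ)) ≤ (Q.card:ℝ) ^ (11/12:ℝ) := by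
      rw [show (1 - 1 / ((12:ℕ):ℝ)) = 11/12 by norm_num]
      gcongr
      exact filter_subset _ _
    refine (mul_le_mul c1 c2 (by positivity) (by positivity)).trans (le_of_eq (by ring))
  -- major
  have j1 : ∑ i ∈ Q1, Wf N (γ i) ^ 8 ≤ (4 * (K * E)) * (ρ * (N:ℝ) ^ 8) := by
    have h := holder Q1 (fun i => Wf N (γ i) ^ 12 / (1 + MM N (γ i))) (fun i => (1 + (MM N (γ i):ℝ)) ^ 2)
      (fun i _ => by have := hW i; positivity) (fun i _ => by positivity) (2/3) (by norm_num) (by norm_num)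
    have l1 : ∀ i ∈ Q1, Wf N (γ i) ^ 8 = (Wf N (γ i) ^ 12 / (1 + MM N (γ i))) ^ (2/3:ℝ) * ((1 + (MM N (γ i):ℝ)) ^ 2) ^ (1 - 2/3:ℝ) := by
      intro i _
      have hw := hW i
      have hm : (0:ℝ) < 1 + MM N (γ i) := by positivity
      rw [Real.div_rpow (by positivity) hm.le, ← Real.rpow_natCast (Wf N (γ i)) 12, ← Real.rpow_mul hw, ← Real.rpow_natCast (1 + (MM N (γ i):ℝ)) 2, ← Real.rpow_mul hm.le]
      rw [show (((12:ℕ):ℝ) * (2/3)) = ((8:ℕ):ℝ) by norm_num, Real.rpow_natCast, show (((2:ℕ):ℝ) * (1 - 2/3)) = 2/3 by norm_num]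
      have : (1 + (MM N (γ i):ℝ)) ^ (2/3:ℝ) ≠ 0 := (Real.rpow_pos_of_pos hm _).ne'
      field_simp
    rw [sum_congr rfl l1]
    refine h.trans ?_
    have g1 : ∑ i ∈ Q1, Wf N (γ i) ^ 12 / (1 + MM N (γ i)) ≤ K * E * ρ * (N:ℝ) ^ 11 :=
      le_trans (sum_le_sum_of_subset_of_nonneg (filter_subset _ _) (fun i _ _ => by have := hW i; positivity)) b1
    have g2 : ∑ i ∈ Q1, (1 + (MM N (γ i):ℝ)) ^ 2 ≤ 4 * (K * E * ρ * (N:ℝ) ^ 2) := by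
      calc _ ≤ ∑ i ∈ Q1, 4 * (MM N (γ i):ℝ) ^ 2 := by
            refine sum_le_sum fun i hi => ?_
            have h0 := (mem_filter.1 hi).2
            have h1 : (1:ℝ) ≤ MM N (γ i) := by exact_mod_cast Nat.one_le_iff_ne_zero.2 h0
            nlinarith
        _ = 4 * ∑ i ∈ Q1, (MM N (γ i):ℝ) ^ 2 := by rw [mul_sum]
        _ ≤ 4 * ∑ i ∈ Q, (MM N (γ i):ℝ) ^ 2 := by
            gcongr
            exact filter_subset _ _
        _ ≤ _ := by gcongr
    have hy : 0 ≤ K * E * ρ := by positivity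
    calc _ ≤ (K * E * ρ * (N:ℝ) ^ 11) ^ (2/3:ℝ) * (4 * (K * E * ρ * (N:ℝ) ^ 2)) ^ (1 - 2/3:ℝ) := by
          apply mul_le_mul
          · exact Real.rpow_le_rpow (sum_nonneg fun i _ => by have := hW i; positivity) g1 (by norm_num)
          · exact Real.rpow_le_rpow (sum_nonneg fun i _ => by positivity) g2 (by norm_num)
          · exact Real.rpow_nonneg (sum_nonneg fun i _ => by positivity) _
          · positivity
      _ = 4 ^ (1/3:ℝ) * ((K * E * ρ) ^ (2/3:ℝ) * (K * E * ρ) ^ (1/3:ℝ)) * (((N:ℝ) ^ 11) ^ (2/3:ℝ) * ((N:ℝ) ^ 2) ^ (1/3:ℝ)) := by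
          rw [show (1 - 2/3:ℝ) = 1/3 by norm_num]
          generalize K * E * ρ = y at hy
          rw [Real.mul_rpow (x := y) (y := (N:ℝ) ^ 11) hy (by positivity), Real.mul_rpow (x := 4) (by norm_num) (by positivity), Real.mul_rpow (x := y) (y := (N:ℝ) ^ 2) hy (by positivity)]
          ring
      _ = 4 ^ (1/3:ℝ) * (K * E * ρ) * (N:ℝ) ^ 8 := by
          rw [← Real.rpow_add_of_nonneg hy (by norm_num) (by norm_num), ← Real.rpow_natCast (N:ℝ) 11, ← Real.rpow_natCast (N:ℝ) 2, ← Real.rpow_mul hN0.le, ← Real.rpow_mul hN0.le, ← Real.rpow_add hN0]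
          rw [show (2/3 + 1/3 : ℝ) = 1 by norm_num, Real.rpow_one, ← Real.rpow_natCast (N:ℝ) 8]
          norm_num
      _ ≤ 4 * (K * E * ρ) * (N:ℝ) ^ 8 := by
          gcongr; exact rp_le_self (by norm_num) (by norm_num)
      _ = _ := by ring
  have j2 : ∑ i ∈ Q1, Wf N (γ i) ≤ (4 * (K * E)) * ((Q.card:ℝ) ^ (7/8:ℝ) * ρ ^ (1/8:ℝ) * N) := by
    refine (holder_one Q1 (fun i => Wf N (γ i)) (fun i _ => hW i) 8 (by norm_num)).trans ?_
    have c1 : (∑ i ∈ Q1, Wf N (γ i) ^ 8) ^ (1 / ((8:ℕ):ℝ)) ≤ (4 * (K * E)) * (ρ ^ (1/8:ℝ) * N) := by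
      calc _ ≤ ((4 * (K * E)) * (ρ * (N:ℝ) ^ 8)) ^ (1 / ((8:ℕ):ℝ)) :=
            Real.rpow_le_rpow (sum_nonneg fun i _ => by have := hW i; positivity) j1 (by positivity)
        _ = (4 * (K * E)) ^ (1 / 8:ℝ) * (ρ ^ (1/8:ℝ) * N) := by
            rw [Real.mul_rpow (by positivity) (by positivity), Real.mul_rpow hρ (by positivity), ← Real.rpow_natCast (N:ℝ), ← Real.rpow_mul hN0.le]
            push_cast
            norm_num
        _ ≤ _ := by gcongr; exact rp_le_self (by linarith) (by norm_num)
    have c2 : (Q1.card:ℝ) ^ (1 - 1 / ((8:ℕ):ℝ)) ≤ (Q.card:ℝ) ^ (7/8:ℝ) := by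
      rw [show (1 - 1 / ((8:ℕ):ℝ)) = 7/8 by norm_num]
      gcongr
      exact filter_subset _ _
    refine (mul_le_mul c1 c2 (by positivity) (by positivity)).trans (le_of_eq (by ring))
  have hx : 0 ≤ (K * E) * ((Q.card:ℝ) ^ (11/12:ℝ) * ρ ^ (1/12:ℝ) * (N:ℝ) ^ (11/12:ℝ)) := by positivity
  have : 4 * K * E * ((Q.card:ℝ) ^ (7/8:ℝ) * ρ ^ (1/8:ℝ) * N + (Q.card:ℝ) ^ (11/12:ℝ) * ρ ^ (1/12:ℝ) * (N:ℝ) ^ (11/12:ℝ)) =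
    (4 * (K * E)) * ((Q.card:ℝ) ^ (7/8:ℝ) * ρ ^ (1/8:ℝ) * N) + 4 * ((K * E) * ((Q.card:ℝ) ^ (11/12:ℝ) * ρ ^ (1/12:ℝ) * (N:ℝ) ^ (11/12:ℝ))) := by ring
  rw [this]
  linarith
end WW

namespace WW
open Finset Polynomial

lemma diff_id (f : ℤ → ℝ) (N : ℕ) (u v : ℤ) (hu : 1 ≤ u) (hv : v ≤ N) :
    ‖∑ x ∈ Icc u v, ee (f x)‖ ^ 2 ≤ ∑ h ∈ Icc (-(N:ℤ)) N,
      ‖∑ x ∈ Icc (max u (u - h)) (min v (v - h)), ee (f (x + h) - f x)‖ := by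
  have e1 : ((‖∑ x ∈ Icc u v, ee (f x)‖ ^ 2 : ℝ) : ℂ) = ∑ h ∈ Icc (-(N:ℤ)) N,
      ∑ x ∈ Icc (max u (u - h)) (min v (v - h)), ee (f (x + h) - f x) := by
    push_cast
    rw [← Complex.conj_mul', map_sum, sum_mul_sum]
    have : ∀ h ∈ Icc (-(N:ℤ)) N, ∑ x ∈ Icc (max u (u - h)) (min v (v - h)), ee (f (x + h) - f x) =
        ∑ x ∈ Icc u v, if x + h ∈ Icc u v then ee (f (x + h) - f x) else 0 := by
      intro h _
      rw [← sum_filter]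
      refine sum_congr ?_ fun _ _ => rfl
      ext x
      simp only [mem_filter, mem_Icc, max_le_iff, le_min_iff]
      constructor <;> intro h <;> omega
    rw [sum_congr rfl this]
    conv_rhs => rw [sum_comm]
    refine sum_congr rfl fun x hx => ?_
    rw [← sum_filter]
    refine sum_bij' (fun y _ => y - x) (fun h _ => x + h) ?_ ?_ ?_ ?_ ?_
    · intro y hy
      simp only [mem_filter, mem_Icc] at *
      omega
    · intro h hh
      simp only [mem_filter, mem_Icc] at *
      omega
    · intros; ring
    · intros; ring
    · intro y hy
      rw [conj_ee, ← ee_add]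
      congr 1
      rw [show x + (y - x) = y by ring]; ring
  have e2 : ‖∑ x ∈ Icc u v, ee (f x)‖ ^ 2 = ‖((‖∑ x ∈ Icc u v, ee (f x)‖ ^ 2 : ℝ) : ℂ)‖ := by
    rw [Complex.norm_real, Real.norm_of_nonneg (by positivity)]
  rw [e2, e1]
  exact norm_sum_le _ _

/-- Iterated differencing operator. -/
noncomputable def TT (N : ℕ) : ℕ → (ℤ → ℝ) → ℝ
  | 0, F => F 1
  | j + 1, F => ∑ h ∈ Icc (-(N:ℤ)) N, TT N j (fun n => F (h * n))

lemma dpoly (P : ℝ[X]) (m : ℕ) (hP : P.natDegree ≤ m + 1) (h : ℝ) :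
    (taylor h P - P).natDegree ≤ m ∧ (taylor h P - P).coeff m = (m + 1) * h * P.coeff (m + 1) := by
  have hd : ∀ n, n ≤ m + 1 → (hasseDeriv n P).natDegree ≤ m + 1 - n := fun n _ =>
    (natDegree_hasseDeriv_le P n).trans (by omega)
  constructor
  · rw [natDegree_le_iff_coeff_eq_zero]
    intro n hn
    rw [coeff_sub]
    rcases Nat.lt_or_ge (m + 1) n with h1 | h1
    · rw [coeff_eq_zero_of_natDegree_lt (by rw [natDegree_taylor]; omega), coeff_eq_zero_of_natDegree_lt (by omega), sub_zero]
    · have : n = m + 1 := by omega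
      subst this
      rw [taylor_coeff, eq_C_of_natDegree_le_zero (p := hasseDeriv (m+1) P) (by have := hd (m+1) le_rfl; omega), eval_C, hasseDeriv_coeff]
      simp
  · rw [coeff_sub, taylor_coeff, eq_X_add_C_of_natDegree_le_one (p := hasseDeriv m P) (by have := hd m (by omega); omega)]
    simp only [eval_add, eval_mul, eval_C, eval_X, hasseDeriv_coeff]
    simp only [zero_add, Nat.choose_self, add_comm 1 m, Nat.choose_succ_self_right]
    push_cast
    ring

lemma weyl_diff (N : ℕ) : ∀ (j : ℕ) (P : ℝ[X]), P.natDegree ≤ j + 3 → ∀ u v : ℤ, 1 ≤ u → v ≤ N →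
    ‖∑ x ∈ Icc u v, ee (P.eval (x:ℝ))‖ ^ (2 ^ j) ≤ (2 * (N:ℝ) + 1) ^ (2 ^ j - j - 1) *
      TT N j (fun n => Wf N (P.coeff (j + 3) * ((Nat.factorial (j + 3) : ℕ) / 6 : ℝ) * n)) := by
  intro j
  induction j with
  | zero =>
    intro P hP u v hu hv
    simp only [pow_zero, pow_one, TT, zero_add]
    norm_num [Nat.factorial]
    have := le_Wf N (P.coeff 3) (P.coeff 2) (P.coeff 1) (P.coeff 0) u v hu hv
    refine le_trans (le_of_eq ?_) this
    unfold cs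
    congr 1
    refine sum_congr rfl fun x _ => ?_
    rw [eval_eq_sum_range' (n := 4) (by omega)]
    simp only [sum_range_succ, range_zero, sum_empty]
    congr 1; ring
  | succ j ih =>
    intro P hP u v hu hv
    set M := 2 * (N:ℝ) + 1 with hM
    have hM0 : 0 < M := by positivity
    have hcard : ((Icc (-(N:ℤ)) N).card : ℝ) = M := by
      rw [Int.card_Icc, hM]
      have : ((N:ℤ) + 1 - -(N:ℤ)).toNat = 2 * N + 1 := by omega
      rw [this]; push_cast; ring
    have h1 := diff_id (fun x => P.eval (x:ℝ)) N u v hu hv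
    set S : ℤ → ℝ := fun h => ‖∑ x ∈ Icc (max u (u - h)) (min v (v - h)), ee (P.eval ((x + h : ℤ):ℝ) - P.eval (x:ℝ))‖ with hS
    have hS2 : ∀ h : ℤ, S h ^ (2 ^ j) ≤ M ^ (2 ^ j - j - 1) * TT N j (fun n => Wf N (P.coeff (j + 1 + 3) * ((Nat.factorial (j + 1 + 3) : ℕ) / 6 : ℝ) * ((h * n : ℤ):ℝ))) := by
      intro h
      obtain ⟨d1, d2⟩ := dpoly P (j + 3) (by omega) (h:ℝ)
      have := ih (taylor (h:ℝ) P - P) d1 (max u (u - h)) (min v (v - h)) (by omega) (by omega)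
      refine le_trans (le_of_eq ?_) (this.trans (le_of_eq ?_))
      · simp only [hS]
        congr 2
        refine sum_congr rfl fun x _ => ?_
        rw [eval_sub, taylor_eval]
        push_cast
        rfl
      · congr 2
        funext n
        congr 1
        have hf : ((Nat.factorial (j + 1 + 3) : ℕ):ℝ) = ((j + 3 : ℕ) + 1) * ((Nat.factorial (j + 3) : ℕ):ℝ) := by
          rw [show j + 1 + 3 = (j + 3) + 1 by ring, Nat.factorial_succ (j + 3)]
          push_cast; ring
        rw [d2, hf, show j + 1 + 3 = (j + 3) + 1 by ring]
        generalize ((Nat.factorial (j + 3) : ℕ):ℝ) = y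
        push_cast; ring
    have h2 : (∑ h ∈ Icc (-(N:ℤ)) N, S h) ^ (2 ^ j) ≤ M ^ (2 ^ j - 1) * ∑ h ∈ Icc (-(N:ℤ)) N, S h ^ (2 ^ j) := by
      have h2j : 1 ≤ 2 ^ j := Nat.one_le_two_pow
      have := pow_sum_div_card_le_sum_pow (s := Icc (-(N:ℤ)) N) (f := S) (fun i _ => norm_nonneg _) (2 ^ j - 1)
      rw [hcard, Nat.sub_add_cancel h2j, div_le_iff₀ (by positivity)] at this
      linarith
    have hj : j + 1 ≤ 2 ^ j := Nat.lt_two_pow_self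
    calc _ = (‖∑ x ∈ Icc u v, ee (P.eval (x:ℝ))‖ ^ 2) ^ (2 ^ j) := by rw [← pow_mul, pow_succ, mul_comm]
      _ ≤ (∑ h ∈ Icc (-(N:ℤ)) N, S h) ^ (2 ^ j) := by gcongr
      _ ≤ _ := h2
      _ ≤ M ^ (2 ^ j - 1) * ∑ h ∈ Icc (-(N:ℤ)) N, M ^ (2 ^ j - j - 1) * TT N j (fun n => Wf N (P.coeff (j + 1 + 3) * ((Nat.factorial (j + 1 + 3) : ℕ) / 6 : ℝ) * ((h * n : ℤ):ℝ))) := by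
          gcongr with h _; exact hS2 h
      _ = _ := by
          rw [← mul_sum, ← mul_assoc, ← pow_add]
          have : 2 ^ j - 1 + (2 ^ j - j - 1) = 2 ^ (j + 1) - (j + 1) - 1 := by
            rw [pow_succ]; omega
          rw [this]
          rfl

lemma TT_mono (N : ℕ) : ∀ (j : ℕ) (F G : ℤ → ℝ), (∀ n, F n ≤ G n) → TT N j F ≤ TT N j G := by
  intro j
  induction j with
  | zero => intro F G h; exact h 1
  | succ j ih => intro F G h; exact sum_le_sum fun i _ => ih _ _ fun n => h _

lemma TT_const (N : ℕ) (c : ℝ) : ∀ j, TT N j (fun _ => c) = (2 * (N:ℝ) + 1) ^ j * c := by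
  intro j
  induction j with
  | zero => simp [TT]
  | succ j ih =>
    simp only [TT, ih, sum_const, Int.card_Icc, nsmul_eq_mul]
    have : ((N:ℤ) + 1 - -(N:ℤ)).toNat = 2 * N + 1 := by omega
    rw [this]; push_cast; ring

/-- nonzero integers up to N^j -/
noncomputable def QQ (N j : ℕ) : Finset ℤ := (Icc (-((N ^ j : ℕ):ℤ)) ((N ^ j : ℕ):ℤ)).erase 0

lemma mem_QQ {N j : ℕ} {n : ℤ} : n ∈ QQ N j ↔ n ≠ 0 ∧ n.natAbs ≤ N ^ j := by
  unfold QQ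
  rw [mem_erase, mem_Icc]
  constructor
  · rintro ⟨h, h1, h2⟩; exact ⟨h, by omega⟩
  · rintro ⟨h, h1⟩; exact ⟨h, by omega, by omega⟩

lemma TT_bound (N : ℕ) : ∀ (j : ℕ) (F : ℤ → ℝ), (∀ n, 0 ≤ F n) →
    TT N j F ≤ ∑ n ∈ QQ N j, (2 * (n.natAbs.divisors.card:ℝ)) ^ j * F n + j * (2 * (N:ℝ) + 1) ^ (j - 1) * F 0 := by
  intro j
  induction j with
  | zero =>
    intro F hF
    simp only [TT, pow_zero, one_mul, Nat.cast_zero, zero_mul, add_zero]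
    exact single_le_sum (f := F) (fun i _ => hF i) (mem_QQ.2 (by norm_num))
  | succ j ih =>
    intro F hF
    set M := 2 * (N:ℝ) + 1 with hM
    have hM0 : 0 < M := by positivity
    have h0 : (0:ℤ) ∈ Icc (-(N:ℤ)) N := by simp
    have hcard : (((Icc (-(N:ℤ)) N).erase 0).card : ℝ) ≤ M := by
      have : (((Icc (-(N:ℤ)) N).erase 0).card : ℝ) ≤ ((Icc (-(N:ℤ)) N).card : ℝ) := by
        exact_mod_cast card_le_card (erase_subset _ _)
      refine this.trans (le_of_eq ?_)
      rw [Int.card_Icc, hM]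
      have : ((N:ℤ) + 1 - -(N:ℤ)).toNat = 2 * N + 1 := by omega
      rw [this]; push_cast; ring
    simp only [TT]
    rw [← add_sum_erase _ _ h0]
    simp only [zero_mul, TT_const]
    have hmain : ∑ h ∈ (Icc (-(N:ℤ)) N).erase 0, ∑ n ∈ QQ N j, (2 * (n.natAbs.divisors.card:ℝ)) ^ j * F (h * n) ≤
        ∑ m ∈ QQ N (j+1), (2 * (m.natAbs.divisors.card:ℝ)) ^ (j+1) * F m := by
      rw [← sum_product']
      have hmaps : ∀ p ∈ (Icc (-(N:ℤ)) N).erase 0 ×ˢ QQ N j, p.1 * p.2 ∈ QQ N (j+1) := by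
        rintro ⟨h, n⟩ hp
        simp only [mem_product, mem_erase, mem_Icc, mem_QQ] at hp ⊢
        refine ⟨mul_ne_zero hp.1.1 hp.2.1, ?_⟩
        rw [Int.natAbs_mul, pow_succ, mul_comm]
        exact Nat.mul_le_mul hp.2.2 (by omega)
      rw [← sum_fiberwise_of_maps_to hmaps]
      refine sum_le_sum fun m hm => ?_
      have hm0 := (mem_QQ.1 hm).1
      calc _ ≤ ∑ p ∈ (((Icc (-(N:ℤ)) N).erase 0 ×ˢ QQ N j).filter fun p => p.1 * p.2 = m), (2 * (m.natAbs.divisors.card:ℝ)) ^ j * F m := by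
            refine sum_le_sum fun p hp => ?_
            have hpm := (mem_filter.1 hp).2
            rw [hpm]
            have := hF m
            gcongr
            rw [← hpm, Int.natAbs_mul]; exact Dvd.intro_left _ rfl
        _ = ((((Icc (-(N:ℤ)) N).erase 0 ×ˢ QQ N j).filter fun p => p.1 * p.2 = m).card:ℝ) * ((2 * (m.natAbs.divisors.card:ℝ)) ^ j * F m) := by
            rw [sum_const, nsmul_eq_mul]
        _ ≤ (2 * (m.natAbs.divisors.card:ℝ)) * ((2 * (m.natAbs.divisors.card:ℝ)) ^ j * F m) := by
            have := hF m
            gcongr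
            have hc : (((Icc (-(N:ℤ)) N).erase 0 ×ˢ QQ N j).filter fun p => p.1 * p.2 = m).card ≤
                (m.natAbs.divisors.image (fun d : ℕ => (d:ℤ)) ∪ m.natAbs.divisors.image (fun d : ℕ => -(d:ℤ))).card := by
              refine card_le_card_of_injOn (fun p => p.1) ?_ ?_
              · intro p hp
                have hp := mem_filter.1 (mem_coe.1 hp)
                have hd : p.1.natAbs ∈ m.natAbs.divisors := by
                  rw [Nat.mem_divisors]
                  exact ⟨by rw [← hp.2, Int.natAbs_mul]; exact Dvd.intro _ rfl, by simpa using hm0⟩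
                rw [mem_coe, mem_union, mem_image, mem_image]
                rcases Int.natAbs_eq p.1 with h | h
                · left; exact ⟨_, hd, h.symm⟩
                · right; exact ⟨_, hd, h.symm⟩
              · rintro ⟨a, b⟩ hp ⟨a', b'⟩ hp' he
                have hp := mem_filter.1 (mem_coe.1 hp)
                have hp' := mem_filter.1 (mem_coe.1 hp')
                simp only at he hp hp'
                subst he
                have ha : a ≠ 0 := by
                  have := hp.1; simp only [mem_product, mem_erase] at this; exact this.1.1
                have : b = b' := mul_left_cancel₀ ha (hp.2.trans hp'.2.symm)
                rw [this]
            have := hc.trans ((card_union_le _ _).trans (add_le_add card_image_le card_image_le))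
            have h3 : (((((Icc (-(N:ℤ)) N).erase 0 ×ˢ QQ N j).filter fun p => p.1 * p.2 = m).card : ℕ):ℝ) ≤ ((m.natAbs.divisors.card + m.natAbs.divisors.card : ℕ):ℝ) := by exact_mod_cast this
            push_cast at h3
            linarith
        _ = _ := by ring
    have hpart : ∑ h ∈ (Icc (-(N:ℤ)) N).erase 0, TT N j (fun n => F (h * n)) ≤
        ∑ m ∈ QQ N (j+1), (2 * (m.natAbs.divisors.card:ℝ)) ^ (j+1) * F m + j * M ^ j * F 0 := by
      calc _ ≤ ∑ h ∈ (Icc (-(N:ℤ)) N).erase 0, (∑ n ∈ QQ N j, (2 * (n.natAbs.divisors.card:ℝ)) ^ j * F (h * n) + j * M ^ (j - 1) * F (h * 0)) :=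
            sum_le_sum fun h _ => ih _ fun n => hF _
        _ ≤ _ := by
            rw [sum_add_distrib]
            refine add_le_add hmain ?_
            simp only [mul_zero, sum_const, nsmul_eq_mul]
            rcases j with _ | j
            · simp
            · have := hF 0
              calc _ ≤ M * (((j + 1 : ℕ):ℝ) * M ^ (j + 1 - 1) * F 0) := by gcongr
                _ = _ := by rw [Nat.add_sub_cancel, pow_succ]; ring
    have := add_le_add_right hpart (M ^ j * F 0)
    refine this.trans (le_of_eq ?_)
    rw [Nat.add_sub_cancel]; push_cast; ring
end WW

namespace WW
open Finset

lemma block_count (α : ℝ) (a : ℤ) (q : ℕ) (hq : 0 < q) (hc : Int.gcd a q = 1)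
    (hα : |α - (a:ℝ) / q| ≤ ((q:ℝ) ^ 2)⁻¹) (δ : ℝ) (hδ : 0 ≤ δ) (x : ℝ) (t : ℤ) (T : Finset ℤ)
    (hT : ∀ m ∈ T, m / q = t) (h : ∀ m ∈ T, ∃ z : ℤ, |α * m - x - z| ≤ δ) :
    (T.card : ℝ) ≤ 4 * δ * q + 3 := by
  have hq0 : (0:ℝ) < q := by exact_mod_cast hq
  rcases T.eq_empty_or_nonempty with rfl | ⟨i0, hi0⟩
  · simp; positivity
  choose! z hz using h
  set s : ℤ → ℤ := fun i => (i - i0) * a - (z i - z i0) * q with hs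
  set B : ℕ := ⌊2 * δ * q + 1⌋₊ with hB
  have hmod : ∀ i ∈ T, i = t * q + i % q ∧ 0 ≤ i % q ∧ i % q < q := by
    intro i hi
    have h1 := hT i hi
    have h2 := Int.mul_ediv_add_emod i q
    refine ⟨by rw [← h1]; linarith, Int.emod_nonneg _ (by omega), Int.emod_lt_of_pos _ (by omega)⟩
  have hmaps : ∀ i ∈ T, s i ∈ Icc (-(B:ℤ)) B := by
    intro i hi
    have hd : |((i - i0 : ℤ):ℝ)| ≤ q := by
      have h1 := hmod i hi
      have h2 := hmod i0 hi0
      have : |i - i0| ≤ q := by rw [abs_le]; constructor <;> omega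
      exact_mod_cast this
    have e : ((s i : ℤ):ℝ) = q * ((α * i - x - z i) - (α * i0 - x - z i0)) - q * (((i - i0 : ℤ):ℝ) * (α - (a:ℝ) / q)) := by
      simp only [hs]; push_cast; field_simp; ring
    have h1 := hz i hi
    have h2 := hz i0 hi0
    have h3 : |((i - i0 : ℤ):ℝ) * (α - (a:ℝ) / q)| ≤ q * ((q:ℝ) ^ 2)⁻¹ := by
      rw [abs_mul]; gcongr
    have h4 : |((s i:ℤ):ℝ)| ≤ 2 * δ * q + 1 := by
      rw [e]
      have h5 : q * (q * ((q:ℝ) ^ 2)⁻¹) = 1 := by field_simp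
      calc _ ≤ |(q:ℝ) * ((α * i - x - z i) - (α * i0 - x - z i0))| + |q * (((i - i0 : ℤ):ℝ) * (α - (a:ℝ) / q))| := abs_sub _ _
        _ ≤ q * (δ + δ) + q * (q * ((q:ℝ) ^ 2)⁻¹) := by
          rw [abs_mul, abs_mul (q:ℝ), abs_of_pos hq0]
          gcongr
          exact (abs_sub _ _).trans (add_le_add h1 h2)
        _ = _ := by rw [h5]; ring
    have h6 : (s i).natAbs ≤ B := by
      rw [hB, Nat.le_floor_iff (by positivity)]
      rw [Nat.cast_natAbs]; push_cast; exact h4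
    rw [mem_Icc]; omega
  have hinj : Set.InjOn s T := by
    intro i hi i' hi' he
    simp only [hs] at he
    have hd : (q:ℤ) ∣ (i - i') * a := ⟨z i - z i', by linarith⟩
    have hcop : IsCoprime (q:ℤ) a := (Int.isCoprime_iff_gcd_eq_one.2 hc).symm
    have hd2 := hcop.dvd_of_dvd_mul_right hd
    have h1 := hmod i hi
    have h2 := hmod i' hi'
    have h3 : i % q = i' % q := Int.emod_eq_emod_iff_emod_sub_eq_zero.2 (Int.emod_eq_zero_of_dvd hd2)
    rw [h1.1, h2.1, h3]
  have hcard := card_le_card_of_injOn s (fun i hi => mem_coe.2 (hmaps i hi)) hinj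
  rw [Int.card_Icc] at hcard
  have h7 : T.card ≤ 2 * B + 1 := by omega
  have h8 : (B:ℝ) ≤ 2 * δ * q + 1 := Nat.floor_le (by positivity)
  have h9 : (T.card:ℝ) ≤ 2 * B + 1 := by exact_mod_cast h7
  linarith

lemma full_count (α : ℝ) (a : ℤ) (q : ℕ) (hq : 0 < q) (hc : Int.gcd a q = 1)
    (hα : |α - (a:ℝ) / q| ≤ ((q:ℝ) ^ 2)⁻¹) (δ : ℝ) (hδ : 0 ≤ δ) (x : ℝ) (H : ℕ) (T : Finset ℤ)
    (hT : ∀ m ∈ T, m.natAbs ≤ H) (h : ∀ m ∈ T, ∃ z : ℤ, |α * m - x - z| ≤ δ) :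
    (T.card : ℝ) ≤ (4 * δ * q + 3) * (2 * H / q + 2) := by
  classical
  have hq0 : (0:ℝ) < q := by exact_mod_cast hq
  have hqz : (0:ℤ) < q := by exact_mod_cast hq
  set I := Icc (-((H / q : ℕ):ℤ) - 1) ((H / q : ℕ):ℤ) with hI
  have hmaps : ∀ m ∈ T, m / (q:ℤ) ∈ I := by
    intro m hm
    have := hT m hm
    rw [hI, mem_Icc]
    push_cast
    constructor
    · rw [Int.le_ediv_iff_mul_le hqz]
      have h1 := Int.mul_ediv_add_emod (H:ℤ) q
      have h2 := Int.emod_lt_of_pos (H:ℤ) hqz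
      have : (-((H:ℤ) / q) - 1) * q = - (q * ((H:ℤ) / q)) - q := by ring
      rw [this]; omega
    · exact Int.ediv_le_ediv hqz (by omega)
  have e := card_eq_sum_card_fiberwise (f := fun m => m / (q:ℤ)) (s := T) (t := I) (fun m hm => mem_coe.2 (hmaps m (mem_coe.1 hm)))
  rw [e]; push_cast
  calc _ ≤ ∑ t ∈ I, (4 * δ * q + 3) := sum_le_sum fun t _ =>
        block_count α a q hq hc hα δ hδ x t _ (fun m hm => (mem_filter.1 hm).2) (fun m hm => h m (mem_filter.1 hm).1)
    _ = (I.card:ℝ) * (4 * δ * q + 3) := by rw [sum_const, nsmul_eq_mul]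
    _ ≤ _ := by
      rw [mul_comm]
      gcongr
      rw [hI, Int.card_Icc]
      have : (((H / q : ℕ):ℤ) + 1 - (-((H / q : ℕ):ℤ) - 1)).toNat = 2 * (H / q) + 2 := by omega
      rw [this]; push_cast
      have := Nat.cast_div_le (α := ℝ) (m := H) (n := q)
      rw [mul_div_assoc]; linarith

lemma Sp_holds (k : ℕ) (hk : 6 ≤ k) (α : ℝ) (a : ℤ) (q : ℕ) (hq : 0 < q) (hc : Int.gcd a q = 1)
    (hα : |α - (a:ℝ) / q| ≤ ((q:ℝ) ^ 2)⁻¹) (N : ℕ) (hN : 1 ≤ N) :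
    Sp N (QQ N (k - 3)) (fun n => α * ((Nat.factorial k : ℕ) / 6 : ℝ) * n)
      (14 * (Nat.factorial k : ℕ) * ((N:ℝ) ^ (k - 3) * ((q:ℝ)⁻¹ + ((N:ℝ) ^ 3)⁻¹ + q * ((N:ℝ) ^ k)⁻¹))) := by
  intro T hT x h
  have hq0 : (0:ℝ) < q := by exact_mod_cast hq
  have hN1 : (1:ℝ) ≤ N := by exact_mod_cast hN
  have hN0 : (0:ℝ) < N := by linarith
  obtain ⟨c, hcd⟩ : 6 ∣ Nat.factorial k := (Nat.factorial_dvd_factorial (show 3 ≤ k by omega) : Nat.factorial 3 ∣ _)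
  have hc1 : 1 ≤ c := by
    rcases Nat.eq_zero_or_pos c with h0 | h0
    · rw [h0] at hcd; exact absurd hcd (Nat.factorial_ne_zero k)
    · exact h0
  have hcr : ((Nat.factorial k : ℕ) / 6 : ℝ) = c := by rw [hcd]; push_cast; ring
  have hcF : ((Nat.factorial k : ℕ):ℝ) = 6 * c := by rw [hcd]; push_cast; ring
  have hinj : Function.Injective (fun n : ℤ => (c:ℤ) * n) := fun u v huv => mul_left_cancel₀ (by omega) huv
  have := full_count α a q hq hc hα (1 / ((49 * N ^ 3 : ℕ):ℝ)) (by positivity) x (c * N ^ (k - 3)) (T.image fun n => (c:ℤ) * n)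
    (by
      intro m hm
      obtain ⟨n, hn, rfl⟩ := mem_image.1 hm
      rw [Int.natAbs_mul, Int.natAbs_natCast]
      exact Nat.mul_le_mul_left _ (mem_QQ.1 (hT hn)).2)
    (by
      intro m hm
      obtain ⟨n, hn, rfl⟩ := mem_image.1 hm
      obtain ⟨z, hz⟩ := h n hn
      refine ⟨z, ?_⟩
      rw [hcr] at hz
      push_cast at hz ⊢
      rw [← mul_assoc]; exact hz)
  rw [card_image_of_injective _ hinj] at this
  refine this.trans ?_
  rw [hcF]
  obtain ⟨i, rfl⟩ : ∃ i, k = i + 6 := ⟨k - 6, by omega⟩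
  have hp : i + 6 - 3 = i + 3 := by omega
  rw [hp]
  have hc1' : (1:ℝ) ≤ c := by exact_mod_cast hc1
  have hNi : (1:ℝ) ≤ (N:ℝ) ^ i := one_le_pow₀ hN1
  have e2 : (14 * (6 * c) * ((N:ℝ) ^ (i + 3) * ((q:ℝ)⁻¹ + ((N:ℝ) ^ 3)⁻¹ + q * ((N:ℝ) ^ (i + 6))⁻¹)) : ℝ) =
      84 * c * ((N:ℝ) ^ (i + 3) / q) + 84 * c * (N:ℝ) ^ i + 84 * c * (q / (N:ℝ) ^ 3) := by
    field_simp
    ring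
  have e3 : (4 * (1 / ((49 * N ^ 3 : ℕ):ℝ)) * q + 3) * (2 * ((c * N ^ (i + 3) : ℕ):ℝ) / q + 2) =
      6 * c * ((N:ℝ) ^ (i + 3) / q) + (8 / 49 * c * (N:ℝ) ^ i + 6) + 8 / 49 * (q / (N:ℝ) ^ 3) := by
    push_cast; field_simp; ring
  rw [e2, e3]
  have p1 : 0 ≤ (N:ℝ) ^ (i + 3) / q := by positivity
  have p2 : 0 ≤ q / (N:ℝ) ^ 3 := by positivity
  have p3 : 1 ≤ c * (N:ℝ) ^ i := by nlinarith
  have p4 : 0 ≤ c * ((N:ℝ) ^ (i + 3) / q) := by positivity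
  have p5 : q / (N:ℝ) ^ 3 ≤ c * (q / (N:ℝ) ^ 3) := by nlinarith
  nlinarith
end WW

namespace WW
open Finset

lemma mix {θ a b y Θ : ℝ} (h0 : 0 ≤ θ) (h1 : θ ≤ 1) (ha : 1 ≤ a) (hb : 1 ≤ b) (hy : 0 < y) (hΘ : 0 ≤ Θ) :
    (a * y) ^ (1 - θ) * (b * (y * Θ)) ^ θ ≤ a * b * y * Θ ^ θ := by
  rw [Real.mul_rpow (by linarith) hy.le, Real.mul_rpow (by linarith) (by positivity), Real.mul_rpow hy.le hΘ]
  have e : y ^ (1 - θ) * y ^ θ = y := by rw [← Real.rpow_add hy]; norm_num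
  calc _ = a ^ (1 - θ) * b ^ θ * (y ^ (1 - θ) * y ^ θ) * Θ ^ θ := by ring
    _ = a ^ (1 - θ) * b ^ θ * y * Θ ^ θ := by rw [e]
    _ ≤ _ := by
      gcongr
      · exact rp_le_self ha (by linarith)
      · exact rp_le_self hb h1

lemma card_QQ (N j : ℕ) : ((QQ N j).card : ℝ) ≤ 2 * (N:ℝ) ^ j := by
  have : (QQ N j).card ≤ 2 * N ^ j := by
    unfold QQ
    rw [card_erase_of_mem (by simp), Int.card_Icc]
    omega
  exact_mod_cast this

lemma S_bound (j : ℕ) (ε : ℝ) (hε : 0 < ε) : ∃ C : ℝ, 0 < C ∧ ∀ N : ℕ, 1 ≤ N → ∀ (γ : ℤ → ℝ) (b Θ : ℝ),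
    1 ≤ b → 0 ≤ Θ → Sp N (QQ N j) γ (b * ((N:ℝ) ^ j * Θ)) →
    ∑ i ∈ QQ N j, Wf N (γ i) ≤ C * b * (N:ℝ) ^ ε * ((N:ℝ) ^ (j + 1) * (Θ ^ (1/8:ℝ) + (Θ / N) ^ (1/12:ℝ))) := by
  obtain ⟨C, hC, h⟩ := meanW ε hε
  refine ⟨2 * C, by positivity, fun N hN γ b Θ hb hΘ hS => ?_⟩
  have hN0 : (0:ℝ) < N := by exact_mod_cast hN
  refine (h N hN _ γ _ (by positivity) hS).trans ?_
  have hcard := card_QQ N j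
  have m1 := mix (θ := 1/8) (a := 2) (by norm_num) (by norm_num) (by norm_num) hb (pow_pos hN0 j) hΘ
  have m2 := mix (θ := 1/12) (a := 2) (by norm_num) (by norm_num) (by norm_num) hb (pow_pos hN0 j) hΘ
  rw [show (1 - 1/8:ℝ) = 7/8 by norm_num] at m1
  rw [show (1 - 1/12:ℝ) = 11/12 by norm_num] at m2
  have e : (N:ℝ) ^ (11/12:ℝ) * Θ ^ (1/12:ℝ) = N * (Θ / N) ^ (1/12:ℝ) := by
    rw [Real.div_rpow hΘ hN0.le, show (11/12:ℝ) = 1 - 1/12 by norm_num, Real.rpow_sub hN0, Real.rpow_one]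
    ring
  calc _ ≤ C * (N:ℝ) ^ ε * ((2 * (N:ℝ) ^ j) ^ (7/8:ℝ) * (b * ((N:ℝ) ^ j * Θ)) ^ (1/8:ℝ) * N +
      (2 * (N:ℝ) ^ j) ^ (11/12:ℝ) * (b * ((N:ℝ) ^ j * Θ)) ^ (1/12:ℝ) * (N:ℝ) ^ (11/12:ℝ)) := by gcongr
    _ ≤ C * (N:ℝ) ^ ε * (2 * b * (N:ℝ) ^ j * Θ ^ (1/8:ℝ) * N + 2 * b * (N:ℝ) ^ j * Θ ^ (1/12:ℝ) * (N:ℝ) ^ (11/12:ℝ)) := by gcongr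
    _ = C * (N:ℝ) ^ ε * (2 * b * (N:ℝ) ^ j * Θ ^ (1/8:ℝ) * N + 2 * b * (N:ℝ) ^ j * ((N:ℝ) ^ (11/12:ℝ) * Θ ^ (1/12:ℝ))) := by ring
    _ = _ := by rw [e]; ring

lemma core (k : ℕ) (hk : 6 ≤ k) (ε : ℝ) (hε : 0 < ε) : ∃ C : ℝ, 0 < C ∧ ∀ (α : ℝ) (a : ℤ) (q : ℕ),
      0 < q → Int.gcd a q = 1 → |α - (a : ℝ) / q| ≤ ((q : ℝ) ^ 2)⁻¹ → ∀ N : ℕ, 1 ≤ N → ∀ Θ : ℝ,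
      Θ = (q:ℝ)⁻¹ + ((N:ℝ) ^ 3)⁻¹ + q * ((N:ℝ) ^ k)⁻¹ →
      ‖∑ x ∈ Icc (1:ℤ) N, ee (α * (x:ℝ) ^ k)‖ ^ (2 ^ (k - 3)) ≤
        C * ((N:ℝ) ^ (2 ^ (k - 3)) * (N:ℝ) ^ ε * (Θ ^ (1/8:ℝ) + (Θ / N) ^ (1/12:ℝ))) := by
  obtain ⟨j, rfl⟩ : ∃ j, k = j + 3 := ⟨k - 3, by omega⟩
  have hj3 : 3 ≤ j := by omega
  have hj0 : (0:ℝ) < j := by exact_mod_cast (by omega : 0 < j)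
  obtain ⟨C1, hC1, h1⟩ := S_bound j (ε / 2) (by positivity)
  obtain ⟨C3, hC3, h3⟩ := div_bound (ε / (2 * j * j)) (by positivity)
  have hb : (1:ℝ) ≤ 14 * (Nat.factorial (j + 3) : ℕ) := by
    have : (1:ℝ) ≤ (Nat.factorial (j + 3) : ℕ) := by exact_mod_cast Nat.factorial_pos _
    linarith
  obtain ⟨b, hbd⟩ : ∃ b : ℝ, b = 14 * (Nat.factorial (j + 3) : ℕ) := ⟨_, rfl⟩
  rw [← hbd] at hb
  have hb0 : 0 < b := by linarith
  refine ⟨3 ^ (2 ^ j) * ((2 * C3) ^ j * (C1 * b) + j * 3 ^ j), by positivity, ?_⟩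
  intro α a q hq hc hα N hN Θ hΘ
  have hN1 : (1:ℝ) ≤ N := by exact_mod_cast hN
  have hN0 : (0:ℝ) < N := by linarith
  have hΘ0 : 0 ≤ Θ := by rw [hΘ]; positivity
  have hsp := Sp_holds (j + 3) hk α a q hq hc hα N hN
  simp only [Nat.add_sub_cancel] at hsp ⊢
  rw [← hbd, ← hΘ] at hsp
  have hS := h1 N hN _ b Θ hb hΘ0 hsp
  obtain ⟨Φ, hΦ⟩ : ∃ Φ, Φ = Θ ^ (1/8:ℝ) + (Θ / N) ^ (1/12:ℝ) := ⟨_, rfl⟩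
  rw [← hΦ] at hS ⊢
  have hΦN : 1 ≤ N * Φ := by
    have t1 : ((N:ℝ) ^ 8)⁻¹ ≤ Θ := by
      have u1 : ((N:ℝ) ^ 8)⁻¹ ≤ ((N:ℝ) ^ 3)⁻¹ := by
        gcongr
        norm_num
      have u2 : 0 ≤ (q:ℝ)⁻¹ := by positivity
      have u3 : 0 ≤ q * ((N:ℝ) ^ (j + 3))⁻¹ := by positivity
      rw [hΘ]; linarith
    have t2 : (N:ℝ)⁻¹ ≤ Θ ^ (1/8:ℝ) := by
      calc (N:ℝ)⁻¹ = (((N:ℝ) ^ 8)⁻¹) ^ (1/8:ℝ) := by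
            rw [Real.inv_rpow (by positivity), ← Real.rpow_natCast, ← Real.rpow_mul hN0.le]
            norm_num
        _ ≤ _ := by gcongr
    have t3 : 0 ≤ (Θ / N) ^ (1/12:ℝ) := by positivity
    have t4 : (N:ℝ)⁻¹ ≤ Φ := by rw [hΦ]; linarith
    calc (1:ℝ) = N * (N:ℝ)⁻¹ := by field_simp
      _ ≤ _ := by gcongr
  have hΦ0 : 0 ≤ Φ := by rw [hΦ]; positivity
  have hE1 : 1 ≤ (N:ℝ) ^ ε := Real.one_le_rpow hN1 hε.le
  have hEE : (N:ℝ) ^ (ε/2) * (N:ℝ) ^ (ε/2) = (N:ℝ) ^ ε := by rw [← Real.rpow_add hN0]; norm_num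
  obtain ⟨F, hF⟩ : ∃ F : ℤ → ℝ, F = fun n : ℤ => Wf N (α * ((Nat.factorial (j + 3) : ℕ) / 6 : ℝ) * n) := ⟨_, rfl⟩
  have hF0 : ∀ n, 0 ≤ F n := fun n => by rw [hF]; exact Wf_nonneg _ _
  have hT := TT_bound N j F hF0
  have hD : ∀ n ∈ QQ N j, (2 * (n.natAbs.divisors.card:ℝ)) ^ j ≤ (2 * C3) ^ j * (N:ℝ) ^ (ε / 2) := by
    intro n hn
    obtain ⟨n0, n1⟩ := mem_QQ.1 hn
    have d1 := h3 n.natAbs (by simpa using n0)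
    have d2 : (n.natAbs:ℝ) ^ (ε / (2 * j * j)) ≤ ((N:ℝ) ^ j) ^ (ε / (2 * j * j)) := by
      gcongr
      exact_mod_cast n1
    calc _ ≤ (2 * (C3 * ((N:ℝ) ^ j) ^ (ε / (2 * j * j)))) ^ j := by
          gcongr
          exact d1.trans (by gcongr)
      _ = (2 * C3) ^ j * (((N:ℝ) ^ j) ^ (ε / (2 * j * j))) ^ j := by rw [← mul_assoc, mul_pow]
      _ = _ := by
          congr 1
          rw [← Real.rpow_natCast (N:ℝ) j, ← Real.rpow_mul hN0.le, ← Real.rpow_natCast _ j, ← Real.rpow_mul hN0.le]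
          congr 1
          field_simp
  have hTT : TT N j F ≤ ((2 * C3) ^ j * (C1 * b) + j * 3 ^ j) * ((N:ℝ) ^ (j + 1) * (N:ℝ) ^ ε * Φ) := by
    have p1 : ∑ n ∈ QQ N j, (2 * (n.natAbs.divisors.card:ℝ)) ^ j * F n ≤ (2 * C3) ^ j * (C1 * b) * ((N:ℝ) ^ (j + 1) * (N:ℝ) ^ ε * Φ) := by
      calc _ ≤ ∑ n ∈ QQ N j, (2 * C3) ^ j * (N:ℝ) ^ (ε / 2) * F n :=
            sum_le_sum fun n hn => mul_le_mul_of_nonneg_right (hD n hn) (hF0 n)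
        _ = (2 * C3) ^ j * (N:ℝ) ^ (ε / 2) * ∑ n ∈ QQ N j, F n := by rw [mul_sum]
        _ ≤ (2 * C3) ^ j * (N:ℝ) ^ (ε / 2) * (C1 * b * (N:ℝ) ^ (ε / 2) * ((N:ℝ) ^ (j + 1) * Φ)) := by
            gcongr
            rw [hF]; exact hS
        _ = (2 * C3) ^ j * (C1 * b) * ((N:ℝ) ^ (j + 1) * ((N:ℝ) ^ (ε / 2) * (N:ℝ) ^ (ε / 2)) * Φ) := by ring
        _ = _ := by rw [hEE]
    have p2 : j * (2 * (N:ℝ) + 1) ^ (j - 1) * F 0 ≤ j * 3 ^ j * ((N:ℝ) ^ (j + 1) * (N:ℝ) ^ ε * Φ) := by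
      have hF00 : F 0 ≤ N := by rw [hF]; exact Wf_le _ _
      calc _ ≤ j * (3 * (N:ℝ)) ^ (j - 1) * (3 * N) := by
            have := hF0 0
            gcongr
            · linarith
            · linarith
        _ = j * ((3 * (N:ℝ)) ^ (j - 1 + 1)) := by rw [pow_succ]; ring
        _ = j * 3 ^ j * ((N:ℝ) ^ j * 1 * 1) := by rw [Nat.sub_add_cancel (by omega), mul_pow]; ring
        _ ≤ j * 3 ^ j * ((N:ℝ) ^ j * (N:ℝ) ^ ε * (N * Φ)) := by gcongr
        _ = _ := by rw [pow_succ]; ring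
    calc _ ≤ _ := hT
      _ ≤ _ := add_le_add p1 p2
      _ = _ := by ring
  have hW := weyl_diff N j (Polynomial.C α * Polynomial.X ^ (j + 3)) (Polynomial.natDegree_C_mul_X_pow_le _ _) 1 N le_rfl le_rfl
  simp only [Polynomial.coeff_C_mul_X_pow, if_true, Polynomial.eval_mul, Polynomial.eval_C, Polynomial.eval_pow, Polynomial.eval_X] at hW
  rw [← hF] at hW
  refine hW.trans ?_
  have hj : j + 1 ≤ 2 ^ j := Nat.lt_two_pow_self
  calc _ ≤ (3 * (N:ℝ)) ^ (2 ^ j - j - 1) * (((2 * C3) ^ j * (C1 * b) + j * 3 ^ j) * ((N:ℝ) ^ (j + 1) * (N:ℝ) ^ ε * Φ)) := by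
        refine (mul_le_mul_of_nonneg_left hTT (by positivity)).trans ?_
        gcongr
        linarith
    _ = 3 ^ (2 ^ j - j - 1) * (((2 * C3) ^ j * (C1 * b) + j * 3 ^ j) * (((N:ℝ) ^ (2 ^ j - j - 1) * (N:ℝ) ^ (j + 1)) * (N:ℝ) ^ ε * Φ)) := by
        rw [mul_pow]; ring
    _ = 3 ^ (2 ^ j - j - 1) * (((2 * C3) ^ j * (C1 * b) + j * 3 ^ j) * ((N:ℝ) ^ (2 ^ j) * (N:ℝ) ^ ε * Φ)) := by
        rw [← pow_add, show 2 ^ j - j - 1 + (j + 1) = 2 ^ j by omega]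
    _ ≤ 3 ^ (2 ^ j) * (((2 * C3) ^ j * (C1 * b) + j * 3 ^ j) * ((N:ℝ) ^ (2 ^ j) * (N:ℝ) ^ ε * Φ)) := by
        gcongr
        · norm_num
        · omega
    _ = _ := by ring
end WW

namespace WW
open Finset

lemma gsum_eq (k : ℕ) (α X : ℝ) : gsum k α X = ∑ x ∈ Icc (1:ℤ) ((⌊X⌋₊ : ℕ):ℤ), ee (α * (x:ℝ) ^ k) := by
  unfold gsum
  refine sum_bij' (fun x _ => (x:ℤ)) (fun y _ => y.toNat) ?_ ?_ ?_ ?_ ?_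
  · intro x hx; simp only [mem_Icc] at *; omega
  · intro x hx; simp only [mem_Icc] at *; omega
  · intro x hx; simp
  · intro x hx; simp only [mem_Icc] at *; omega
  · intro x hx; unfold ee; push_cast; rfl

lemma final (k : ℕ) (hk : 6 ≤ k) (ε : ℝ) (hε : ε > 0) :
    ∃ C : ℝ, ∀ (α : ℝ) (a : ℤ) (q : ℕ),
      0 < q → Int.gcd a q = 1 → |α - (a : ℝ) / q| ≤ ((q : ℝ) ^ 2)⁻¹ →
      ∀ X : ℝ, X ≥ 1 →
        ‖gsum k α X‖ ≤
          C * (X ^ (1 + ε) *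
              ((q : ℝ)⁻¹ + X ^ (-(3 : ℝ)) + (q : ℝ) * X ^ (-(k : ℝ))) ^ ((2 : ℝ) ^ (-(k : ℝ))) +
            X ^ (1 + ε) *
              (((q : ℝ)⁻¹ + X ^ (-(3 : ℝ)) + (q : ℝ) * X ^ (-(k : ℝ))) / X) ^
                (2 / 3 * (2 : ℝ) ^ (-(k : ℝ)))) := by
  obtain ⟨C, hC, h⟩ := core k hk ε hε
  obtain ⟨B, hB⟩ : ∃ B : ℕ, B = 2 ^ (k - 3) := ⟨_, rfl⟩
  have hB1 : 1 ≤ B := by rw [hB]; exact Nat.one_le_two_pow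
  have hB1' : (1:ℝ) ≤ B := by exact_mod_cast hB1
  have hB0 : (0:ℝ) < B := by linarith
  have h8B : (2:ℝ) ^ (-(k:ℝ)) = 1/8 * (1/(B:ℝ)) := by
    rw [Real.rpow_neg (by norm_num), Real.rpow_natCast, hB]
    push_cast
    obtain ⟨j, rfl⟩ : ∃ j, k = j + 3 := ⟨k - 3, by omega⟩
    rw [Nat.add_sub_cancel, pow_add]
    field_simp; norm_num
  rw [← hB] at h
  refine ⟨(C * 2 ^ (k + 1)) ^ (1/(B:ℝ)), ?_⟩
  intro α a q hq hc hα X hX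
  have hq0 : (0:ℝ) < q := by exact_mod_cast hq
  have hX0 : 0 < X := by linarith
  obtain ⟨N, hNd⟩ : ∃ N : ℕ, N = ⌊X⌋₊ := ⟨_, rfl⟩
  have hN : 1 ≤ N := by rw [hNd]; exact Nat.le_floor (by exact_mod_cast hX)
  have hN1 : (1:ℝ) ≤ N := by exact_mod_cast hN
  have hN0 : (0:ℝ) < N := by linarith
  have hNX : (N:ℝ) ≤ X := by rw [hNd]; exact Nat.floor_le hX0.le
  have hXN : X ≤ 2 * N := by
    have := Nat.lt_floor_add_one X
    rw [← hNd] at this; linarith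
  obtain ⟨Θ, hΘ⟩ : ∃ Θ, Θ = (q : ℝ)⁻¹ + X ^ (-(3 : ℝ)) + (q : ℝ) * X ^ (-(k : ℝ)) := ⟨_, rfl⟩
  rw [← hΘ, gsum_eq, ← hNd, h8B, show (2/3 * (1/8 * (1/(B:ℝ)))) = 1/12 * (1/(B:ℝ)) by ring]
  have hΘ0 : 0 ≤ Θ := by rw [hΘ]; positivity
  have hm := h α a q hq hc hα N hN _ rfl
  obtain ⟨Θ', hΘ'⟩ : ∃ Θ', Θ' = (q:ℝ)⁻¹ + ((N:ℝ) ^ 3)⁻¹ + q * ((N:ℝ) ^ k)⁻¹ := ⟨_, rfl⟩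
  rw [← hΘ'] at hm
  have hΘ'0 : 0 ≤ Θ' := by rw [hΘ']; positivity
  have h2k : (1:ℝ) ≤ 2 ^ k := one_le_pow₀ (by norm_num)
  have hpw : ∀ m : ℕ, m ≤ k → ((N:ℝ) ^ m)⁻¹ ≤ 2 ^ k * (X ^ m)⁻¹ := by
    intro m hm
    rw [← div_eq_mul_inv, inv_eq_one_div, div_le_div_iff₀ (by positivity) (by positivity), one_mul]
    calc X ^ m ≤ (2 * N) ^ m := by gcongr
      _ = 2 ^ m * (N:ℝ) ^ m := by rw [mul_pow]
      _ ≤ _ := by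
        gcongr
        norm_num
  have hTT : Θ' ≤ 2 ^ k * Θ := by
    have a1 := hpw 3 (by omega)
    have a2 := mul_le_mul_of_nonneg_left (hpw k le_rfl) hq0.le
    have a3 : (q:ℝ)⁻¹ ≤ 2 ^ k * (q:ℝ)⁻¹ := le_mul_of_one_le_left (by positivity) h2k
    rw [hΘ, hΘ', Real.rpow_neg hX0.le, Real.rpow_neg hX0.le, Real.rpow_natCast, show (3:ℝ) = ((3:ℕ):ℝ) by norm_num, Real.rpow_natCast]
    linarith
  have u1 : Θ' ^ (1/8:ℝ) ≤ 2 ^ (k + 1) * Θ ^ (1/8:ℝ) := by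
    calc _ ≤ (2 ^ (k + 1) * Θ) ^ (1/8:ℝ) := by
          gcongr
          refine hTT.trans ?_
          gcongr
          · norm_num
          · omega
      _ = (2 ^ (k + 1)) ^ (1/8:ℝ) * Θ ^ (1/8:ℝ) := Real.mul_rpow (by positivity) hΘ0
      _ ≤ _ := by
          gcongr
          exact rp_le_self (one_le_pow₀ (by norm_num)) (by norm_num)
  have u2 : (Θ' / N) ^ (1/12:ℝ) ≤ 2 ^ (k + 1) * (Θ / X) ^ (1/12:ℝ) := by
    calc _ ≤ (2 ^ (k + 1) * (Θ / X)) ^ (1/12:ℝ) := by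
          gcongr
          rw [div_le_iff₀ hN0]
          refine hTT.trans ?_
          have : 2 ^ (k + 1) * (Θ / X) * N = 2 ^ k * Θ * ((2 * N) / X) := by rw [pow_succ]; ring
          rw [this]
          refine le_mul_of_one_le_right (by positivity) ?_
          rwa [one_le_div hX0]
      _ = (2 ^ (k + 1)) ^ (1/12:ℝ) * (Θ / X) ^ (1/12:ℝ) := Real.mul_rpow (by positivity) (by positivity)
      _ ≤ _ := by
          gcongr
          exact rp_le_self (one_le_pow₀ (by norm_num)) (by norm_num)
  have hm2 : ‖∑ x ∈ Icc (1:ℤ) N, ee (α * (x:ℝ) ^ k)‖ ^ B ≤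
      (C * 2 ^ (k + 1)) * ((X ^ B * X ^ ε) * (Θ ^ (1/8:ℝ) + (Θ / X) ^ (1/12:ℝ))) := by
    calc _ ≤ _ := hm
      _ ≤ C * (X ^ B * X ^ ε * (2 ^ (k + 1) * Θ ^ (1/8:ℝ) + 2 ^ (k + 1) * (Θ / X) ^ (1/12:ℝ))) := by gcongr
      _ = _ := by ring
  have hr : ‖∑ x ∈ Icc (1:ℤ) N, ee (α * (x:ℝ) ^ k)‖ = (‖∑ x ∈ Icc (1:ℤ) N, ee (α * (x:ℝ) ^ k)‖ ^ B) ^ (1/(B:ℝ)) := by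
    rw [← Real.rpow_natCast, ← Real.rpow_mul (norm_nonneg _), mul_one_div_cancel hB0.ne', Real.rpow_one]
  rw [hr]
  have hXX : (X ^ B * X ^ ε) ^ (1/(B:ℝ)) ≤ X ^ (1 + ε) := by
    rw [← Real.rpow_natCast, ← Real.rpow_add hX0, ← Real.rpow_mul hX0.le]
    apply Real.rpow_le_rpow_of_exponent_le hX
    rw [mul_one_div, div_le_iff₀ hB0]
    nlinarith
  have hsub : (Θ ^ (1/8:ℝ) + (Θ / X) ^ (1/12:ℝ)) ^ (1/(B:ℝ)) ≤ Θ ^ (1/8 * (1/(B:ℝ))) + (Θ / X) ^ (1/12 * (1/(B:ℝ))) := by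
    rw [Real.rpow_mul hΘ0, Real.rpow_mul (by positivity)]
    exact Real.rpow_add_le_add_rpow (by positivity) (by positivity) (by positivity) (by rw [div_le_one hB0]; exact hB1')
  calc _ ≤ ((C * 2 ^ (k + 1)) * ((X ^ B * X ^ ε) * (Θ ^ (1/8:ℝ) + (Θ / X) ^ (1/12:ℝ)))) ^ (1/(B:ℝ)) := by gcongr
    _ = (C * 2 ^ (k + 1)) ^ (1/(B:ℝ)) * ((X ^ B * X ^ ε) ^ (1/(B:ℝ)) * (Θ ^ (1/8:ℝ) + (Θ / X) ^ (1/12:ℝ)) ^ (1/(B:ℝ))) := by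
        rw [Real.mul_rpow (x := C * 2 ^ (k + 1)) (by positivity) (by positivity), Real.mul_rpow (x := X ^ B * X ^ ε) (by positivity) (by positivity)]
    _ ≤ (C * 2 ^ (k + 1)) ^ (1/(B:ℝ)) * (X ^ (1 + ε) * (Θ ^ (1/8 * (1/(B:ℝ))) + (Θ / X) ^ (1/12 * (1/(B:ℝ))))) := by gcongr
    _ = _ := by ring
end WW

theorem wooley_weyl_refinement (k : ℕ) (hk : 6 ≤ k) (ε : ℝ) (hε : ε > 0) :
    ∃ C : ℝ, ∀ (α : ℝ) (a : ℤ) (q : ℕ),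
      0 < q → Int.gcd a q = 1 → |α - (a : ℝ) / q| ≤ ((q : ℝ) ^ 2)⁻¹ →
      ∀ X : ℝ, X ≥ 1 →
        ‖gsum k α X‖ ≤
          C * (X ^ (1 + ε) *
              ((q : ℝ)⁻¹ + X ^ (-(3 : ℝ)) + (q : ℝ) * X ^ (-(k : ℝ))) ^ ((2 : ℝ) ^ (-(k : ℝ))) +
            X ^ (1 + ε) *
              (((q : ℝ)⁻¹ + X ^ (-(3 : ℝ)) + (q : ℝ) * X ^ (-(k : ℝ))) / X) ^
                (2 / 3 * (2 : ℝ) ^ (-(k : ℝ)))) := by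
  exact WW.final k hk ε hε
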